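/- arXiv:1211.5031 — 2 statements merged into one kernel-verified Lean document; each statement's English description precedes it below -/
import Mathlib

section
/- Every simple graph G of maximum degree 7 has a 7-edge-colorable subgraph with at least (22/25)·|E(G)| edges. -/
/-- A proper edge coloring of (the edges of) `G` using colors `< k`. -/
def IsProperEdgeColoring {V : Type*} (G : SimpleGraph V) (k : ℕ) (c : Sym2 V → ℕ) : Prop :=
  (∀ e ∈ G.edgeSet, c e < k) ∧
  ∀ e₁ ∈ G.edgeSet, ∀ e₂ ∈ G.edgeSet, e₁ ≠ e₂ → (∃ v, v ∈ e₁ ∧ v ∈ e₂) → c e₁ ≠ c e₂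

set_option linter.unusedSectionVars false

namespace PartialColoring
open Finset Classical

variable {V : Type*} [Fintype V] {G : SimpleGraph V}

/-- A proper partial edge coloring of `G` with seven colors: `mate a` exchanges the ends of each
edge of color `a` and fixes the vertices at which `a` is missing. -/
structure PCol (G : SimpleGraph V) where
  mate : Fin 7 → V → V
  invol : ∀ a v, mate a (mate a v) = v
  adj : ∀ a v, mate a v ≠ v → G.Adj v (mate a v)
  inj : ∀ a b v, mate a v = mate b v → mate a v ≠ v → a = b

namespace PCol

/-- The graph of uncolored edges. -/
def U (π : PCol G) : SimpleGraph V where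
  Adj u v := G.Adj u v ∧ ∀ a, π.mate a u ≠ v
  symm := ⟨fun u v h => ⟨h.1.symm, fun a ha => h.2 a (by rw [← ha, π.invol])⟩⟩
  loopless := ⟨fun u h => G.loopless.irrefl u h.1⟩

/-- The colors missing at `v`. -/
noncomputable def miss (π : PCol G) (v : V) : Finset (Fin 7) :=
  univ.filter fun a => π.mate a v = v

/-- The uncolored degree. -/
noncomputable def d (π : PCol G) (v : V) : ℕ := #{u | π.U.Adj v u}

/-- The total number of missing colors. -/
noncomputable def defect (π : PCol G) : ℕ := ∑ v, #(π.miss v)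

/-- As many edges as possible are colored. -/
def Opt (π : PCol G) : Prop := ∀ π' : PCol G, π.defect ≤ π'.defect

variable {π π' : PCol G} {u v w x y z p q : V} {a b c e : Fin 7}

@[simp] lemma mem_miss : a ∈ π.miss v ↔ π.mate a v = v := by simp [miss]

lemma mate_eq_comm : π.mate a u = v ↔ π.mate a v = u :=
  ⟨fun h => by rw [← h, π.invol], fun h => by rw [← h, π.invol]⟩

lemma mate_inj : π.mate a u = π.mate a v ↔ u = v :=
  ⟨fun h => by rw [← π.invol a u, h, π.invol], fun h => by rw [h]⟩

lemma U_adj : π.U.Adj u v ↔ G.Adj u v ∧ ∀ a, π.mate a u ≠ v := Iff.rfl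

lemma d_pos : 0 < π.d v ↔ ∃ u, π.U.Adj v u := by
  simp [d, Finset.card_pos, Finset.Nonempty]

lemma d_pos_of_adj (h : π.U.Adj u v) : 0 < π.d u := d_pos.2 ⟨v, h⟩

/-- The number of colored edges at `v`. -/
lemma card_colored_add_miss (π : PCol G) (v : V) :
    #{a | π.mate a v ≠ v} + #(π.miss v) = 7 := by
  rw [add_comm]
  simpa [miss] using Finset.card_filter_add_card_filter_not (s := (univ : Finset (Fin 7)))
    (fun a => π.mate a v = v)

lemma degree_eq (π : PCol G) (v : V) :
    (G.neighborSet v).ncard = #{a | π.mate a v ≠ v} + π.d v := by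
  have h1 : #{a | π.mate a v ≠ v} = #(({a | π.mate a v ≠ v} : Finset (Fin 7)).image
      fun a => π.mate a v) := by
    rw [card_image_of_injOn]
    intro a ha b _ hab
    exact π.inj a b v hab (by simpa using ha)
  rw [h1, d, ← card_union_of_disjoint, ← Set.ncard_coe_finset]
  · congr 1
    ext u
    simp only [SimpleGraph.mem_neighborSet, coe_union, coe_image, coe_filter, mem_univ, true_and,
      Set.mem_union, Set.mem_image, Set.mem_ofPred_eq, U_adj]
    constructor
    · intro h
      by_cases h' : ∃ a, π.mate a v = u
      · obtain ⟨a, ha⟩ := h'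
        exact Or.inl ⟨a, by rw [ha]; exact h.ne', ha⟩
      · push Not at h'
        exact Or.inr ⟨h, h'⟩
    · rintro (⟨a, ha, rfl⟩ | h)
      · exact π.adj a v ha
      · exact h.1
  · rw [Finset.disjoint_left]
    simp only [mem_image, mem_filter, mem_univ, true_and, U_adj]
    rintro u ⟨a, ha, rfl⟩ h
    exact h.2 a rfl

lemma d_le_miss (hG : ∀ v, (G.neighborSet v).ncard ≤ 7) (π : PCol G) (v : V) :
    π.d v ≤ #(π.miss v) := by
  have h1 := hG v
  have h2 := π.card_colored_add_miss v
  have h3 := π.degree_eq v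
  omega

lemma exists_miss (hG : ∀ v, (G.neighborSet v).ncard ≤ 7) (h : π.U.Adj u v) :
    ∃ a, π.mate a u = u := by
  have h1 := d_le_miss hG π u
  have h2 := d_pos_of_adj h
  obtain ⟨a, ha⟩ := Finset.card_pos.1 (lt_of_lt_of_le h2 h1)
  exact ⟨a, mem_miss.1 ha⟩

lemma sum_two_points {f g : V → ℕ} (hxz : x ≠ z) (h : ∀ v, v ≠ x → v ≠ z → f v = g v) :
    ∑ v, f v + g x + g z = ∑ v, g v + f x + f z := by
  have hz : z ∈ (univ : Finset V).erase x := by simp [hxz.symm]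
  rw [← add_sum_erase univ f (mem_univ x), ← add_sum_erase univ g (mem_univ x),
    ← add_sum_erase _ f hz, ← add_sum_erase _ g hz]
  have : ∑ v ∈ (univ.erase x).erase z, f v = ∑ v ∈ (univ.erase x).erase z, g v := by
    refine sum_congr rfl fun v hv => h v ?_ ?_ <;> simp at hv <;> tauto
  omega

/-- Two adjacent vertices of the uncolored graph of an optimal coloring miss no common color. -/
lemma Opt.no_common_adj (hO : π.Opt) (hU : π.U.Adj x y) (hx : π.mate c x = x)
    (hy : π.mate c y = y) : False := by
  have hxy : x ≠ y := hU.ne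
  let f : Fin 7 → V → V := fun a v =>
    if a = c then (if v = x then y else if v = y then x else π.mate c v) else π.mate a v
  have key : ∀ v, v ≠ x → v ≠ y → π.mate c v ≠ x ∧ π.mate c v ≠ y := by
    intro v h1 h2
    constructor
    · intro h; rw [mate_eq_comm, hx] at h; exact h1 h.symm
    · intro h; rw [mate_eq_comm, hy] at h; exact h2 h.symm
  let π' : PCol G :=
    { mate := f
      invol := by
        intro a v
        simp only [f]
        by_cases ha : a = c
        · by_cases h1 : v = x
          · simp [ha, h1, hxy.symm]
          · by_cases h2 : v = y
            · simp [ha, h2, hxy.symm]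
            · simp [ha, h1, h2, key v h1 h2, π.invol]
        · simp [ha, π.invol]
      adj := by
        intro a v
        simp only [f]
        split_ifs with ha h1 h2
        · subst h1; exact fun _ => hU.1
        · subst h2; exact fun _ => hU.1.symm
        · exact π.adj c v
        · exact π.adj a v
      inj := by
        intro a b v
        simp only [f]
        have e1 := hU.2
        have e2 := hU.symm.2
        by_cases ha : a = c <;> by_cases hb : b = c
        · simp [ha, hb]
        · by_cases h1 : v = x
          · subst h1; simp only [ha, hb, if_true, if_false]
            intro h; exact absurd h.symm (e1 b)
          · by_cases h2 : v = y
            · subst h2; simp only [ha, hb, if_true, if_false, h1]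
              intro h; exact absurd h.symm (e2 b)
            · simp only [ha, hb, h1, h2, if_true, if_false]
              exact π.inj c b v
        · by_cases h1 : v = x
          · subst h1; simp only [ha, hb, if_true, if_false]
            intro h; exact absurd h (e1 a)
          · by_cases h2 : v = y
            · subst h2; simp only [ha, hb, if_true, if_false, h1]
              intro h; exact absurd h (e2 a)
            · simp only [ha, hb, h1, h2, if_true, if_false]
              exact fun h h' => ha (π.inj a c v h h')
        · simp only [ha, hb, if_false]
          exact π.inj a b v }
  have h1 := hO π'
  have hm : ∀ v, v ≠ x → v ≠ y → #(π'.miss v) = #(π.miss v) := by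
    intro v hv1 hv2
    congr 1
    ext a
    simp only [mem_miss, π', f, hv1, hv2, if_false]
    split_ifs with ha <;> simp_all
  have h2 := sum_two_points hxy hm
  have h3 : #(π'.miss x) < #(π.miss x) := by
    apply card_lt_card
    rw [Finset.ssubset_iff_of_subset]
    · exact ⟨c, by simpa using hx, by simp [π', f, hxy.symm]⟩
    · intro a
      simp only [mem_miss, π', f, if_true]
      split_ifs with ha
      · intro h; exact absurd h hxy.symm
      · exact id
  have h4 : #(π'.miss y) < #(π.miss y) := by
    apply card_lt_card
    rw [Finset.ssubset_iff_of_subset]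
    · exact ⟨c, by simpa using hy, by simp [π', f, hxy.symm, hxy]⟩
    · intro a
      simp only [mem_miss, π', f, if_true, hxy.symm, if_false]
      split_ifs with ha
      · intro h; exact absurd h hxy
      · exact id
  simp only [defect] at h1
  omega

end PCol
end PartialColoring

namespace PartialColoring
open Finset Classical

variable {V : Type*} [Fintype V] {G : SimpleGraph V}

namespace PCol
variable {π π' : PCol G} {u v w x y z p q : V} {a b c e : Fin 7}

/-- `π'` is obtained from `π` by giving the uncolored edge `x y` the color `c` that the edge `y z`
had before, and by removing the color of `y z`. -/
structure IsShift (π π' : PCol G) (x y z : V) (c : Fin 7) : Prop where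
  hU : π.U.Adj x y
  hx : π.mate c x = x
  hy : π.mate c y = z
  hzy : z ≠ y
  mate_x : π'.mate c x = y
  mate_y : π'.mate c y = x
  mate_z : π'.mate c z = z
  mate_of_ne : ∀ v, v ≠ x → v ≠ y → v ≠ z → π'.mate c v = π.mate c v
  mate_of_color_ne : ∀ a, a ≠ c → ∀ v, π'.mate a v = π.mate a v

lemma exists_shift (hU : π.U.Adj x y) (hx : π.mate c x = x) (hy : π.mate c y = z) (hzy : z ≠ y) :
    ∃ π' : PCol G, IsShift π π' x y z c := by
  have hxy : x ≠ y := hU.ne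
  have hzx : z ≠ x := by rintro rfl; rw [mate_eq_comm, hx] at hy; exact hzy hy
  have hz : π.mate c z = y := mate_eq_comm.1 hy
  let f : Fin 7 → V → V := fun a v =>
    if a = c then (if v = x then y else if v = y then x else if v = z then z else π.mate c v)
    else π.mate a v
  have key : ∀ v, v ≠ x → v ≠ y → v ≠ z →
      π.mate c v ≠ x ∧ π.mate c v ≠ y ∧ π.mate c v ≠ z := by
    intro v h1 h2 h3
    refine ⟨?_, ?_, ?_⟩
    · intro h; rw [mate_eq_comm, hx] at h; exact h1 h.symm
    · intro h; rw [mate_eq_comm, hy] at h; exact h3 h.symm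
    · intro h; rw [mate_eq_comm, hz] at h; exact h2 h.symm
  let π' : PCol G :=
    { mate := f
      invol := by
        intro a v
        simp only [f]
        by_cases ha : a = c
        · by_cases h1 : v = x
          · simp [ha, h1, hxy.symm]
          · by_cases h2 : v = y
            · simp [ha, h2, hxy.symm]
            · by_cases h3 : v = z
              · simp [ha, h3, hzx, hzy]
              · simp [ha, h1, h2, h3, key v h1 h2, π.invol]
        · simp [ha, π.invol]
      adj := by
        intro a v
        simp only [f]
        split_ifs with ha h1 h2 h3
        · subst h1; exact fun _ => hU.1
        · subst h2; exact fun _ => hU.1.symm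
        · exact fun h => absurd h3.symm h
        · exact π.adj c v
        · exact π.adj a v
      inj := by
        intro a b v
        simp only [f]
        have e1 := hU.2
        have e2 := hU.symm.2
        by_cases ha : a = c <;> by_cases hb : b = c
        · simp [ha, hb]
        · simp only [ha, hb, if_true, if_false]
          by_cases h1 : v = x
          · subst h1; simp only [if_true]
            intro h; exact absurd h.symm (e1 b)
          · by_cases h2 : v = y
            · subst h2; simp only [if_true, if_false, h1]
              intro h; exact absurd h.symm (e2 b)
            · by_cases h3 : v = z
              · simp [h3, hzx, hzy]
              · simp only [h1, h2, h3, if_false]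
                exact π.inj c b v
        · simp only [ha, hb, if_true, if_false]
          by_cases h1 : v = x
          · subst h1; simp only [if_true]
            intro h; exact absurd h (e1 a)
          · by_cases h2 : v = y
            · subst h2; simp only [if_true, if_false, h1]
              intro h; exact absurd h (e2 a)
            · by_cases h3 : v = z
              · subst h3; simp only [hzx, hzy, if_true, if_false]
                intro h h'; exact absurd h h'
              · simp only [h1, h2, h3, if_false]
                exact fun h h' => ha (π.inj a c v h h')
        · simp only [ha, hb, if_false]
          exact π.inj a b v }
  refine ⟨π', hU, hx, hy, hzy, ?_, ?_, ?_, ?_, ?_⟩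
  · simp [π', f]
  · simp [π', f, hxy.symm]
  · simp [π', f, hzx, hzy]
  · intro v h1 h2 h3; simp [π', f, h1, h2, h3]
  · intro a ha v; simp [π', f, ha]

namespace IsShift
variable (s : IsShift π π' x y z c)
include s

lemma hxy : x ≠ y := s.hU.ne

lemma hzx : z ≠ x := by
  rintro rfl
  have := s.hy
  rw [mate_eq_comm, s.hx] at this
  exact s.hzy this

lemma hz : π.mate c z = y := mate_eq_comm.1 s.hy

lemma mate_eq (h1 : v ≠ x) (h2 : v ≠ y) (h3 : v ≠ z) (a : Fin 7) :
    π'.mate a v = π.mate a v := by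
  by_cases ha : a = c
  · subst ha; exact s.mate_of_ne v h1 h2 h3
  · exact s.mate_of_color_ne a ha v

lemma U_yz : π'.U.Adj y z := by
  refine ⟨by have := π.adj c y (by rw [s.hy]; exact s.hzy); rwa [s.hy] at this, fun a ha => ?_⟩
  by_cases hac : a = c
  · subst hac; rw [s.mate_y] at ha; exact s.hzx ha.symm
  · rw [s.mate_of_color_ne a hac] at ha
    exact hac (π.inj a c y (by rw [ha, s.hy]) (by rw [ha]; exact s.hzy))

lemma not_U : ¬ π'.U.Adj x y := fun h => h.2 c s.mate_x

lemma not_U_old : ¬ π.U.Adj y z := fun h => h.2 c s.hy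

lemma U_of_ne (h : s(u, v) ≠ s(x, y)) (h' : s(u, v) ≠ s(y, z)) :
    π'.U.Adj u v ↔ π.U.Adj u v := by
  rw [U_adj, U_adj]
  refine and_congr_right fun hG => forall_congr' fun a => not_congr ?_
  by_cases ha : a = c
  · subst ha
    have hz := s.hz
    have hx := s.hx
    have hy := s.hy
    have m1 := s.mate_x
    have m2 := s.mate_y
    have m3 := s.mate_z
    have huv := hG.ne
    simp only [ne_eq, Sym2.eq_iff, not_or, not_and] at h h'
    by_cases h1 : u = x
    · subst h1; rw [m1, hx]
      exact ⟨fun e => absurd e.symm (h.1 rfl), fun e => absurd e huv⟩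
    · by_cases h2 : u = y
      · subst h2; rw [m2, hy]
        exact ⟨fun e => absurd e.symm (h.2 rfl), fun e => absurd e.symm (h'.1 rfl)⟩
      · by_cases h3 : u = z
        · subst h3; rw [m3, hz]
          exact ⟨fun e => absurd e huv, fun e => absurd e.symm (h'.2 rfl)⟩
        · rw [s.mate_of_ne u h1 h2 h3]
  · rw [s.mate_of_color_ne a ha]

lemma U_iff : π'.U.Adj u v ↔ (π.U.Adj u v ∧ s(u, v) ≠ s(x, y)) ∨ s(u, v) = s(y, z) := by
  by_cases h' : s(u, v) = s(y, z)
  · simp only [h', or_true, iff_true]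
    rw [← SimpleGraph.mem_edgeSet, h', SimpleGraph.mem_edgeSet]
    exact s.U_yz
  · by_cases h : s(u, v) = s(x, y)
    · simp only [h, ne_eq, not_true, and_false, false_or]
      rw [← SimpleGraph.mem_edgeSet, h, SimpleGraph.mem_edgeSet]
      simp only [s.not_U, false_iff]
      rw [Sym2.eq_iff]
      have := s.hzx
      have := s.hxy
      tauto
    · rw [s.U_of_ne h h']; tauto

lemma U_mono (h : π.U.Adj u v) (hne : s(u, v) ≠ s(x, y)) : π'.U.Adj u v :=
  s.U_iff.2 (Or.inl ⟨h, hne⟩)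

lemma miss_eq (h1 : v ≠ x) (h3 : v ≠ z) : π'.miss v = π.miss v := by
  ext a
  simp only [mem_miss]
  by_cases h2 : v = y
  · subst h2
    by_cases ha : a = c
    · subst ha; rw [s.mate_y, s.hy]; simp [s.hxy, s.hzy]
    · rw [s.mate_of_color_ne a ha]
  · rw [s.mate_eq h1 h2 h3]

lemma miss_x : π'.miss x = (π.miss x).erase c := by
  ext a
  simp only [mem_miss, mem_erase]
  by_cases ha : a = c
  · subst ha; simp [s.mate_x, s.hxy.symm]
  · rw [s.mate_of_color_ne a ha]; tauto

lemma miss_z : π'.miss z = insert c (π.miss z) := by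
  ext a
  simp only [mem_miss, mem_insert]
  by_cases ha : a = c
  · subst ha; simp [s.mate_z]
  · rw [s.mate_of_color_ne a ha]; tauto

lemma card_miss_x : #(π'.miss x) + 1 = #(π.miss x) := by
  rw [s.miss_x, card_erase_add_one]
  simpa using s.hx

lemma card_miss_z : #(π'.miss z) = #(π.miss z) + 1 := by
  rw [s.miss_z, card_insert_of_notMem]
  simpa [s.hz] using s.hzy.symm

lemma defect_eq : π'.defect = π.defect := by
  have h := sum_two_points (f := fun v => #(π'.miss v)) (g := fun v => #(π.miss v)) s.hzx.symm
    (fun v h1 h2 => by rw [s.miss_eq h1 h2])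
  have h1 := s.card_miss_x
  have h2 := s.card_miss_z
  simp only [defect]
  omega

lemma opt (hO : π.Opt) : π'.Opt := fun π'' => by rw [s.defect_eq]; exact hO π''

lemma d_x : π'.d x + 1 = π.d x := by
  have hne := s.hU.ne
  have hzx := s.hzx
  rw [d, d, ← card_erase_add_one (s := ({u | π.U.Adj x u} : Finset V)) (a := y)
    (by simpa using s.hU)]
  congr 2
  ext u
  simp only [mem_filter, mem_univ, true_and, mem_erase, s.U_iff]
  simp only [ne_eq, Sym2.eq_iff]
  tauto

lemma d_z : π'.d z = π.d z + 1 := by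
  have hne := s.hU.ne
  have hzx := s.hzx
  have hzy := s.hzy
  have h := s.not_U_old
  rw [d, d, ← card_insert_of_notMem (s := ({u | π.U.Adj z u} : Finset V)) (a := y)
    (by simpa [SimpleGraph.adj_comm] using h)]
  congr 1
  ext u
  simp only [mem_filter, mem_univ, true_and, mem_insert, s.U_iff]
  simp only [ne_eq, Sym2.eq_iff]
  tauto

lemma d_y : π'.d y = π.d y := by
  have hne := s.hU.ne
  have hzx := s.hzx
  have hzy := s.hzy
  have h := s.not_U_old
  have h1 : ({u | π'.U.Adj y u} : Finset V) = insert z (({u | π.U.Adj y u} : Finset V).erase x) := by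
    ext u
    simp only [mem_filter, mem_univ, true_and, mem_insert, mem_erase, s.U_iff]
    simp only [ne_eq, Sym2.eq_iff]
    tauto
  rw [d, d, h1, card_insert_of_notMem (by simp [h]), card_erase_add_one]
  simpa using s.hU.symm

lemma d_eq (h1 : v ≠ x) (h3 : v ≠ z) : π'.d v = π.d v := by
  by_cases h2 : v = y
  · rw [h2, s.d_y]
  · rw [d, d]
    congr 1
    ext u
    simp only [mem_filter, mem_univ, true_and, s.U_iff]
    simp only [ne_eq, Sym2.eq_iff]
    tauto

end IsShift
end PCol
end PartialColoring

namespace PartialColoring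
open Finset Classical

/-- The union of the two alternating paths from a fixed point `y` of the involution `σ`, taken
along `σ` and `τ`: it has at most one other end. -/
lemma exists_alternating_orbit {V : Type*} (σ τ : Equiv.Perm V) (hσ : σ * σ = 1) (hτ : τ * τ = 1)
    {y : V} (hy : σ y = y) :
    ∃ S : Set V, y ∈ S ∧ (∀ v ∈ S, σ v ∈ S ∧ τ v ∈ S) ∧
      ∀ u ∈ S, ∀ v ∈ S, u ≠ y → v ≠ y → (σ u = u ∨ τ u = u) → (σ v = v ∨ τ v = v) → u = v := by
  set ρ := σ * τ with hρ
  have hσi : σ⁻¹ = σ := inv_eq_of_mul_eq_one_left hσ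
  have hτi : τ⁻¹ = τ := inv_eq_of_mul_eq_one_left hτ
  have hconj : σ * ρ * σ⁻¹ = ρ⁻¹ := by
    rw [hρ, mul_inv_rev, hσi, hτi, ← mul_assoc, hσ, one_mul]
  have e1 : ∀ k : ℤ, σ ((ρ ^ k) y) = (ρ ^ (-k)) y := by
    intro k
    have : σ * ρ ^ k * σ⁻¹ = ρ ^ (-k) := by rw [← conj_zpow, hconj, inv_zpow, zpow_neg]
    have h := congrArg (fun f : Equiv.Perm V => f y) this
    simp only [Equiv.Perm.mul_apply, hσi, hy] at h
    exact h
  have e2 : ∀ k : ℤ, τ ((ρ ^ k) y) = (ρ ^ (-k - 1)) y := by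
    intro k
    have h : τ = σ * ρ := by rw [hρ, ← mul_assoc, hσ, one_mul]
    rw [show -k - 1 = -(1 + k) by ring, ← e1, zpow_add, zpow_one, h]
    rfl
  have key : ∀ n : ℤ, (ρ ^ n) y = y ↔ (Function.minimalPeriod (ρ • ·) y : ℤ) ∣ n := by
    intro n
    rw [← MulAction.zpow_smul_eq_iff_minimalPeriod_dvd]
    rfl
  set P : ℤ := (Function.minimalPeriod (ρ • ·) y : ℤ)
  have shift : ∀ i j : ℤ, (ρ ^ i) y = (ρ ^ j) y ↔ P ∣ i - j := by
    intro i j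
    rw [← key, sub_eq_add_neg, add_comm, zpow_add, Equiv.Perm.mul_apply, zpow_neg,
      Equiv.Perm.inv_eq_iff_eq, eq_comm]
  refine ⟨{v | ∃ k : ℤ, (ρ ^ k) y = v}, ⟨0, rfl⟩, ?_, ?_⟩
  · rintro v ⟨k, rfl⟩
    exact ⟨⟨-k, (e1 k).symm⟩, ⟨-k - 1, (e2 k).symm⟩⟩
  · rintro u ⟨i, rfl⟩ v ⟨j, rfl⟩ hu hv h1 h2
    rw [ne_eq, key] at hu hv
    rw [shift]
    rw [e1, e2, shift, shift] at h1 h2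
    have h1' : P ∣ 2 * i ∨ P ∣ 2 * i + 1 := by
      refine h1.imp (fun h => ?_) (fun h => ?_)
      · obtain ⟨t, ht⟩ := h; exact ⟨-t, by linarith⟩
      · obtain ⟨t, ht⟩ := h; exact ⟨-t, by linarith⟩
    have h2' : P ∣ 2 * j ∨ P ∣ 2 * j + 1 := by
      refine h2.imp (fun h => ?_) (fun h => ?_)
      · obtain ⟨t, ht⟩ := h; exact ⟨-t, by linarith⟩
      · obtain ⟨t, ht⟩ := h; exact ⟨-t, by linarith⟩
    have odd_case : ∀ i j : ℤ, P ∣ 2 * i + 1 → P ∣ 2 * j → P ∣ j := by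
      intro i j h h'
      have : j = j * (2 * i + 1) - i * (2 * j) := by ring
      rw [this]
      exact dvd_sub (h.mul_left _) (h'.mul_left _)
    rcases h1' with h1' | h1' <;> rcases h2' with h2' | h2'
    · obtain ⟨s, hs⟩ := h1'
      obtain ⟨t, ht⟩ := h2'
      have hs2 : ¬ Even s := by
        rintro ⟨r, rfl⟩
        exact hu ⟨r, by linarith⟩
      have ht2 : ¬ Even t := by
        rintro ⟨r, rfl⟩
        exact hv ⟨r, by linarith⟩
      rw [Int.not_even_iff_odd] at hs2 ht2
      obtain ⟨s', rfl⟩ := hs2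
      obtain ⟨t', rfl⟩ := ht2
      exact ⟨s' - t', by linarith⟩
    · exact absurd (odd_case _ _ h2' h1') hu
    · exact absurd (odd_case _ _ h1' h2') hv
    · refine odd_case i (i - j) h1' ?_
      have := dvd_sub h1' h2'
      rwa [show 2 * i + 1 - (2 * j + 1) = 2 * (i - j) by ring] at this

variable {V : Type*} [Fintype V] {G : SimpleGraph V}

namespace PCol
variable {π π' : PCol G} {u v w x y z p q : V} {a b c e : Fin 7}

/-- `π'` is obtained from `π` by exchanging the colors `a` and `b` on the set `S`. -/
structure IsKempe (π π' : PCol G) (S : Set V) (a b : Fin 7) : Prop where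
  on : ∀ v ∈ S, ∀ e, π'.mate e v = π.mate (Equiv.swap a b e) v
  off : ∀ v ∉ S, ∀ e, π'.mate e v = π.mate e v

lemma exists_kempe (π : PCol G) (S : Set V) (a b : Fin 7)
    (hS : ∀ v ∈ S, π.mate a v ∈ S ∧ π.mate b v ∈ S) : ∃ π' : PCol G, IsKempe π π' S a b := by
  let f : Fin 7 → V → V := fun e v => if v ∈ S then π.mate (Equiv.swap a b e) v else π.mate e v
  have hS' : ∀ v ∉ S, π.mate a v ∉ S ∧ π.mate b v ∉ S := by
    intro v hv
    refine ⟨fun h => hv ?_, fun h => hv ?_⟩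
    · simpa [π.invol] using (hS _ h).1
    · simpa [π.invol] using (hS _ h).2
  have hsw : ∀ e, e = a ∨ e = b ∨ Equiv.swap a b e = e := by
    intro e
    by_cases h1 : e = a
    · exact Or.inl h1
    · by_cases h2 : e = b
      · exact Or.inr (Or.inl h2)
      · exact Or.inr (Or.inr (Equiv.swap_apply_of_ne_of_ne h1 h2))
  refine ⟨⟨f, ?_, ?_, ?_⟩, ?_, ?_⟩
  · intro e v
    simp only [f]
    rcases hsw e with rfl | rfl | h
    · by_cases hv : v ∈ S
      · simp [hv, hS v hv, π.invol]
      · simp [hv, hS' v hv, π.invol]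
    · by_cases hv : v ∈ S
      · simp [hv, hS v hv, π.invol]
      · simp [hv, hS' v hv, π.invol]
    · simp [h, π.invol]
  · intro e v
    simp only [f]
    split_ifs
    · exact π.adj _ v
    · exact π.adj _ v
  · intro e e' v
    simp only [f]
    split_ifs
    · intro h h'
      exact (Equiv.swap a b).injective (π.inj _ _ v h h')
    · exact π.inj e e' v
  · intro v hv e
    simp [f, hv]
  · intro v hv e
    simp [f, hv]

namespace IsKempe
variable {S : Set V} (s : IsKempe π π' S a b)
include s

lemma U_eq : π'.U = π.U := by
  ext u v
  rw [U_adj, U_adj]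
  refine and_congr_right fun _ => ?_
  by_cases hu : u ∈ S
  · simp only [s.on u hu]
    exact (Equiv.swap a b).forall_congr_left.trans (by simp)
  · simp only [s.off u hu]

lemma card_miss (v : V) : #(π'.miss v) = #(π.miss v) := by
  by_cases hv : v ∈ S
  · rw [← card_map (Equiv.swap a b).toEmbedding (s := π'.miss v)]
    congr 1
    ext e
    simp only [mem_map_equiv, mem_miss, s.on v hv, Equiv.symm_swap, Equiv.swap_apply_self]
  · congr 1
    ext e
    simp [s.off v hv]

lemma defect_eq : π'.defect = π.defect := by simp only [defect, s.card_miss]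

lemma opt (hO : π.Opt) : π'.Opt := fun π'' => by rw [s.defect_eq]; exact hO π''

lemma mate_of_ne (ha : e ≠ a) (hb : e ≠ b) (v : V) : π'.mate e v = π.mate e v := by
  by_cases hv : v ∈ S
  · rw [s.on v hv, Equiv.swap_apply_of_ne_of_ne ha hb]
  · rw [s.off v hv]

end IsKempe

/-- The involution `mate a` as a permutation. -/
def perm (π : PCol G) (a : Fin 7) : Equiv.Perm V := ⟨π.mate a, π.mate a, π.invol a, π.invol a⟩

lemma exists_orbit (π : PCol G) (b : Fin 7) (hy : π.mate a y = y) :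
    ∃ S : Set V, y ∈ S ∧ (∀ v ∈ S, π.mate a v ∈ S ∧ π.mate b v ∈ S) ∧
      ∀ u ∈ S, ∀ v ∈ S, u ≠ y → v ≠ y → (π.mate a u = u ∨ π.mate b u = u) →
        (π.mate a v = v ∨ π.mate b v = v) → u = v :=
  exists_alternating_orbit (π.perm a) (π.perm b) (Equiv.ext (π.invol a)) (Equiv.ext (π.invol b)) hy

variable (hG : ∀ v, (G.neighborSet v).ncard ≤ 7)
include hG

/-- Components of the uncolored graph of an optimal coloring are elementary. -/
lemma Opt.no_common (hO : π.Opt) (hr : π.U.Reachable u v) (huv : u ≠ v)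
    (hu : π.mate a u = u) (hv : π.mate a v = v) : False := by
  obtain ⟨p⟩ := hr
  suffices H : ∀ (H : SimpleGraph V) (u v : V) (_ : H.Walk u v) (π : PCol G), π.Opt → π.U = H →
      u ≠ v → π.mate a u = u → π.mate a v = v → False from H _ u v p π hO rfl huv hu hv
  clear! u v π
  intro H u v p
  induction p with
  | nil => intro π _ _ h; exact absurd rfl h
  | @cons u w v h p ih =>
    intro π hO hH huv hu hv
    have hadj : π.U.Adj u w := by rw [hH]; exact h
    by_cases hwv : w = v
    · subst hwv; exact hO.no_common_adj hadj hu hv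
    obtain ⟨b, hb⟩ := exists_miss hG hadj.symm
    obtain ⟨S, hwS, hS, huniq⟩ := π.exists_orbit a hb
    obtain ⟨π', s⟩ := π.exists_kempe S b a hS
    have hw' : π'.mate a w = w := by rw [s.on w hwS]; simpa using hb
    by_cases huS : u ∈ S
    · have hvS : v ∉ S := fun hvS =>
        huv (huniq u huS v hvS hadj.ne (Ne.symm hwv) (Or.inr hu) (Or.inr hv))
      exact ih π' (s.opt hO) (by rw [s.U_eq, hH]) hwv hw' (by rw [s.off v hvS, hv])
    · exact (s.opt hO).no_common_adj (by rw [s.U_eq]; exact hadj) (by rw [s.off u huS, hu]) hw'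

/-- In a component of the uncolored graph, a color missing at `p` can be made missing at `y`. -/
lemma Opt.exists_kempe_chain (hO : π.Opt) (hr : π.U.Reachable y p) (hyp : y ≠ p)
    (hy : π.mate a y = y) (hp : π.mate e p = p) :
    ∃ π' : PCol G, π'.Opt ∧ π'.U = π.U ∧ π'.mate e y = y ∧
      (∀ b, b ≠ a → b ≠ e → ∀ v, π'.mate b v = π.mate b v) ∧
      ∀ v, v ≠ y → v ≠ p → π'.miss v = π.miss v := by
  obtain ⟨S, hyS, hS, huniq⟩ := π.exists_orbit e hy
  obtain ⟨π', s⟩ := π.exists_kempe S a e hS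
  have hy' : π'.mate e y = y := by rw [s.on y hyS]; simpa using hy
  have hpS : p ∈ S := by
    by_contra hpS
    exact (s.opt hO).no_common hG (by rw [s.U_eq]; exact hr) hyp hy' (by rw [s.off p hpS, hp])
  refine ⟨π', s.opt hO, s.U_eq, hy', fun b hb hb' v => s.mate_of_ne hb hb' v, ?_⟩
  intro v hvy hvp
  ext b
  simp only [mem_miss]
  by_cases hvS : v ∈ S
  · have h1 : π.mate a v ≠ v := fun h =>
      hvp (huniq v hvS p hpS hvy hyp.symm (Or.inl h) (Or.inr hp))
    have h2 : π.mate e v ≠ v := fun h =>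
      hvp (huniq v hvS p hpS hvy hyp.symm (Or.inr h) (Or.inr hp))
    rw [s.on v hvS]
    by_cases hba : b = a
    · subst hba; simp [h1, h2]
    · by_cases hbe : b = e
      · subst hbe; simp [h1, h2]
      · rw [Equiv.swap_apply_of_ne_of_ne hba hbe]
  · rw [s.off v hvS]

end PCol
end PartialColoring

namespace PartialColoring
open Finset Classical

lemma reachable_iff_of_adj_iff {V : Type*} {H H' : SimpleGraph V} {S : Set V} {x : V} (hx : x ∈ S)
    (hS : ∀ u ∈ S, ∀ v, H.Adj u v → v ∈ S)
    (h : ∀ u ∈ S, ∀ v, H'.Adj u v ↔ H.Adj u v) (w : V) :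
    H'.Reachable x w ↔ H.Reachable x w := by
  simp only [SimpleGraph.reachable_iff_reflTransGen]
  have key : ∀ w, Relation.ReflTransGen H.Adj x w → w ∈ S := by
    intro w hw
    induction hw with
    | refl => exact hx
    | tail _ h' ih => exact hS _ ih _ h'
  constructor
  · intro hw
    induction hw with
    | refl => exact .refl
    | tail _ h' ih => exact ih.tail ((h _ (key _ ih) _).1 h')
  · intro hw
    induction hw with
    | refl => exact .refl
    | tail hw' h' ih => exact ih.tail ((h _ (key _ hw') _).2 h')

lemma mem_of_reachable {V : Type*} {H : SimpleGraph V} {S : Set V} {x w : V} (hx : x ∈ S)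
    (hS : ∀ u ∈ S, ∀ v, H.Adj u v → v ∈ S) (h : H.Reachable x w) : w ∈ S := by
  rw [SimpleGraph.reachable_iff_reflTransGen] at h
  induction h with
  | refl => exact hx
  | tail _ h' ih => exact hS _ ih _ h'

variable {V : Type*} [Fintype V] {G : SimpleGraph V}

namespace PCol
variable {π π' π₀ : PCol G} {u v w x y z p q r x₀ x' : V} {a b c e k : Fin 7}

/-- All colors but at most one are missing in the component of `x`. -/
def Big (π : PCol G) (x : V) : Prop :=
  ∃ k, ∀ e, e ≠ k → ∃ p, π.U.Reachable x p ∧ π.mate e p = p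

lemma Big.of_reachable (h : π.Big x) (hr : π.U.Reachable x y) : π.Big y := by
  obtain ⟨k, hk⟩ := h
  exact ⟨k, fun e he => (hk e he).imp fun p hp => ⟨hr.symm.trans hp.1, hp.2⟩⟩

section
variable (hG : ∀ v, (G.neighborSet v).ncard ≤ 7)
include hG

lemma Opt.not_miss_of_attach (hO : π.Opt) (hU : π.U.Adj x y) (hx : π.mate c x = x)
    (hy : π.mate c y = q) (hqy : q ≠ y) (hr : ¬ π.U.Reachable x q) (hp : π.U.Reachable x p)
    (he : π.mate e p = p) (hqr : q = r ∨ π.U.Adj q r) : π.mate e r ≠ r := by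
  intro her
  have hqr' : π.U.Reachable q r := by
    rcases hqr with rfl | h
    · exact .rfl
    · exact h.reachable
  have hrx : ∀ v, π.U.Reachable x v → r ≠ v := by
    rintro v hv rfl
    exact hr (hv.trans hqr'.symm)
  have hqx : ∀ v, π.U.Reachable x v → q ≠ v := by
    rintro v hv rfl
    exact hr hv
  by_cases hec : e = c
  · subst hec
    have hne : q ≠ r := by
      rintro rfl
      rw [← mate_eq_comm.1 hy] at hqy
      exact hqy her.symm
    obtain ⟨π', s⟩ := exists_shift hU hx hy hqy
    have h1 := hqr.resolve_left hne
    refine (s.opt hO).no_common_adj (s.U_mono h1 ?_) s.mate_z ?_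
    · have := hrx x .rfl
      have := hqx x .rfl
      simp only [ne_eq, Sym2.eq_iff]
      tauto
    · rw [s.mate_eq (hrx x .rfl) (hrx y hU.reachable) hne.symm, her]
  · suffices H : ∀ π' : PCol G, π'.Opt → π'.U = π.U → π'.mate c x = x → π'.mate c y = q →
        π'.mate e y = y → π'.mate e r = r → False by
      by_cases hyp : y = p
      · exact H π hO rfl hx hy (by rw [hyp, he]) her
      · obtain ⟨d, hd⟩ := exists_miss hG hU.symm
        obtain ⟨π', h1, h2, h3, h4, h5⟩ := hO.exists_kempe_chain hG
          (hU.symm.reachable.trans hp) hyp hd he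
        have hcd : c ≠ d := by rintro rfl; rw [hd] at hy; exact hqy hy.symm
        refine H π' h1 h2 (by rw [h4 c hcd (Ne.symm hec), hx])
          (by rw [h4 c hcd (Ne.symm hec), hy]) h3 ?_
        rw [← mem_miss, h5 r (hrx y hU.reachable) (hrx p hp), mem_miss, her]
    intro π' hO' hU' hx' hy' hey her'
    obtain ⟨π'', s⟩ := exists_shift (hU' ▸ hU) hx' hy' hqy
    have h1 : π''.mate e y = y := by rw [s.mate_of_color_ne e hec, hey]
    have h2 : π''.mate e r = r := by rw [s.mate_of_color_ne e hec, her']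
    refine (s.opt hO').no_common hG (s.U_yz.reachable.trans ?_) (hrx y hU.reachable).symm h1 h2
    rcases hqr with rfl | h
    · exact .rfl
    · refine (s.U_mono (hU' ▸ h) ?_).reachable
      have := hrx x .rfl
      have := hqx x .rfl
      simp only [ne_eq, Sym2.eq_iff]
      tauto

/-- A big component is not attached to another component. -/
lemma Opt.no_contact (hO : π.Opt) (hU : π.U.Adj x y) (hx : π.mate c x = x)
    (hy : π.mate c y = q) (hqy : q ≠ y) (hr : ¬ π.U.Reachable x q) (hB : π.Big x)
    (hq : π.U.Adj q r) : False := by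
  obtain ⟨k, hk⟩ := hB
  obtain ⟨e, he⟩ := exists_miss hG hq
  by_cases hek : e = k
  · obtain ⟨g, hg⟩ := exists_miss hG hq.symm
    have hgk : g ≠ k := by
      rintro rfl
      exact hO.no_common_adj hq (hek ▸ he) hg
    obtain ⟨p, hp, hp'⟩ := hk g hgk
    exact hO.not_miss_of_attach hG hU hx hy hqy hr hp hp' (Or.inr hq) hg
  · obtain ⟨p, hp, hp'⟩ := hk e hek
    exact hO.not_miss_of_attach hG hU hx hy hqy hr hp hp' (Or.inl rfl) he

/-- A big component is not attached to a vertex that another component is attached to. -/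
lemma Opt.no_contact_of_attach (hO : π.Opt) {S : Set V} (hS : ∀ u ∈ S, ∀ v, π.U.Adj u v → v ∈ S)
    (hxS : x ∈ S) (hU : π.U.Adj x y) (hx : π.mate c x = x)
    (hy : π.mate c y = q) (hqS : q ∉ S) (hB : π.Big x) (huS : u ∉ S) (hvS : v ∉ S)
    (hU' : π.U.Adj u v) (hu : π.mate e u = u) (hv : π.mate e v = q) (hqv : q ≠ v) : False := by
  obtain ⟨π', s⟩ := exists_shift hU' hu hv hqv
  have hne : ∀ {w}, w ∈ S → ∀ {t}, t ∉ S → w ≠ t := fun hw t ht h => ht (h ▸ hw)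
  have hyS := hS x hxS y hU
  have hadj : ∀ w ∈ S, ∀ t, π'.U.Adj w t ↔ π.U.Adj w t := by
    intro w hw t
    refine s.U_of_ne ?_ ?_
    · have := hne hw huS
      have := hne hw hvS
      simp only [ne_eq, Sym2.eq_iff]
      tauto
    · have := hne hw hvS
      have := hne hw hqS
      simp only [ne_eq, Sym2.eq_iff]
      tauto
  have hm : ∀ w ∈ S, ∀ a, π'.mate a w = π.mate a w := fun w hw a =>
    s.mate_eq (hne hw huS) (hne hw hvS) (hne hw hqS) a
  have hreach := reachable_iff_of_adj_iff hxS hS hadj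
  refine (s.opt hO).no_contact hG ((hadj x hxS y).2 hU) (by rw [hm x hxS, hx])
    (by rw [hm y hyS, hy]) (hne hyS hqS).symm ?_ ?_ s.U_yz.symm
  · intro h
    exact hqS (mem_of_reachable hxS hS ((hreach q).1 h))
  · obtain ⟨k, hk⟩ := hB
    refine ⟨k, fun e he => ?_⟩
    obtain ⟨p, hp, hp'⟩ := hk e he
    refine ⟨p, (hreach p).2 hp, ?_⟩
    rw [hm p (mem_of_reachable hxS hS hp), hp']

end

/-- The weight of an uncolored degree in the first potential. -/
def phi : ℕ → ℕ
  | 0 => 0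
  | n + 1 => phi n + if n = 0 then 0 else n + 1

/-- The first potential. -/
noncomputable def Phi (π : PCol G) : ℕ := ∑ v, phi (π.d v)

/-- The second potential. -/
noncomputable def Psi (π : PCol G) : ℕ := ∑ v, if π.d v = 0 then 0 else #(π.miss v)

/-- Optimal colorings of maximum potential. -/
def FOpt (π : PCol G) : Prop := π.Opt ∧ ∀ π' : PCol G, π'.Opt → π'.Phi ≤ π.Phi

/-- The extremal colorings used below. -/
def Best (π : PCol G) : Prop := π.FOpt ∧ ∀ π' : PCol G, π'.FOpt → π'.Psi ≤ π.Psi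

lemma exists_best (G : SimpleGraph V) : ∃ π : PCol G, π.Best := by
  have key : ∀ (P : PCol G → Prop) (f : PCol G → ℕ) (N : ℕ), (∃ π, P π) → (∀ π, f π ≤ N) →
      ∃ π, P π ∧ ∀ π', P π' → f π' ≤ f π := by
    rintro P f N ⟨π₀, h₀⟩ hN
    have hex : ∃ n, ∃ π, P π ∧ N - f π = n := ⟨_, π₀, h₀, rfl⟩
    obtain ⟨π, hπ, hn⟩ := Nat.find_spec hex
    refine ⟨π, hπ, fun π' h' => ?_⟩
    have := Nat.find_min' hex ⟨π', h', rfl⟩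
    have := hN π'
    have := hN π
    omega
  have hmiss : ∀ (π : PCol G) v, #(π.miss v) ≤ 7 := fun π v =>
    (card_le_univ _).trans (by simp)
  have hphi : Monotone phi := monotone_nat_of_le_succ fun n => by simp [phi]
  have h0 : ∃ π : PCol G, π.Opt := by
    obtain ⟨π, -, h⟩ := key (fun _ => True) (fun π => ∑ _v : V, 7 - π.defect) (∑ _v : V, 7)
      ⟨⟨fun _ v => v, fun _ _ => rfl, fun _ _ h => absurd rfl h, fun _ _ _ _ h => absurd rfl h⟩,
        trivial⟩ (fun π => Nat.sub_le _ _)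
    refine ⟨π, fun π' => ?_⟩
    have h1 := h π' trivial
    have h2 : π'.defect ≤ ∑ _v : V, 7 := sum_le_sum fun v _ => hmiss π' v
    have h3 : π.defect ≤ ∑ _v : V, 7 := sum_le_sum fun v _ => hmiss π v
    omega
  obtain ⟨π₁, h1⟩ := key PCol.Opt Phi (∑ _v : V, phi (Fintype.card V)) h0
    (fun π => sum_le_sum fun v _ => hphi (card_le_univ _))
  obtain ⟨π₂, h2⟩ := key FOpt Psi (∑ _v : V, 7) ⟨π₁, h1⟩
    (fun π => sum_le_sum fun v _ => by split_ifs <;> simp [hmiss])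
  exact ⟨π₂, h2⟩

lemma IsShift.phi_eq (s : IsShift π π' x y z c) :
    π'.Phi + phi (π.d x) + phi (π.d z) = π.Phi + phi (π.d x - 1) + phi (π.d z + 1) := by
  have h := sum_two_points (f := fun v => phi (π'.d v)) (g := fun v => phi (π.d v)) s.hzx.symm
    (fun v h1 h2 => by rw [s.d_eq h1 h2])
  have h1 := s.d_x
  rw [s.d_z, show π'.d x = π.d x - 1 by omega] at h
  exact h

lemma FOpt.d_lt (hF : π.FOpt) (hU : π.U.Adj x y) (hx : π.mate c x = x) (hy : π.mate c y = z)
    (hzy : z ≠ y) : π.d z < π.d x := by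
  obtain ⟨π', s⟩ := exists_shift hU hx hy hzy
  have h1 := s.phi_eq
  have h2 := hF.2 π' (s.opt hF.1)
  obtain ⟨n, hn⟩ : ∃ n, π.d x = n + 1 := ⟨π.d x - 1, by have := s.d_x; omega⟩
  rw [hn] at h1 ⊢
  simp only [phi, Nat.add_sub_cancel] at h1
  split_ifs at h1 <;> omega

/-- Moving an uncolored leaf keeps a coloring extremal for the first potential. -/
lemma FOpt.shift (hF : π.FOpt) (s : IsShift π π' x y z c) (hx : π.d x = 1) : π'.FOpt := by
  have h := hF.d_lt s.hU s.hx s.hy s.hzy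
  have h1 := s.phi_eq
  have hz : π.d z = 0 := by omega
  rw [hx, hz] at h1
  simp only [phi] at h1
  refine ⟨s.opt hF.1, fun π'' h'' => (hF.2 π'' h'').trans ?_⟩
  simp at h1
  omega

lemma Best.card_miss_lt (hB : π.Best) (hU : π.U.Adj x y) (hx : π.mate c x = x)
    (hy : π.mate c y = z) (hzy : z ≠ y) (hd : π.d x = 1) : #(π.miss z) < #(π.miss x) := by
  obtain ⟨π', s⟩ := exists_shift hU hx hy hzy
  have hz : π.d z = 0 := by have := hB.1.d_lt hU hx hy hzy; omega
  have h := sum_two_points (f := fun v => if π'.d v = 0 then 0 else #(π'.miss v))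
    (g := fun v => if π.d v = 0 then 0 else #(π.miss v)) s.hzx.symm
    (fun v h1 h2 => by rw [s.d_eq h1 h2, s.miss_eq h1 h2])
  have h1 := s.d_x
  have h2 := hB.2 π' (hB.1.shift s hd)
  simp only [Psi] at h2
  rw [s.d_z, s.card_miss_z, show π'.d x = 0 by omega, hz, hd] at h
  simp at h
  omega

/-- The region of the component of `x₀`: the component itself and the vertices it is attached to
in a way which may be used to move an uncolored edge. -/
def R (π : PCol G) (x₀ : V) : Set V :=
  {z | π.U.Reachable x₀ z ∧ π.d z ≠ 0} ∪
  {z | ∃ u v c, π.U.Reachable x₀ u ∧ π.U.Adj u v ∧ π.mate c u = u ∧ π.mate c v = z ∧ z ≠ v ∧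
    (π.d u = 1 ∨ π.Big x₀)}

lemma R_congr (h : π.U.Reachable x₀ x') : π.R x₀ = π.R x' := by
  have h1 : ∀ z, π.U.Reachable x₀ z ↔ π.U.Reachable x' z := fun z =>
    ⟨fun h' => h.symm.trans h', fun h' => h.trans h'⟩
  have h2 : π.Big x₀ ↔ π.Big x' := ⟨fun h' => h'.of_reachable h, fun h' => h'.of_reachable h.symm⟩
  simp only [R, h1, h2]

lemma mem_R_of_reachable (h : π.U.Reachable x₀ z) (hz : π.U.Adj z u) : z ∈ π.R x₀ :=
  Or.inl ⟨h, (d_pos_of_adj hz).ne'⟩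

section
variable (hG : ∀ v, (G.neighborSet v).ncard ≤ 7)
include hG

lemma FOpt.disjoint_R (hF : π.FOpt) (h : ¬ π.U.Reachable x₀ x') :
    Disjoint (π.R x₀) (π.R x') := by
  have key : ∀ x₀ x' z, ¬ π.U.Reachable x₀ x' → π.U.Reachable x₀ z → π.d z ≠ 0 →
      ∀ u v c, π.U.Reachable x' u → π.U.Adj u v → π.mate c u = u → π.mate c v = z → z ≠ v →
      (π.d u = 1 ∨ π.Big x') → False := by
    intro x₀ x' z h hz hdz u v c hu huv hcu hcv hzv hd
    rcases hd with hd | hd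
    · have := hF.d_lt huv hcu hcv hzv
      omega
    · obtain ⟨r, hr⟩ := d_pos.1 (Nat.pos_of_ne_zero hdz)
      exact hF.1.no_contact hG huv hcu hcv hzv
        (fun h' => h (hz.trans (hu.trans h').symm)) (hd.of_reachable hu) hr
  have key2 : ∀ x₀ x' z, ¬ π.U.Reachable x₀ x' → π.Big x₀ →
      ∀ u v c, π.U.Reachable x₀ u → π.U.Adj u v → π.mate c u = u → π.mate c v = z → z ≠ v →
      ∀ u' v' c', π.U.Reachable x' u' → π.U.Adj u' v' → π.mate c' u' = u' → π.mate c' v' = z →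
      z ≠ v' → (π.d u' = 1 ∨ π.Big x') → False := by
    intro x₀ x' z h hB u v c hu huv hcu hcv hzv u' v' c' hu' huv' hcu' hcv' hzv' hd
    by_cases hz : π.U.Reachable x₀ z ∧ π.d z ≠ 0
    · exact key x₀ x' z h hz.1 hz.2 u' v' c' hu' huv' hcu' hcv' hzv' hd
    have hz' : ¬ π.U.Reachable x₀ z := by
      intro hr
      refine hz ⟨hr, ?_⟩
      have hne : z ≠ u := by
        rintro rfl; rw [mate_eq_comm, hcu] at hcv; exact hzv hcv
      obtain ⟨p⟩ := hr.symm.trans hu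
      cases p with
      | nil => exact absurd rfl hne
      | cons h' _ => exact (d_pos_of_adj h').ne'
    exact hF.1.no_contact_of_attach hG (S := {w | π.U.Reachable x₀ w})
      (fun u hu v huv => hu.trans huv.reachable) hu huv hcu hcv hz' (hB.of_reachable hu)
      (fun h' => h (h'.trans hu'.symm)) (fun h' => h (h'.trans (hu'.trans huv'.reachable).symm))
      huv' hcu' hcv' hzv'
  rw [Set.disjoint_left]
  rintro z (⟨hz, hdz⟩ | ⟨u, v, c, hu, huv, hcu, hcv, hzv, hd⟩)
    (⟨hz', hdz'⟩ | ⟨u', v', c', hu', huv', hcu', hcv', hzv', hd'⟩)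
  · exact h (hz.trans hz'.symm)
  · exact key x₀ x' z h hz hdz u' v' c' hu' huv' hcu' hcv' hzv' hd'
  · exact key x' x₀ z (fun h' => h h'.symm) hz' hdz' u v c hu huv hcu hcv hzv hd
  · by_cases hB : π.Big x₀
    · exact key2 x₀ x' z h hB u v c hu huv hcu hcv hzv u' v' c' hu' huv' hcu' hcv' hzv' hd'
    by_cases hB' : π.Big x'
    · exact key2 x' x₀ z (fun h' => h h'.symm) hB' u' v' c' hu' huv' hcu' hcv' hzv'
        u v c hu huv hcu hcv hzv hd
    replace hd := hd.resolve_right hB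
    replace hd' := hd'.resolve_right hB'
    obtain ⟨π', s⟩ := exists_shift huv' hcu' hcv' hzv'
    have hne : ∀ w t, π.U.Reachable x₀ w → π.U.Reachable x' t → w ≠ t := by
      rintro w t hw ht rfl; exact h (hw.trans ht.symm)
    have hzu : z ≠ u := by
      rintro rfl; rw [mate_eq_comm, hcu] at hcv; exact hzv hcv
    have e1 := hne u u' hu hu'
    have e2 := hne u v' hu (hu'.trans huv'.reachable)
    have e3 := hne v u' (hu.trans huv.reachable) hu'
    have e4 := hne v v' (hu.trans huv.reachable) (hu'.trans huv'.reachable)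
    have h1 := (hF.shift s hd').d_lt (x := u) (y := v) (c := c) (z := z)
      (s.U_mono huv (by simp only [ne_eq, Sym2.eq_iff]; tauto))
      (by rw [s.mate_eq e1 e2 hzu.symm, hcu]) (by rw [s.mate_eq e3 e4 hzv.symm, hcv]) hzv
    rw [s.d_eq e1 hzu.symm, s.d_z] at h1
    omega

lemma FOpt.mem_R_of_adj (hF : π.FOpt) (h : u ∈ π.R x₀) (huv : π.U.Adj u v) : v ∈ π.R x₀ := by
  by_cases hr : π.U.Reachable x₀ u
  · exact mem_R_of_reachable (hr.trans huv.reachable) huv.symm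
  · exact absurd h (Set.disjoint_left.1 (hF.disjoint_R hG (x₀ := u) (x' := x₀)
      (fun h' => hr h'.symm)) (mem_R_of_reachable .rfl huv))

lemma FOpt.U_iff_of_agree (hag : ∀ v ∉ π.R x₀, ∀ a, π₀.mate a v = π.mate a v)
    (hu : u ∉ π.R x₀) : π₀.U.Adj u v ↔ π.U.Adj u v := by
  rw [U_adj, U_adj]
  simp only [hag u hu]

lemma FOpt.closed_of_agree (hF : π.FOpt) (hag : ∀ v ∉ π.R x₀, ∀ a, π₀.mate a v = π.mate a v) :
    ∀ u ∈ π.R x₀, ∀ v, π₀.U.Adj u v → v ∈ π.R x₀ := by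
  intro u hu v huv
  by_contra hv
  exact hv (hF.mem_R_of_adj hG hu ((U_iff_of_agree hG hag hv).1 huv.symm).symm)

/-- A vertex outside a region belongs to no region if it can be attached to a big component by
recoloring inside the region. -/
lemma FOpt.unowned (hF : π.FOpt) (hO : π₀.Opt)
    (hag : ∀ v ∉ π.R x₀, ∀ a, π₀.mate a v = π.mate a v)
    (hxR : x ∈ π.R x₀) (hU : π₀.U.Adj x y) (hx : π₀.mate c x = x) (hy : π₀.mate c y = q)
    (hqR : q ∉ π.R x₀) (hB : π₀.Big x) : ∀ x', q ∉ π.R x' := by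
  intro x' hq
  have hr : ¬ π.U.Reachable x₀ x' := fun h => hqR (by rwa [R_congr h])
  have hdis := Set.disjoint_left.1 (hF.disjoint_R hG hr)
  have hcl := hF.closed_of_agree hG hag
  have hyR := hcl x hxR y hU
  have hqy : q ≠ y := fun h => hqR (h ▸ hyR)
  rcases hq with ⟨h1, h2⟩ | ⟨u, v, e, hu, huv, heu, hev, hqv, -⟩
  · obtain ⟨r, hr'⟩ := d_pos.1 (Nat.pos_of_ne_zero h2)
    exact hO.no_contact hG hU hx hy hqy (fun h => hqR (mem_of_reachable hxR hcl h)) hB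
      ((U_iff_of_agree hG hag hqR).2 hr')
  · have huR : u ∉ π.R x₀ := fun h => hdis h (mem_R_of_reachable hu huv)
    have hvR : v ∉ π.R x₀ := fun h => hdis h (mem_R_of_reachable (hu.trans huv.reachable) huv.symm)
    exact hO.no_contact_of_attach hG hcl hxR hU hx hy hqR hB huR hvR
      ((U_iff_of_agree hG hag huR).2 huv) (by rw [hag u huR, heu]) (by rw [hag v hvR, hev]) hqv

end
end PCol
end PartialColoring

namespace PartialColoring
open Finset Classical

variable {V : Type*} [Fintype V] {G : SimpleGraph V}

namespace PCol
variable {π π' π₀ : PCol G} {u v w x y z p q r x₀ x' : V} {a b c e k : Fin 7}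

/-- The number of colored edges at `w`. -/
noncomputable def col (π : PCol G) (w : V) : ℕ := #{a | π.mate a w ≠ w}

/-- The number of colored edges from `w` to vertices outside of all regions. -/
noncomputable def bonus (π : PCol G) (w : V) : ℕ := #{a | ∀ x, π.mate a w ∉ π.R x}

/-- The contribution of a vertex `w` to the region it belongs to. -/
noncomputable def val (π : PCol G) (w : V) : ℕ := π.col w + π.bonus w

lemma col_add_miss (π : PCol G) (w : V) : π.col w + #(π.miss w) = 7 :=
  π.card_colored_add_miss w

lemma col_le_val (π : PCol G) (w : V) : π.col w ≤ π.val w := Nat.le_add_right _ _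

lemma col_pos (h : π.mate a w ≠ w) : 0 < π.col w :=
  card_pos.2 ⟨a, by simpa using h⟩

/-- The neighbors of `v` along the colors in `C`. -/
noncomputable def nbrs (π : PCol G) (v : V) (C : Finset (Fin 7)) : Finset V :=
  C.image fun c => π.mate c v

lemma mem_nbrs {C : Finset (Fin 7)} : w ∈ π.nbrs v C ↔ ∃ c ∈ C, π.mate c v = w := by
  simp [nbrs]

lemma card_nbrs {C : Finset (Fin 7)} (h : ∀ c ∈ C, π.mate c v ≠ v) : #(π.nbrs v C) = #C :=
  card_image_of_injOn fun c hc _ _ hcd => π.inj _ _ v hcd (h c hc)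

lemma disjoint_nbrs {C D : Finset (Fin 7)} (h : ∀ c ∈ C, π.mate c v ≠ v) (hCD : Disjoint C D) :
    Disjoint (π.nbrs v C) (π.nbrs v D) := by
  rw [Finset.disjoint_left] at hCD ⊢
  simp only [mem_nbrs]
  rintro w ⟨c, hc, rfl⟩ ⟨d, hd, hcd⟩
  exact hCD hc (π.inj c d v hcd.symm (h c hc) ▸ hd)

lemma sum_val_ge {W : Finset V} {n : ℕ} (h : ∀ w ∈ W, n ≤ π.val w) :
    #W * n ≤ ∑ w ∈ W, π.val w := by
  simpa using card_nsmul_le_sum W π.val n h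

variable (hG : ∀ v, (G.neighborSet v).ncard ≤ 7)
include hG

lemma Opt.disjoint_miss (hO : π.Opt) (hr : π.U.Reachable u v) (huv : u ≠ v) :
    Disjoint (π.miss u) (π.miss v) := by
  rw [Finset.disjoint_left]
  intro a h1 h2
  exact hO.no_common hG hr huv (mem_miss.1 h1) (mem_miss.1 h2)

lemma Opt.mate_ne (hO : π.Opt) (hr : π.U.Reachable u v) (huv : u ≠ v) (hc : c ∈ π.miss u) :
    π.mate c v ≠ v := fun h => hO.no_common hG hr huv (mem_miss.1 hc) h

lemma Opt.card_biUnion_miss (hO : π.Opt) {T : Finset V} (hT : ∀ v ∈ T, π.U.Reachable x v) :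
    #(T.biUnion π.miss) = ∑ v ∈ T, #(π.miss v) :=
  card_biUnion fun u hu v hv huv => hO.disjoint_miss hG ((hT u hu).symm.trans (hT v hv)) huv

lemma Opt.sum_miss_le (hO : π.Opt) {T : Finset V} (hT : ∀ v ∈ T, π.U.Reachable x v) :
    ∑ v ∈ T, #(π.miss v) ≤ 7 := by
  rw [← hO.card_biUnion_miss hG hT]
  exact (card_le_univ _).trans (by simp)

lemma Opt.big (hO : π.Opt) {T : Finset V} (hT : ∀ v ∈ T, π.U.Reachable x v)
    (h : 6 ≤ ∑ v ∈ T, #(π.miss v)) : π.Big x := by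
  rw [← hO.card_biUnion_miss hG hT] at h
  have h1 : #(T.biUnion π.miss)ᶜ ≤ 1 := by
    rw [card_compl]
    simp
    omega
  have hk : ∃ k, ∀ e, e ∉ T.biUnion π.miss → e = k := by
    rcases (T.biUnion π.miss)ᶜ.eq_empty_or_nonempty with h2 | ⟨k, hk⟩
    · exact ⟨0, fun e he => absurd (mem_compl.2 he) (by rw [h2]; simp)⟩
    · exact ⟨k, fun e he => card_le_one.1 h1 e (mem_compl.2 he) k hk⟩
  obtain ⟨k, hk⟩ := hk
  refine ⟨k, fun e he => ?_⟩
  have : e ∈ T.biUnion π.miss := by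
    by_contra h'; exact he (hk e h')
  obtain ⟨p, hp, hp'⟩ := mem_biUnion.1 this
  exact ⟨p, hT p hp, mem_miss.1 hp'⟩

/-- The vertices to which a leaf can be moved. -/
lemma Best.leaf_nbrs (hB : π.Best) (hU : π.U.Adj y x) (hd : π.d y = 1) :
    #(π.nbrs x (π.miss y)) = #(π.miss y) ∧
      ∀ z ∈ π.nbrs x (π.miss y), z ∈ π.R x ∧ π.d z = 0 ∧ 8 ≤ #(π.miss y) + π.val z := by
  have h0 : ∀ c ∈ π.miss y, π.mate c x ≠ x := fun c hc =>
    hB.1.1.mate_ne hG hU.reachable hU.ne hc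
  refine ⟨card_nbrs h0, ?_⟩
  intro z hz
  obtain ⟨c, hc, hcz⟩ := mem_nbrs.1 hz
  have hzx : z ≠ x := hcz ▸ h0 c hc
  have h1 := hB.1.d_lt hU (mem_miss.1 hc) hcz hzx
  have h2 := hB.card_miss_lt hU (mem_miss.1 hc) hcz hzx hd
  have h3 := π.col_add_miss z
  have h4 := π.col_le_val z
  exact ⟨Or.inr ⟨y, x, c, hU.symm.reachable, hU, mem_miss.1 hc, hcz, hzx, Or.inl hd⟩,
    by omega, by omega⟩

lemma Best.charge_edge (hB : π.Best) (hU : π.U.Adj x y) (hx : π.d x = 1) (hy : π.d y = 1)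
    (hle : #(π.miss x) ≤ #(π.miss y)) :
    ∃ W : Finset V, (∀ w ∈ W, w ∈ π.R x) ∧ 15 ≤ ∑ w ∈ W, π.val w := by
  obtain ⟨h1, h2⟩ := hB.leaf_nbrs hG hU.symm hy
  set Z := π.nbrs x (π.miss y)
  have hxZ : x ∉ insert y Z := by
    simp only [mem_insert, hU.ne, false_or]
    intro h
    have := (h2 x h).2.1
    omega
  have hyZ : y ∉ Z := fun h => by have := (h2 y h).2.1; omega
  refine ⟨insert x (insert y Z), ?_, ?_⟩
  · intro w hw
    simp only [mem_insert] at hw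
    rcases hw with rfl | rfl | hw
    · exact mem_R_of_reachable .rfl hU
    · exact mem_R_of_reachable hU.reachable hU.symm
    · exact (h2 w hw).1
  · rw [sum_insert hxZ, sum_insert hyZ]
    have h3 := sum_val_ge (π := π) (W := Z) (n := 8 - #(π.miss y)) fun w hw => by
      have := (h2 w hw).2.2
      omega
    rw [h1] at h3
    have h4 := π.col_add_miss x
    have h5 := π.col_add_miss y
    have h6 := π.col_le_val x
    have h7 := π.col_le_val y
    have h8 := hB.1.1.sum_miss_le hG (T := {x, y}) (x := x) (by
      simp [hU.reachable])
    rw [sum_pair hU.ne] at h8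
    have h9 := d_le_miss hG π x
    generalize #(π.miss y) = b at *
    have : b ≤ 6 := by omega
    interval_cases b <;> omega

lemma Best.charge_two_edges (hB : π.Best) (hy : π.U.Adj x y) (hw : π.U.Adj x w) (hyw : y ≠ w)
    (hdx : π.d x = 2) (hdy : π.d y = 1) (hdw : π.d w = 1) :
    ∃ W : Finset V, (∀ w ∈ W, w ∈ π.R x) ∧ 30 ≤ ∑ w ∈ W, π.val w := by
  have hO := hB.1.1
  obtain ⟨h1, h2⟩ := hB.leaf_nbrs hG hy.symm hdy
  obtain ⟨h3, h4⟩ := hB.leaf_nbrs hG hw.symm hdw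
  have hdisj : Disjoint (π.nbrs x (π.miss y)) (π.nbrs x (π.miss w)) :=
    disjoint_nbrs (fun c hc => hO.mate_ne hG hy.symm.reachable hy.ne' hc)
      (hO.disjoint_miss hG (hy.symm.reachable.trans hw.reachable) hyw)
  set Z := π.nbrs x (π.miss y)
  set Z' := π.nbrs x (π.miss w)
  have hZ : ∀ z ∈ Z ∪ Z', π.d z = 0 := by
    intro z hz
    rcases mem_union.1 hz with h | h
    · exact (h2 z h).2.1
    · exact (h4 z h).2.1
  have hxZ : x ∉ insert y (insert w (Z ∪ Z')) := by
    simp only [mem_insert, hy.ne, hw.ne, false_or]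
    intro h; have := hZ x h; omega
  have hyZ : y ∉ insert w (Z ∪ Z') := by
    simp only [mem_insert, hyw, false_or]
    intro h; have := hZ y h; omega
  have hwZ : w ∉ Z ∪ Z' := fun h => by have := hZ w h; omega
  have hWR : ∀ v ∈ insert x (insert y (insert w (Z ∪ Z'))), v ∈ π.R x := by
    intro v hv
    simp only [mem_insert, mem_union] at hv
    rcases hv with rfl | rfl | rfl | hv | hv
    · exact mem_R_of_reachable .rfl hy
    · exact mem_R_of_reachable hy.reachable hy.symm
    · exact mem_R_of_reachable hw.reachable hw.symm
    · exact (h2 v hv).1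
    · exact (h4 v hv).1
  have hsum : ∑ v ∈ insert x (insert y (insert w (Z ∪ Z'))), π.val v =
      π.val x + (π.val y + (π.val w + (∑ v ∈ Z, π.val v + ∑ v ∈ Z', π.val v))) := by
    rw [sum_insert hxZ, sum_insert hyZ, sum_insert hwZ, sum_union hdisj]
  have h5 := sum_val_ge (π := π) (W := Z) (n := 8 - #(π.miss y)) fun w hw => by
    have := (h2 w hw).2.2
    omega
  have h6 := sum_val_ge (π := π) (W := Z') (n := 8 - #(π.miss w)) fun w hw => by
    have := (h4 w hw).2.2
    omega
  rw [h1] at h5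
  rw [h3] at h6
  have e1 := π.col_add_miss x
  have e2 := π.col_add_miss y
  have e3 := π.col_add_miss w
  have e4 := π.col_le_val x
  have e5 := π.col_le_val y
  have e6 := π.col_le_val w
  have hT : ∀ v ∈ ({x, y, w} : Finset V), π.U.Reachable x v := by
    simp [hy.reachable, hw.reachable]
  have hTs : ∑ v ∈ ({x, y, w} : Finset V), #(π.miss v) =
      #(π.miss x) + (#(π.miss y) + #(π.miss w)) := by
    rw [sum_insert (by simp [hy.ne, hw.ne]), sum_pair hyw]
  have e7 := hO.sum_miss_le hG hT
  rw [hTs] at e7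
  have e8 := d_le_miss hG π x
  have e9 := d_le_miss hG π y
  have e10 := d_le_miss hG π w
  by_cases hc : #(π.miss y) = 1 ∧ #(π.miss w) = 1 ∧ 4 ≤ #(π.miss x)
  · obtain ⟨c1, c2, c3⟩ := hc
    have hbig : π.Big x := hO.big hG hT (by omega)
    have hN : ∀ c ∈ π.miss x, π.mate c y ≠ y := fun c hc =>
      hO.mate_ne hG hy.reachable hy.ne hc
    set N := π.nbrs y (π.miss x) \ insert x (insert y (insert w (Z ∪ Z'))) with hNdef
    have hNc : #(π.miss x) ≤ #N + 3 := by
      have : π.nbrs y (π.miss x) ⊆ N ∪ insert w (Z ∪ Z') := by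
        intro v hv
        obtain ⟨c, hc, hcv⟩ := mem_nbrs.1 hv
        have h1 : v ≠ x := fun h => hy.symm.2 c (hcv.trans h)
        have h2 : v ≠ y := hcv ▸ hN c hc
        simp only [hNdef, mem_union, mem_sdiff, mem_insert]
        tauto
      have h8 := card_le_card this
      rw [card_nbrs hN] at h8
      have h9 := card_union_le N (insert w (Z ∪ Z'))
      rw [card_insert_of_notMem hwZ, card_union_of_disjoint hdisj] at h9
      omega
    have hNR : ∀ v ∈ N, v ∈ π.R x ∧ 1 ≤ π.val v := by
      intro v hv
      rw [hNdef, mem_sdiff] at hv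
      obtain ⟨c, hc, hcv⟩ := mem_nbrs.1 hv.1
      have hvy : v ≠ y := hcv ▸ hN c hc
      refine ⟨Or.inr ⟨x, y, c, .rfl, hy, mem_miss.1 hc, hcv, hvy, Or.inr hbig⟩, ?_⟩
      have h1 : π.mate c v ≠ v := by rw [mate_eq_comm.1 hcv]; exact hvy.symm
      exact (col_pos h1).trans_le (π.col_le_val v)
    refine ⟨insert x (insert y (insert w (Z ∪ Z'))) ∪ N, ?_, ?_⟩
    · intro v hv
      rcases mem_union.1 hv with hv | hv
      · exact hWR v hv
      · exact (hNR v hv).1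
    · have hdN : Disjoint (insert x (insert y (insert w (Z ∪ Z')))) N := disjoint_sdiff
      rw [sum_union hdN, hsum]
      have h8 := sum_val_ge (π := π) (W := N) (n := 1) fun v hv => (hNR v hv).2
      rw [c1] at h5
      rw [c2] at h6
      omega
  · refine ⟨_, hWR, ?_⟩
    rw [hsum]
    generalize #(π.miss y) = b at *
    generalize #(π.miss w) = b' at *
    have : b ≤ 4 := by omega
    have : b' ≤ 4 := by omega
    interval_cases b <;> interval_cases b' <;> omega

end PCol
end PartialColoring

namespace PartialColoring
open Finset Classical

variable {V : Type*} [Fintype V] {G : SimpleGraph V}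

namespace PCol
variable {π π' π₀ : PCol G} {t u v w x y z p q r x₀ x' : V} {a b c e k : Fin 7}

lemma not_reachable_of_d_eq_zero (hz : π.d z = 0) (hne : z ≠ x) : ¬ π.U.Reachable x z := by
  intro hr
  obtain ⟨p⟩ := hr.symm
  cases p with
  | nil => exact hne rfl
  | cons h' _ => exact (d_pos_of_adj h').ne' hz

/-- Possibly move a leaf. -/
lemma FOpt.exists_leaf (hF : π.FOpt) (hU : π.U.Adj x y) (hd : π.d y = 1) (hc : π.mate c y = y)
    (hz : π.mate c x = z) (hzx : z ≠ x) {l : V} (hl : l = y ∨ l = z) :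
    ∃ π' : PCol G, π'.FOpt ∧ π'.U.Adj x l ∧ π'.d l = 1 ∧ π'.mate c l = l ∧ π'.d x = π.d x ∧
      π'.miss x = π.miss x ∧ (∀ t, t ≠ x → t ≠ y → t ≠ z → (π.U.Adj x t → π'.U.Adj x t) ∧
        π'.d t = π.d t ∧ ∀ e, π'.mate e t = π.mate e t) ∧
      ∀ e, e ≠ c → ∀ v, π'.mate e v = π.mate e v := by
  rcases hl with rfl | rfl
  · exact ⟨π, hF, hU, hd, hc, rfl, rfl, fun t _ _ _ => ⟨id, rfl, fun _ => rfl⟩,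
      fun _ _ _ => rfl⟩
  · obtain ⟨π', s⟩ := exists_shift hU.symm hc hz hzx
    have h0 : π.d l = 0 := by have := hF.d_lt hU.symm hc hz hzx; omega
    refine ⟨π', hF.shift s hd, s.U_yz, by rw [s.d_z, h0], s.mate_z, s.d_y,
      s.miss_eq hU.ne hzx.symm, fun t h1 h2 h3 => ⟨fun h => s.U_mono h ?_, s.d_eq h2 h3,
        fun e => s.mate_eq h2 h1 h3 e⟩, s.mate_of_color_ne⟩
    simp only [ne_eq, Sym2.eq_iff]
    tauto

/-- A star cannot be turned into a triangle. -/
lemma FOpt.star_no_triangle {l m : V} (hF : π.FOpt) (hl : π.U.Adj x l)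
    (ht : π.U.Adj x t) (hlm : l ≠ m) (hmt : m ≠ t) (hdx : π.d x = 3)
    (hdl : π.d l = 1) (hdm : π.d m = 1) (hdt : π.d t = 1) (hc : π.mate c x = x)
    (hcl : π.mate c l = m) (he : π.mate e l = l) : π.mate e m ≠ t := by
  intro hem
  obtain ⟨π₂, s⟩ := exists_shift hl hc hcl hlm.symm
  have hec : e ≠ c := by rintro rfl; exact hlm (he.symm.trans hcl)
  obtain ⟨π₃, s'⟩ := exists_shift s.U_yz (by rw [s.mate_of_color_ne e hec, he])
    (by rw [s.mate_of_color_ne e hec, hem]) hmt.symm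
  have h1 := s.phi_eq
  have h2 := s'.phi_eq
  rw [s.d_y, s.d_eq ht.ne' hmt.symm, hdl, hdt] at h2
  rw [hdx, hdm] at h1
  have h3 := hF.2 π₃ (s'.opt (s.opt hF.1))
  simp [phi] at h1 h2
  omega

variable (hG : ∀ v, (G.neighborSet v).ncard ≤ 7)
include hG

lemma Opt.six_le_val_of_attach (hO : π.Opt) (hU : π.U.Adj x y) (hx : π.mate c x = x)
    (hy : π.mate c y = q) (hqy : q ≠ y) (hr : ¬ π.U.Reachable x q) (hB : π.Big x) :
    6 ≤ π.val q := by
  obtain ⟨k, hk⟩ := hB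
  have h1 : #(π.miss q) ≤ 1 := by
    rw [card_le_one]
    have : ∀ e ∈ π.miss q, e = k := by
      intro e he
      by_contra hek
      obtain ⟨p, hp, hp'⟩ := hk e hek
      exact hO.not_miss_of_attach hG hU hx hy hqy hr hp hp' (Or.inl rfl) (mem_miss.1 he)
    intro a ha b hb
    rw [this a ha, this b hb]
  have h2 := π.col_add_miss q
  have h3 := π.col_le_val q
  omega

lemma Opt.mem_R_of_attach (hO : π.Opt) (hr : π.U.Reachable x₀ x) (hU : π.U.Adj x y)
    (hc : c ∈ π.miss x) (hy : π.mate c y = q) (hB : π.Big x₀) : q ∈ π.R x₀ :=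
  Or.inr ⟨x, y, c, hr, hU, mem_miss.1 hc, hy,
    hy ▸ hO.mate_ne hG hU.reachable hU.ne hc, Or.inr hB⟩

lemma Opt.charge_of_card (hO : π.Opt) {T N : Finset V}
    (hT : ∀ v ∈ T, π.U.Reachable x v ∧ π.d v ≠ 0)
    (hN : ∀ z ∈ N, z ∈ π.R x ∧ ¬ π.U.Reachable x z ∧ 6 ≤ π.val z)
    (h : 51 ≤ 7 * #T + 6 * #N) :
    ∃ W : Finset V, (∀ w ∈ W, w ∈ π.R x) ∧ 44 ≤ ∑ w ∈ W, π.val w := by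
  have hd : Disjoint T N := by
    rw [Finset.disjoint_left]
    exact fun v hv hv' => (hN v hv').2.1 (hT v hv).1
  refine ⟨T ∪ N, ?_, ?_⟩
  · intro w hw
    rcases mem_union.1 hw with hw | hw
    · exact Or.inl (hT w hw)
    · exact (hN w hw).1
  · rw [sum_union hd]
    have h1 := sum_val_ge (π := π) (W := N) (n := 6) fun z hz => (hN z hz).2.2
    have h2 : ∑ w ∈ T, π.val w + ∑ w ∈ T, #(π.miss w) ≥ ∑ w ∈ T, 7 := by
      rw [← sum_add_distrib]
      exact sum_le_sum fun w _ => by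
        have := π.col_add_miss w
        have := π.col_le_val w
        omega
    have h3 := hO.sum_miss_le hG (T := T) fun v hv => (hT v hv).1
    simp only [sum_const, smul_eq_mul] at h2
    omega

lemma Best.charge_path (hB : π.Best) (hwu : π.U.Adj w u) (huv : π.U.Adj u v) (hvt : π.U.Adj v t)
    (hwt : w ≠ t) (hdw : π.d w = 1) (hdu : π.d u = 2) (hdv : π.d v = 2) (hdt : π.d t = 1)
    (hC : ∀ z, π.U.Reachable u z → z = w ∨ z = u ∨ z = v ∨ z = t) :
    ∃ W : Finset V, (∀ w ∈ W, w ∈ π.R u) ∧ 44 ≤ ∑ w ∈ W, π.val w := by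
  have hO := hB.1.1
  have hwv : w ≠ v := by rintro rfl; omega
  have hut : u ≠ t := by rintro rfl; omega
  have hrw := hwu.symm.reachable
  have hrv := huv.reachable
  have hrt := hrv.trans hvt.reachable
  have hT : ∀ z ∈ ({w, u, v, t} : Finset V), π.U.Reachable u z := by
    simp [hrw, hrv, hrt]
  have hTc : #({w, u, v, t} : Finset V) = 4 := by
    rw [card_insert_of_notMem, card_insert_of_notMem, card_pair hvt.ne] <;>
      simp [hwu.ne, huv.ne, hwv, hwt, hut]
  have hm := fun z => d_le_miss hG π z
  have hbig : π.Big u := by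
    refine hO.big hG hT ?_
    rw [sum_insert, sum_insert, sum_pair hvt.ne]
    · have := hm w; have := hm u; have := hm v; have := hm t
      omega
    · simp [huv.ne, hut]
    · simp [hwu.ne, hwv, hwt]
  have hnt : ∀ c ∈ π.miss t, π.mate c v ≠ v := fun c hc =>
    hO.mate_ne hG hvt.symm.reachable hvt.ne' hc
  have hnu : ∀ c ∈ π.miss u, π.mate c v ≠ v := fun c hc =>
    hO.mate_ne hG hrv huv.ne hc
  have hdisj : Disjoint (π.miss t) (π.miss u) := hO.disjoint_miss hG hrt.symm hut.symm
  obtain ⟨c₁, hc₁⟩ := exists_miss hG hwu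
  obtain ⟨z₁, hz₁⟩ : ∃ z₁, π.mate c₁ u = z₁ := ⟨_, rfl⟩
  have hz₁u : z₁ ≠ u := hz₁ ▸ hO.mate_ne hG hrw.symm hwu.ne (mem_miss.2 hc₁)
  have hdz₁ : π.d z₁ = 0 := by have := hB.1.d_lt hwu hc₁ hz₁ hz₁u; omega
  have hz₁r : ¬ π.U.Reachable u z₁ := not_reachable_of_d_eq_zero hdz₁ hz₁u
  have hatt : ∀ z ∈ π.nbrs v (π.miss t ∪ π.miss u), ¬ π.U.Reachable u z := by
    intro z hz hr
    obtain ⟨c, hc, hcz⟩ := mem_nbrs.1 hz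
    have h1 : z ≠ u := fun h => huv.symm.2 c (hcz.trans h)
    have h2 : z ≠ t := fun h => hvt.2 c (hcz.trans h)
    rcases mem_union.1 hc with hc | hc
    · have h3 : z ≠ v := hcz ▸ hnt c hc
      have := hB.1.d_lt hvt.symm (mem_miss.1 hc) hcz h3
      exact not_reachable_of_d_eq_zero (by omega) h1 hr
    · have h3 : z ≠ v := hcz ▸ hnu c hc
      rcases hC z hr with h | h | h | h
      · subst h
        have := hB.1.d_lt hwu.symm (mem_miss.1 hc) (mate_eq_comm.1 hcz) h3.symm
        omega
      · exact h1 h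
      · exact h3 h
      · exact h2 h
  have hz₁N : z₁ ∉ π.nbrs v (π.miss t ∪ π.miss u) := by
    intro hz
    have hrz := hatt z₁ hz
    obtain ⟨c, hc, hcz⟩ := mem_nbrs.1 hz
    obtain ⟨π', s⟩ := exists_shift hwu hc₁ hz₁ hz₁u
    have hF' := hB.1.shift s hdw
    have n1 : z₁ ≠ v := by rintro rfl; exact hrz hrv
    have n2 : z₁ ≠ t := by rintro rfl; exact hrz hrt
    have hcv : π'.mate c v = z₁ := by rw [s.mate_eq hwv.symm huv.ne' n1.symm, hcz]
    rcases mem_union.1 hc with hc | hc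
    · have hct : π'.mate c t = t := by
        rw [s.mate_eq hwt.symm hut.symm n2.symm]; exact mem_miss.1 hc
      have hUv : π'.U.Adj t v := by
        refine s.U_mono hvt.symm ?_
        simp only [ne_eq, Sym2.eq_iff]
        tauto
      have := hF'.d_lt hUv hct hcv n1
      rw [s.d_z, s.d_eq hwt.symm n2.symm] at this
      omega
    · have hcu : π'.mate c u = u := by
        rw [← mem_miss, s.miss_eq hwu.ne' hz₁u.symm]; exact hc
      have := hF'.d_lt s.U_yz hcu (mate_eq_comm.1 hcv) n1.symm
      rw [s.d_y, s.d_eq hwv.symm n1.symm] at this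
      omega
  refine hO.charge_of_card hG (T := {w, u, v, t})
    (N := insert z₁ (π.nbrs v (π.miss t ∪ π.miss u))) ?_ ?_ ?_
  · intro z hz
    refine ⟨hT z hz, ?_⟩
    simp only [mem_insert, mem_singleton] at hz
    rcases hz with rfl | rfl | rfl | rfl <;> omega
  · intro z hz
    rcases mem_insert.1 hz with rfl | hz
    · exact ⟨hO.mem_R_of_attach hG hrw hwu (mem_miss.2 hc₁) hz₁ hbig, hz₁r,
        hO.six_le_val_of_attach hG hwu hc₁ hz₁ hz₁u (fun h => hz₁r (hrw.trans h))
          (hbig.of_reachable hrw)⟩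
    · have hr := hatt z hz
      obtain ⟨c, hc, hcz⟩ := mem_nbrs.1 hz
      rcases mem_union.1 hc with hc | hc
      · exact ⟨hO.mem_R_of_attach hG hrt hvt.symm hc hcz hbig, hr,
          hO.six_le_val_of_attach hG hvt.symm (mem_miss.1 hc) hcz (hcz ▸ hnt c hc)
            (fun h => hr (hrt.trans h)) (hbig.of_reachable hrt)⟩
      · exact ⟨hO.mem_R_of_attach hG .rfl huv hc hcz hbig, hr,
          hO.six_le_val_of_attach hG huv (mem_miss.1 hc) hcz (hcz ▸ hnu c hc) hr hbig⟩
  · rw [hTc, card_insert_of_notMem hz₁N, card_nbrs, card_union_of_disjoint hdisj]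
    · have := hm t; have := hm u
      omega
    · intro c hc
      rcases mem_union.1 hc with hc | hc
      · exact hnt c hc
      · exact hnu c hc

end PCol
end PartialColoring

namespace PartialColoring
open Finset Classical

variable {V : Type*} [Fintype V] {G : SimpleGraph V}

namespace PCol
variable {π π' π₀ : PCol G} {t u v w x p q r x₀ x' : V} {a b e k : Fin 7}
  {y z : Fin 3 → V} {c : Fin 3 → Fin 7} {i j l : Fin 3}

/-- The component of `x` is a star with leaves `y i` of a single missing color `c i`, and it is
attached along these colors to the vertices `z i`. -/
structure IsStar (π : PCol G) (x : V) (y z : Fin 3 → V) (c : Fin 3 → Fin 7) : Prop where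
  best : π.Best
  hU : ∀ i, π.U.Adj x (y i)
  inj : Function.Injective y
  d_x : π.d x = 3
  d_y : ∀ i, π.d (y i) = 1
  miss_y : ∀ i, π.miss (y i) = {c i}
  mate_x : ∀ i, π.mate (c i) x = z i
  comp : ∀ v, π.U.Reachable x v → v = x ∨ ∃ i, v = y i

namespace IsStar
variable (s : IsStar π x y z c)
include s

lemma mate_y (i : Fin 3) : π.mate (c i) (y i) = y i := by
  rw [← mem_miss, s.miss_y]; simp

lemma hyx (i : Fin 3) : y i ≠ x := (s.hU i).ne'

lemma mate_z (i : Fin 3) : π.mate (c i) (z i) = x := mate_eq_comm.1 (s.mate_x i)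

variable (hG : ∀ v, (G.neighborSet v).ncard ≤ 7)
include hG

lemma z_ne_x (i : Fin 3) : z i ≠ x := by
  rw [← s.mate_x i]
  exact s.best.1.1.mate_ne hG (s.hU i).symm.reachable (s.hU i).ne' (by simp [s.miss_y])

lemma d_z (i : Fin 3) : π.d (z i) = 0 := by
  have := s.best.1.d_lt (s.hU i).symm (s.mate_y i) (s.mate_x i) (s.z_ne_x hG i)
  have := s.d_y i
  omega

lemma miss_z (i : Fin 3) : π.miss (z i) = ∅ := by
  have := s.best.card_miss_lt (s.hU i).symm (s.mate_y i) (s.mate_x i) (s.z_ne_x hG i) (s.d_y i)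
  rw [s.miss_y] at this
  simpa using this

lemma z_ne_y (i j : Fin 3) : z i ≠ y j := by
  intro h
  have := s.d_z hG i
  rw [h, s.d_y j] at this
  omega

lemma c_inj : Function.Injective c := by
  intro i j h
  by_contra hij
  have hne : y i ≠ y j := fun h' => hij (s.inj h')
  have := s.best.1.1.disjoint_miss hG
    ((s.hU i).symm.reachable.trans (s.hU j).reachable) hne
  rw [s.miss_y, s.miss_y, h] at this
  simp at this

lemma z_inj : Function.Injective z := by
  intro i j h
  rw [← s.mate_x i, ← s.mate_x j] at h
  exact s.c_inj hG (π.inj _ _ x h (by rw [s.mate_x i]; exact s.z_ne_x hG i))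

lemma c_notMem (i : Fin 3) : c i ∉ π.miss x := by
  rw [mem_miss, s.mate_x i]
  exact s.z_ne_x hG i

lemma y_mem_R (i : Fin 3) : y i ∈ π.R x := mem_R_of_reachable (s.hU i).reachable (s.hU i).symm

lemma x_mem_R : x ∈ π.R x := mem_R_of_reachable .rfl (s.hU 0)

lemma z_mem_R (i : Fin 3) : z i ∈ π.R x :=
  Or.inr ⟨y i, x, c i, (s.hU i).reachable, (s.hU i).symm, s.mate_y i, s.mate_x i, s.z_ne_x hG i,
    Or.inl (s.d_y i)⟩

/-- The central step for stars: from a leaf `y i` joined to another pair `y j`, `z j` by a color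
missing at the center, follow the color `c j`. -/
lemma mate_c (hij : i ≠ j) (hil : i ≠ l) (hjl : j ≠ l) (ha : a ∈ π.miss x) {m : V}
    (hm : m = y j ∨ m = z j) (ham : π.mate a (y i) = m) :
    (∀ n, n = y l ∨ n = z l → π.mate (c j) (y i) ≠ n) ∧
      (π.mate (c j) (y i) ∉ π.R x → ∀ x', π.mate (c j) (y i) ∉ π.R x') := by
  have hyij : y i ≠ y j := fun h => hij (s.inj h)
  have hyil : y i ≠ y l := fun h => hil (s.inj h)
  have hyjl : y j ≠ y l := fun h => hjl (s.inj h)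
  have hzjl : z j ≠ z l := fun h => hjl (s.z_inj hG h)
  have hcjl : c j ≠ c l := fun h => hjl (s.c_inj hG h)
  have hm' : m ≠ x ∧ m ≠ y l ∧ m ≠ z l ∧ m ≠ y i := by
    rcases hm with rfl | rfl
    · exact ⟨s.hyx j, hyjl, (s.z_ne_y hG l j).symm, hyij.symm⟩
    · exact ⟨s.z_ne_x hG j, s.z_ne_y hG j l, hzjl, s.z_ne_y hG j i⟩
  obtain ⟨hmx, hmyl, hmzl, hmi⟩ := hm'
  suffices H : ∀ n, n = y l ∨ n = z l → π.mate (c j) (y i) ≠ n ∧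
      (π.mate (c j) (y i) ∉ π.R x → ∀ x', π.mate (c j) (y i) ∉ π.R x') from
    ⟨fun n hn => (H n hn).1, (H (y l) (Or.inl rfl)).2⟩
  intro n hn
  have hn' : n ≠ x ∧ n ≠ y i ∧ n ≠ m ∧ n ∈ π.R x := by
    rcases hn with rfl | rfl
    · exact ⟨s.hyx l, hyil.symm, hmyl.symm, s.y_mem_R hG l⟩
    · exact ⟨s.z_ne_x hG l, s.z_ne_y hG l i, hmzl.symm, s.z_mem_R hG l⟩
  obtain ⟨hnx, hni, hnm, hnR⟩ := hn'
  have hmR : m ∈ π.R x := by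
    rcases hm with rfl | rfl
    · exact s.y_mem_R hG j
    · exact s.z_mem_R hG j
  obtain ⟨π₁, hF₁, h11, h12, h13, h14, h15, h16, h17⟩ := s.best.1.exists_leaf (s.hU j) (s.d_y j)
    (s.mate_y j) (s.mate_x j) (s.z_ne_x hG j) hm
  obtain ⟨g1, g2, g3⟩ := h16 (y l) (s.hyx l) hyjl.symm (s.z_ne_y hG j l).symm
  obtain ⟨π₂, hF₂, h21, h22, h23, h24, h25, h26, h27⟩ := hF₁.exists_leaf (g1 (s.hU l))
    (by rw [g2, s.d_y l]) (by rw [g3, s.mate_y l])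
    (by rw [h17 _ hcjl.symm, s.mate_x l]) (s.z_ne_x hG l) hn
  obtain ⟨f1, f2, f3⟩ := h26 m hmx hmyl hmzl
  obtain ⟨e1, e2, e3⟩ := h16 (y i) (s.hyx i) hyij (s.z_ne_y hG j i).symm
  obtain ⟨e1', e2', e3'⟩ := h26 (y i) (s.hyx i) hyil (s.z_ne_y hG l i).symm
  have dx : π₂.d x = 3 := by rw [h24, h14, s.d_x]
  have dm : π₂.d m = 1 := by rw [f2, h12]
  have di : π₂.d (y i) = 1 := by rw [e2', e2, s.d_y]
  have hax : π₂.mate a x = x := by rw [← mem_miss, h25, h15]; exact ha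
  have hami : π₂.mate a m = y i := by rw [mate_eq_comm, e3', e3, ham]
  have hcm : π₂.mate (c j) m = m := by rw [f3, h13]
  have hci : π₂.mate (c j) (y i) = π.mate (c j) (y i) := by rw [e3', e3]
  have hmne : π₂.U.Adj x m := f1 h11
  constructor
  · rw [← hci]
    exact hF₂.star_no_triangle hmne h21 hmi hni.symm dx dm di h22 hax hami hcm
  · intro hq
    obtain ⟨π₃, t⟩ := exists_shift hmne hax hami hmi.symm
    have hac : c j ≠ a := by rintro rfl; exact s.c_notMem hG j ha
    have hag : ∀ v ∉ π.R x, ∀ a, π₃.mate a v = π.mate a v := by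
      intro v hv a
      have hne : ∀ {w}, w ∈ π.R x → v ≠ w := fun hw h => hv (h ▸ hw)
      rw [t.mate_eq (hne (s.x_mem_R hG)) (hne hmR) (hne (s.y_mem_R hG i)),
        (h26 v (hne (s.x_mem_R hG)) (hne (s.y_mem_R hG l)) (hne (s.z_mem_R hG l))).2.2,
        (h16 v (hne (s.x_mem_R hG)) (hne (s.y_mem_R hG j)) (hne (s.z_mem_R hG j))).2.2]
    have hU3 : ∀ v, v ≠ m → π₂.U.Adj x v → π₃.U.Adj x v := by
      intro v hv h
      refine t.U_mono h ?_
      rw [ne_eq, Sym2.eq_iff]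
      rintro (⟨-, h'⟩ | ⟨h', -⟩)
      · exact hv h'
      · exact hmx h'.symm
    have hUi := hU3 (y i) hmi.symm (e1' (e1 (s.hU i)))
    have hUn := hU3 n hnm h21
    refine s.best.1.unowned hG (t.opt hF₂.1) hag hmR t.U_yz
      (by rw [t.mate_of_color_ne _ hac, hcm]) (by rw [t.mate_of_color_ne _ hac, hci]) hq ?_
    have hT : ∀ v ∈ ({m, y i, x, n} : Finset V), π₃.U.Reachable m v := by
      have r1 := t.U_yz.reachable
      have r2 := r1.trans hUi.symm.reachable
      simp [r1, r2, r2.trans hUn.reachable]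
    refine (t.opt hF₂.1).big hG hT ?_
    rw [sum_insert, sum_insert, sum_pair hnx.symm]
    · have := d_le_miss hG π₃ m; have := d_le_miss hG π₃ x
      have := d_le_miss hG π₃ n; have := d_le_miss hG π₃ (y i)
      have := t.d_x; have := t.d_y; have := t.d_z
      have := t.d_eq hnx hni
      omega
    · simp [s.hyx i, hni.symm]
    · simp [hmi, hmx, hnm.symm]

lemma bonus_pos (hR : ∀ v ∈ π.R x, v = x ∨ ∃ i, v = y i ∨ v = z i)
    (hij : i ≠ j) (hil : i ≠ l) (hjl : j ≠ l)
    (h1 : ∃ a ∈ π.miss x, π.mate a (y i) = y j ∨ π.mate a (y i) = z j)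
    (h2 : ∃ a ∈ π.miss x, π.mate a (y i) = y l ∨ π.mate a (y i) = z l) :
    0 < π.bonus (y i) := by
  have key : ∀ j l, i ≠ j → i ≠ l → j ≠ l →
      (∃ a ∈ π.miss x, π.mate a (y i) = y j ∨ π.mate a (y i) = z j) →
      π.mate (c j) (y i) ≠ z i → 0 < π.bonus (y i) := by
    rintro j l hij hil hjl ⟨a, ha, hm⟩ hne
    obtain ⟨h1, h2⟩ := s.mate_c hG hij hil hjl ha hm rfl
    refine card_pos.2 ⟨c j, ?_⟩
    simp only [mem_filter, mem_univ, true_and]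
    refine h2 fun hR' => ?_
    rcases hR _ hR' with h | ⟨m, hm⟩
    · exact (s.hU i).symm.2 _ h
    · have hcov : m = i ∨ m = j ∨ m = l := by omega
      have hyi : π.mate (c j) (y i) ≠ y i := by
        rw [ne_eq, ← mem_miss, s.miss_y i, mem_singleton]
        exact fun h => hij (s.c_inj hG h).symm
      rcases hcov with rfl | rfl | rfl
      · exact hm.elim hyi hne
      · rcases hm with h | h
        · have := (mate_eq_comm.1 h).symm.trans (s.mate_y m)
          exact hij (s.inj this)
        · have := (mate_eq_comm.1 h).symm.trans (s.mate_z m)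
          exact s.hyx i this
      · exact h1 _ hm rfl
  by_cases h : π.mate (c j) (y i) = z i
  · refine key l j hil hij hjl.symm h2 fun h' => ?_
    have h3 : π.mate (c j) (y i) ≠ y i := by rw [h]; exact s.z_ne_y hG i i
    exact hjl (s.c_inj hG (π.inj _ _ _ (h.trans h'.symm) h3))
  · exact key j l hij hil hjl h1 h

lemma bonus_sum (hR : ∀ v ∈ π.R x, v = x ∨ ∃ i, v = y i ∨ v = z i)
    (hN : ∀ i, ∀ a ∈ π.miss x, ∃ j, π.mate a (y i) = y j ∨ π.mate a (y i) = z j)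
    (h4 : #(π.miss x) = 3 ∨ #(π.miss x) = 4) :
    #(π.miss x) ≤ 2 + ∑ i, π.bonus (y i) := by
  let H : Fin 3 → Fin 3 → Prop := fun i j =>
    ∃ a ∈ π.miss x, π.mate a (y i) = y j ∨ π.mate a (y i) = z j
  let A : Fin 3 → Fin 3 → Prop := fun i j => ∃ a ∈ π.miss x, π.mate a (y i) = y j
  have hA : ∀ i j, A i j → A j i := by
    rintro i j ⟨a, ha, h⟩
    exact ⟨a, ha, mate_eq_comm.1 h⟩
  have hAH : ∀ i j, A i j → H i j := by
    rintro i j ⟨a, ha, h⟩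
    exact ⟨a, ha, Or.inl h⟩
  have hb : ∀ i j l, i ≠ j → i ≠ l → j ≠ l → H i j → H i l → 0 < π.bonus (y i) :=
    fun i j l h1 h2 h3 h4 h5 => s.bonus_pos hG hR h1 h2 h3 h4 h5
  have hny : ∀ i, ∀ a ∈ π.miss x, π.mate a (y i) ≠ y i := fun i a ha =>
    s.best.1.1.mate_ne hG (s.hU i).reachable (s.hU i).ne ha
  have hcard : ∀ i, #(π.nbrs (y i) (π.miss x)) = #(π.miss x) := fun i => card_nbrs (hny i)
  have hnot : ∀ i j l, i ≠ j → i ≠ l → j ≠ l → ¬ H i l →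
      #(π.miss x) = 3 ∧ A i j := by
    intro i j l hij hil hjl hH
    have hsub : π.nbrs (y i) (π.miss x) ⊆ {z i, y j, z j} := by
      intro v hv
      obtain ⟨a, ha, rfl⟩ := mem_nbrs.1 hv
      obtain ⟨m, hm⟩ := hN i a ha
      have hcov : m = i ∨ m = j ∨ m = l := by omega
      simp only [mem_insert, mem_singleton]
      rcases hcov with rfl | rfl | rfl
      · exact Or.inl (hm.resolve_left (hny m a ha))
      · exact Or.inr hm
      · exact absurd ⟨a, ha, hm⟩ hH
    have hle := card_le_card hsub
    rw [hcard] at hle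
    have h3 : #({z i, y j, z j} : Finset V) ≤ 3 := card_le_three
    have h5 : #(π.miss x) = 3 := by omega
    refine ⟨h5, ?_⟩
    have heq := eq_of_subset_of_card_le hsub (by rw [hcard]; omega)
    have : y j ∈ π.nbrs (y i) (π.miss x) := by rw [heq]; simp
    obtain ⟨a, ha, h⟩ := mem_nbrs.1 this
    exact ⟨a, ha, h⟩
  rw [Fin.sum_univ_three]
  have b0 := hb 0 1 2 (by decide) (by decide) (by decide)
  have b1 := hb 1 0 2 (by decide) (by decide) (by decide)
  have b2 := hb 2 0 1 (by decide) (by decide) (by decide)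
  have n01 := hnot 0 1 2 (by decide) (by decide) (by decide)
  have n02 := hnot 0 2 1 (by decide) (by decide) (by decide)
  have n10 := hnot 1 0 2 (by decide) (by decide) (by decide)
  have n12 := hnot 1 2 0 (by decide) (by decide) (by decide)
  have n20 := hnot 2 0 1 (by decide) (by decide) (by decide)
  have n21 := hnot 2 1 0 (by decide) (by decide) (by decide)
  by_cases h5 : #(π.miss x) = 4
  · have b0' := b0 (by by_contra h; have := n02 h; omega) (by by_contra h; have := n01 h; omega)
    have b1' := b1 (by by_contra h; have := n12 h; omega) (by by_contra h; have := n10 h; omega)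
    omega
  · suffices 0 < π.bonus (y 0) ∨ 0 < π.bonus (y 1) ∨ 0 < π.bonus (y 2) by omega
    by_contra! hcon
    obtain ⟨z0, z1, z2⟩ := hcon
    have m0 : H 0 1 → ¬ H 0 2 := fun h h' => absurd (b0 h h') (by omega)
    have m1 : H 1 0 → ¬ H 1 2 := fun h h' => absurd (b1 h h') (by omega)
    have m2 : H 2 0 → ¬ H 2 1 := fun h h' => absurd (b2 h h') (by omega)
    by_cases h01 : H 0 1
    · have h12 := m1 (hAH _ _ (hA _ _ (n01 (m0 h01)).2))
      by_cases h20 : H 2 0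
      · exact m0 h01 (hAH _ _ (hA _ _ (n20 (m2 h20)).2))
      · exact h12 (hAH _ _ (hA _ _ (n21 h20).2))
    · have h21 := m2 (hAH _ _ (hA _ _ (n02 h01).2))
      by_cases h10 : H 1 0
      · exact h01 (hAH _ _ (hA _ _ (n10 (m1 h10)).2))
      · exact h21 (hAH _ _ (hA _ _ (n12 h10).2))

end IsStar

variable (hG : ∀ v, (G.neighborSet v).ncard ≤ 7)
include hG

lemma Best.charge_star (hB : π.Best) (hU : ∀ i, π.U.Adj x (y i)) (hy : Function.Injective y)
    (hdx : π.d x = 3) (hdy : ∀ i, π.d (y i) = 1)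
    (hC : ∀ v, π.U.Reachable x v → v = x ∨ ∃ i, v = y i) :
    ∃ W : Finset V, (∀ w ∈ W, w ∈ π.R x) ∧ 44 ≤ ∑ w ∈ W, π.val w := by
  have hO := hB.1.1
  have hm := fun z => d_le_miss hG π z
  have hxy : x ∉ univ.image y := by
    simp only [mem_image, mem_univ, true_and, not_exists]
    exact fun i h => (hU i).ne h.symm
  set T : Finset V := insert x (univ.image y) with hTdef
  have hT : ∀ v ∈ T, π.U.Reachable x v := by
    intro v hv
    simp only [hTdef, mem_insert, mem_image, mem_univ, true_and] at hv
    rcases hv with rfl | ⟨i, rfl⟩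
    · exact .rfl
    · exact (hU i).reachable
  have hTsum : ∀ f : V → ℕ, ∑ v ∈ T, f v = f x + ∑ i, f (y i) := by
    intro f
    rw [hTdef, sum_insert hxy, sum_image fun i _ j _ h => hy h]
  have hTd : ∀ v ∈ T, π.U.Reachable x v ∧ π.d v ≠ 0 := by
    intro v hv
    refine ⟨hT v hv, ?_⟩
    simp only [hTdef, mem_insert, mem_image, mem_univ, true_and] at hv
    rcases hv with rfl | ⟨i, rfl⟩
    · omega
    · rw [hdy i]; omega
  have hTc : #T = 4 := by
    rw [hTdef, card_insert_of_notMem hxy, card_image_of_injective _ hy]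
    simp
  have hsum := hO.sum_miss_le hG hT
  rw [hTsum] at hsum
  have hyi : ∀ i, 1 ≤ #(π.miss (y i)) := fun i => by
    have := hm (y i); have := hdy i; omega
  have hbig : π.Big x := by
    refine hO.big hG hT ?_
    rw [hTsum, Fin.sum_univ_three]
    have := hm x; have := hyi 0; have := hyi 1; have := hyi 2
    omega
  have hne : ∀ i, ∀ c ∈ π.miss (y i), π.mate c x ≠ x := fun i c hc =>
    hO.mate_ne hG (hU i).symm.reachable (hU i).ne' hc
  have hnb : ∀ i, ∀ z ∈ π.nbrs x (π.miss (y i)),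
      z ∈ π.R x ∧ ¬ π.U.Reachable x z ∧ 6 ≤ π.val z := by
    intro i z hz
    obtain ⟨c, hc, hcz⟩ := mem_nbrs.1 hz
    have hzx : z ≠ x := hcz ▸ hne i c hc
    have h1 := hB.1.d_lt (hU i).symm (mem_miss.1 hc) hcz hzx
    have hr : ¬ π.U.Reachable x z := not_reachable_of_d_eq_zero (by have := hdy i; omega) hzx
    exact ⟨hO.mem_R_of_attach hG (hU i).reachable (hU i).symm hc hcz hbig, hr,
      hO.six_le_val_of_attach hG (hU i).symm (mem_miss.1 hc) hcz hzx
        (fun h => hr ((hU i).reachable.trans h)) (hbig.of_reachable (hU i).reachable)⟩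
  have hdis : ∀ i j, i ≠ j → Disjoint (π.miss (y i)) (π.miss (y j)) := fun i j hij =>
    hO.disjoint_miss hG ((hU i).symm.reachable.trans (hU j).reachable) fun h => hij (hy h)
  have hNc : #(univ.biUnion fun i => π.nbrs x (π.miss (y i))) = ∑ i, #(π.miss (y i)) := by
    rw [card_biUnion]
    · exact sum_congr rfl fun i _ => card_nbrs (hne i)
    · exact fun i _ j _ hij => disjoint_nbrs (hne i) (hdis i j hij)
  have hNb : ∀ z ∈ univ.biUnion fun i => π.nbrs x (π.miss (y i)),
      z ∈ π.R x ∧ ¬ π.U.Reachable x z ∧ 6 ≤ π.val z := by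
    intro z hz
    obtain ⟨i, -, hi⟩ := mem_biUnion.1 hz
    exact hnb i z hi
  by_cases h3 : 4 ≤ ∑ i, #(π.miss (y i))
  · exact hO.charge_of_card hG hTd hNb (by rw [hTc, hNc]; omega)
  have h1 : ∀ i, #(π.miss (y i)) = 1 := by
    rw [Fin.sum_univ_three] at h3
    have := hyi 0; have := hyi 1; have := hyi 2
    intro i
    fin_cases i <;> simp <;> omega
  simp only [card_eq_one] at h1
  choose c hc using h1
  have s : IsStar π x y (fun i => π.mate (c i) x) c :=
    ⟨hB, hU, hy, hdx, hdy, hc, fun _ => rfl, hC⟩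
  set z : Fin 3 → V := fun i => π.mate (c i) x with hz
  have hzN : univ.image z ⊆ univ.biUnion fun i => π.nbrs x (π.miss (y i)) := by
    intro v hv
    obtain ⟨i, -, rfl⟩ := mem_image.1 hv
    exact mem_biUnion.2 ⟨i, mem_univ i, mem_nbrs.2 ⟨c i, by simp [hc], rfl⟩⟩
  have hzc : #(univ.image z) = 3 := by
    rw [card_image_of_injective _ (s.z_inj hG)]; simp
  by_cases h4 : ∃ q ∈ π.R x, q ∉ T ∪ univ.image z
  · obtain ⟨q, hq, hqT⟩ := h4
    simp only [mem_union, not_or] at hqT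
    have hqr : ¬ π.U.Reachable x q := by
      intro hr
      apply hqT.1
      rw [hTdef]
      rcases hC q hr with rfl | ⟨i, rfl⟩ <;> simp
    refine hO.charge_of_card hG (T := T) (N := insert q (univ.image z)) hTd ?_ ?_
    · intro v hv
      rcases mem_insert.1 hv with rfl | hv
      · refine ⟨hq, hqr, ?_⟩
        rcases hq with hq | ⟨u, v', e, hu, huv, heu, hev, hqv, -⟩
        · exact absurd hq.1 hqr
        · exact hO.six_le_val_of_attach hG huv heu hev hqv (fun h => hqr (hu.trans h))
            (hbig.of_reachable hu)
      · exact hNb v (hzN hv)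
    · rw [hTc, card_insert_of_notMem hqT.2, hzc]
      norm_num
  · push Not at h4
    have hR : ∀ v ∈ π.R x, v = x ∨ ∃ i, v = y i ∨ v = z i := by
      intro v hv
      have := h4 v hv
      simp only [hTdef, mem_union, mem_insert, mem_image, mem_univ, true_and] at this
      rcases this with (h | ⟨i, h⟩) | ⟨i, h⟩
      · exact Or.inl h
      · exact Or.inr ⟨i, Or.inl h.symm⟩
      · exact Or.inr ⟨i, Or.inr h.symm⟩
    have hbs := s.bonus_sum hG hR ?_ ?_
    · have hd : Disjoint T (univ.image z) := by
        rw [Finset.disjoint_left]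
        exact fun v hv hv' => (hNb v (hzN hv')).2.1 (hT v hv)
      refine ⟨T ∪ univ.image z, ?_, ?_⟩
      · intro v hv
        rcases mem_union.1 hv with hv | hv
        · exact Or.inl (hTd v hv)
        · exact (hNb v (hzN hv)).1
      · rw [sum_union hd, hTsum, sum_image fun i _ j _ h => s.z_inj hG h]
        have e1 := π.col_add_miss x
        have e2 := π.col_le_val x
        have e3 : ∀ i, 6 + π.bonus (y i) ≤ π.val (y i) := fun i => by
          have := π.col_add_miss (y i)
          rw [hc i, card_singleton] at this
          rw [val]
          omega
        have e4 : ∀ i, 7 ≤ π.val (z i) := fun i => by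
          have := π.col_add_miss (z i)
          rw [s.miss_z hG i, card_empty] at this
          have := π.col_le_val (z i)
          omega
        rw [Fin.sum_univ_three] at hbs
        rw [Fin.sum_univ_three, Fin.sum_univ_three]
        have := e3 0; have := e3 1; have := e3 2
        have := e4 0; have := e4 1; have := e4 2
        omega
    · intro i a ha
      have h5 := hO.mem_R_of_attach hG .rfl (hU i) ha rfl hbig
      rcases hR _ h5 with h | h
      · exact absurd h ((hU i).symm.2 a)
      · exact h
    · have := hm x
      rw [Fin.sum_univ_three] at hsum
      have := hyi 0; have := hyi 1; have := hyi 2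
      omega

end PCol
end PartialColoring

namespace PartialColoring
open Finset Classical

variable {V : Type*} [Fintype V] {G : SimpleGraph V}

namespace PCol
variable {π π' π₀ : PCol G} {t u v w x p q r x₀ x' : V} {a b e k : Fin 7}

/-- The possible components of the graph of uncolored edges. -/
inductive Shape (π : PCol G) (x₀ : V) : Prop
  | edge (x y : V) (hr : π.U.Reachable x₀ x) (hxy : π.U.Adj x y) (hdx : π.d x = 1)
      (hdy : π.d y = 1) (hC : ∀ z, π.U.Reachable x z → z = x ∨ z = y)
  | twoEdges (x y w : V) (hr : π.U.Reachable x₀ x) (hxy : π.U.Adj x y) (hxw : π.U.Adj x w)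
      (hyw : y ≠ w) (hdx : π.d x = 2) (hdy : π.d y = 1) (hdw : π.d w = 1)
      (hC : ∀ z, π.U.Reachable x z → z = x ∨ z = y ∨ z = w)
  | path (w u v t : V) (hr : π.U.Reachable x₀ u) (hwu : π.U.Adj w u) (huv : π.U.Adj u v)
      (hvt : π.U.Adj v t) (hwt : w ≠ t) (hdw : π.d w = 1) (hdu : π.d u = 2) (hdv : π.d v = 2)
      (hdt : π.d t = 1) (hC : ∀ z, π.U.Reachable u z → z = w ∨ z = u ∨ z = v ∨ z = t)
  | star (x : V) (y : Fin 3 → V) (hr : π.U.Reachable x₀ x) (hU : ∀ i, π.U.Adj x (y i))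
      (hy : Function.Injective y) (hdx : π.d x = 3) (hdy : ∀ i, π.d (y i) = 1)
      (hC : ∀ z, π.U.Reachable x z → z = x ∨ ∃ i, z = y i)
  | triangle (y : Fin 3 → V) (hr : π.U.Reachable x₀ (y 0))
      (hU : ∀ i j, i ≠ j → π.U.Adj (y i) (y j)) (hdy : ∀ i, π.d (y i) = 2)
      (hC : ∀ z, π.U.Reachable (y 0) z → ∃ i, z = y i)

lemma d_eq_one (hd : π.d x = 1) (hxy : π.U.Adj x y) : π.U.Adj x v ↔ v = y := by
  obtain ⟨z, hz⟩ := card_eq_one.1 hd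
  have h : ∀ v, π.U.Adj x v ↔ v = z := fun v => by
    have := congrArg (v ∈ ·) hz
    simpa using this
  rw [h, (h y).1 hxy]

lemma d_eq_two {y w : V} (hd : π.d x = 2) (hxy : π.U.Adj x y) (hxw : π.U.Adj x w) (hyw : y ≠ w) :
    π.U.Adj x v ↔ v = y ∨ v = w := by
  have h : ({y, w} : Finset V) = ({u | π.U.Adj x u} : Finset V) := by
    refine eq_of_subset_of_card_le ?_ ?_
    · intro v hv
      simp only [mem_insert, mem_singleton] at hv
      rcases hv with rfl | rfl <;> simpa
    · rw [card_pair hyw]; exact hd.le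
  have := congrArg (v ∈ ·) h
  simpa using this.symm

variable (hG : ∀ v, (G.neighborSet v).ncard ≤ 7)
include hG

lemma Opt.sum_d_le (hO : π.Opt) {T : Finset V} (hT : ∀ v ∈ T, π.U.Reachable x v) :
    ∑ v ∈ T, π.d v ≤ 7 :=
  (sum_le_sum fun v _ => d_le_miss hG π v).trans (hO.sum_miss_le hG hT)

lemma Opt.shape (hO : π.Opt) (h₀ : π.d x₀ ≠ 0) : π.Shape x₀ := by
  obtain ⟨x, hx, hmax⟩ := exists_max_image ({v | π.U.Reachable x₀ v} : Finset V) π.d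
    ⟨x₀, by simp⟩
  simp only [mem_filter, mem_univ, true_and] at hx hmax
  have hle : ∀ v, π.U.Reachable x v → π.d v ≤ π.d x := fun v hv => hmax v (hx.trans hv)
  have hsum : ∀ T : Finset V, (∀ v ∈ T, π.U.Reachable x v) → ∑ v ∈ T, π.d v ≤ 7 :=
    fun T hT => hO.sum_d_le hG hT
  have hpos : π.d x ≠ 0 := by have := hmax x₀ .rfl; omega
  have hd1 : ∀ {u v}, π.U.Adj u v → 1 ≤ π.d v := fun h => d_pos_of_adj h.symm
  have hex : ∀ v u, π.U.Adj v u → 2 ≤ π.d v → ∃ t, π.U.Adj v t ∧ t ≠ u := by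
    intro v u _ hv
    obtain ⟨t, ht, htu⟩ := exists_mem_ne (s := ({u | π.U.Adj v u} : Finset V)) hv u
    exact ⟨t, by simpa using ht, htu⟩
  have h3 : π.d x ≤ 3 := by
    by_contra h4
    have h5 := hsum (insert x ({u | π.U.Adj x u} : Finset V)) (by
      intro v hv
      simp only [mem_insert, mem_filter, mem_univ, true_and] at hv
      rcases hv with rfl | hv
      · exact .rfl
      · exact hv.reachable)
    rw [sum_insert (by simp)] at h5
    have h6 : #{u | π.U.Adj x u} ≤ ∑ u with π.U.Adj x u, π.d u := by
      rw [card_eq_sum_ones]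
      exact sum_le_sum fun u hu => hd1 (by simpa using hu : π.U.Adj x u)
    change π.d x ≤ _ at h6
    omega
  have hcases : π.d x = 1 ∨ π.d x = 2 ∨ π.d x = 3 := by omega
  rcases hcases with hdx | hdx | hdx
  · obtain ⟨y, hy⟩ := d_pos.1 (by omega : 0 < π.d x)
    have hdy : π.d y = 1 := by have := hle y hy.reachable; have := hd1 hy; omega
    refine .edge x y hx hy hdx hdy fun z hz => ?_
    refine mem_of_reachable (S := {z | z = x ∨ z = y}) (Or.inl rfl) ?_ hz
    rintro u (rfl | rfl) v huv
    · exact Or.inr ((d_eq_one hdx hy).1 huv)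
    · exact Or.inl ((d_eq_one hdy hy.symm).1 huv)
  · obtain ⟨y, w, hyw, hN⟩ := card_eq_two.1 hdx
    have hN' : ∀ v, π.U.Adj x v ↔ v = y ∨ v = w := fun v => by
      have := congrArg (v ∈ ·) hN
      simpa using this
    have hxy : π.U.Adj x y := (hN' y).2 (Or.inl rfl)
    have hxw : π.U.Adj x w := (hN' w).2 (Or.inr rfl)
    have hdy := hle y hxy.reachable
    have hdw := hle w hxw.reachable
    have hdy' := hd1 hxy
    have hdw' := hd1 hxw
    have hpath : ∀ y w, π.U.Adj x y → π.U.Adj x w → y ≠ w → π.d y = 2 → π.d w = 1 →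
        π.Shape x₀ := by
      intro y w hxy hxw hyw hdy hdw
      obtain ⟨t, hyt, htx⟩ := hex y x hxy.symm (by omega)
      have htw : t ≠ w := by
        rintro rfl
        exact hxy.ne ((d_eq_one hdw hxw.symm).1 hyt.symm).symm
      have hrt := hxy.reachable.trans hyt.reachable
      have hdt : π.d t = 1 := by
        by_contra hdt
        have := hd1 hyt
        obtain ⟨t', htt', hty⟩ := hex t y hyt.symm (by omega)
        have h1 : t' ≠ x := by
          rintro rfl
          rcases (d_eq_two hdx hxy hxw hyw).1 htt'.symm with h | h
          · exact hyt.ne h.symm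
          · exact htw h
        have h2 : t' ≠ w := by
          rintro rfl
          exact htx ((d_eq_one hdw hxw.symm).1 htt'.symm)
        have h5 := hsum {x, y, w, t, t'} (by
          simp [hxy.reachable, hxw.reachable, hrt, hrt.trans htt'.reachable])
        rw [sum_insert, sum_insert, sum_insert, sum_pair htt'.ne] at h5
        · have := hd1 htt'
          omega
        · simp [htw.symm, h2.symm]
        · simp [hyw, hyt.ne, hty.symm]
        · simp [hxy.ne, hxw.ne, htx.symm, h1.symm]
      refine .path w x y t hx hxw.symm hxy hyt htw.symm hdw hdx hdy hdt fun z hz => ?_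
      refine mem_of_reachable (S := {z | z = w ∨ z = x ∨ z = y ∨ z = t}) (by simp) ?_ hz
      rintro u (rfl | rfl | rfl | rfl) v huv
      · exact Or.inr (Or.inl ((d_eq_one hdw hxw.symm).1 huv))
      · rcases (d_eq_two hdx hxy hxw hyw).1 huv with h | h
        · exact Or.inr (Or.inr (Or.inl h))
        · exact Or.inl h
      · rcases (d_eq_two hdy hxy.symm hyt htx.symm).1 huv with h | h
        · exact Or.inr (Or.inl h)
        · exact Or.inr (Or.inr (Or.inr h))
      · exact Or.inr (Or.inr (Or.inl ((d_eq_one hdt hyt.symm).1 huv)))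
    by_cases hy2 : π.d y = 2
    · by_cases hw2 : π.d w = 2
      · by_cases hyw' : π.U.Adj y w
        · refine .triangle ![x, y, w] hx ?_ ?_ ?_
          · intro i j hij
            fin_cases i <;> fin_cases j <;>
              first
              | exact absurd rfl hij
              | simpa using hxy
              | simpa using hxw
              | simpa using hyw'
              | simpa using hxy.symm
              | simpa using hxw.symm
              | simpa using hyw'.symm
          · intro i
            fin_cases i <;> simpa
          · intro z hz
            have : z = x ∨ z = y ∨ z = w := by
              refine mem_of_reachable (S := {z | z = x ∨ z = y ∨ z = w}) (by simp) ?_ hz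
              rintro u (rfl | rfl | rfl) v huv
              · exact Or.inr ((d_eq_two hdx hxy hxw hyw).1 huv)
              · rcases (d_eq_two hy2 hxy.symm hyw' hxw.ne).1 huv with h | h
                · exact Or.inl h
                · exact Or.inr (Or.inr h)
              · rcases (d_eq_two hw2 hxw.symm hyw'.symm hxy.ne).1 huv with h | h
                · exact Or.inl h
                · exact Or.inr (Or.inl h)
            rcases this with h | h | h
            · exact ⟨0, h⟩
            · exact ⟨1, h⟩
            · exact ⟨2, h⟩
        · exfalso
          obtain ⟨t, hyt, htx⟩ := hex y x hxy.symm (by omega)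
          obtain ⟨t', hwt', htx'⟩ := hex w x hxw.symm (by omega)
          have htw : t ≠ w := by rintro rfl; exact hyw' hyt
          have hty' : t' ≠ y := by rintro rfl; exact hyw' hwt'.symm
          have hrt := hxy.reachable.trans hyt.reachable
          have hrt' := hxw.reachable.trans hwt'.reachable
          by_cases htt : t = t'
          · subst htt
            have h2 : 2 ≤ π.d t := by
              refine one_lt_card.2 ⟨y, ?_, w, ?_, hyw⟩
              · simpa using hyt.symm
              · simpa using hwt'.symm
            have h5 := hsum {x, y, w, t} (by simp [hxy.reachable, hxw.reachable, hrt])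
            rw [sum_insert, sum_insert, sum_pair htw.symm] at h5
            · omega
            · simp [hyw, hyt.ne]
            · simp [hxy.ne, hxw.ne, htx.symm]
          · have h5 := hsum {x, y, w, t, t'} (by
              simp [hxy.reachable, hxw.reachable, hrt, hrt'])
            rw [sum_insert, sum_insert, sum_insert, sum_pair htt] at h5
            · have := hd1 hyt
              have := hd1 hwt'
              omega
            · simp [htw.symm, hwt'.ne]
            · simp [hyw, hyt.ne, hty'.symm]
            · simp [hxy.ne, hxw.ne, htx.symm, htx'.symm]
      · exact hpath y w hxy hxw hyw hy2 (by omega)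
    · by_cases hw2 : π.d w = 2
      · exact hpath w y hxw hxy hyw.symm hw2 (by omega)
      · have hdy1 : π.d y = 1 := by omega
        have hdw1 : π.d w = 1 := by omega
        refine .twoEdges x y w hx hxy hxw hyw hdx hdy1 hdw1 fun z hz => ?_
        refine mem_of_reachable (S := {z | z = x ∨ z = y ∨ z = w}) (by simp) ?_ hz
        rintro u (rfl | rfl | rfl) v huv
        · exact Or.inr ((hN' v).1 huv)
        · exact Or.inl ((d_eq_one hdy1 hxy.symm).1 huv)
        · exact Or.inl ((d_eq_one hdw1 hxw.symm).1 huv)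
  · obtain ⟨y₁, y₂, y₃, h12, h13, h23, hN⟩ := card_eq_three.1 hdx
    have hN' : ∀ v, π.U.Adj x v ↔ v = y₁ ∨ v = y₂ ∨ v = y₃ := fun v => by
      have := congrArg (v ∈ ·) hN
      simpa using this
    have h1 : π.U.Adj x y₁ := (hN' _).2 (by simp)
    have h2 : π.U.Adj x y₂ := (hN' _).2 (by simp)
    have h3 : π.U.Adj x y₃ := (hN' _).2 (by simp)
    have key : ∀ y₁ y₂ y₃, y₁ ≠ y₂ → y₁ ≠ y₃ → y₂ ≠ y₃ → π.U.Adj x y₁ → π.U.Adj x y₂ →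
        π.U.Adj x y₃ → π.d y₁ = 1 := by
      intro y₁ y₂ y₃ h12 h13 h23 h1 h2 h3
      by_contra hd
      have d1 := hd1 h1
      have d2 := hd1 h2
      have d3 := hd1 h3
      obtain ⟨t, hyt, htx⟩ := hex y₁ x h1.symm (by omega)
      have hrt := h1.reachable.trans hyt.reachable
      have hd2 : ∀ y, π.U.Adj x y → t = y → 2 ≤ π.d y := by
        rintro y hxy rfl
        refine one_lt_card.2 ⟨x, ?_, y₁, ?_, h1.ne⟩
        · simpa using hxy.symm
        · simpa using hyt.symm
      by_cases ht : t = y₂ ∨ t = y₃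
      · have h5 := hsum {x, y₁, y₂, y₃} (by simp [h1.reachable, h2.reachable, h3.reachable])
        rw [sum_insert, sum_insert, sum_pair h23] at h5
        · rcases ht with ht | ht
          · have := hd2 _ h2 ht
            omega
          · have := hd2 _ h3 ht
            omega
        · simp [h12, h13]
        · simp [h1.ne, h2.ne, h3.ne]
      · push Not at ht
        have h5 := hsum {x, y₁, y₂, y₃, t} (by
          simp [h1.reachable, h2.reachable, h3.reachable, hrt])
        rw [sum_insert, sum_insert, sum_insert, sum_pair ht.2.symm] at h5
        · have := hd1 hyt
          omega
        · simp [h23, ht.1.symm]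
        · simp [h12, h13, hyt.ne]
        · simp [h1.ne, h2.ne, h3.ne, htx.symm]
    have d1 := key y₁ y₂ y₃ h12 h13 h23 h1 h2 h3
    have d2 := key y₂ y₁ y₃ h12.symm h23 h13 h2 h1 h3
    have d3 := key y₃ y₁ y₂ h13.symm h23.symm h12 h3 h1 h2
    refine .star x ![y₁, y₂, y₃] hx ?_ ?_ hdx ?_ ?_
    · intro i
      fin_cases i <;> simpa
    · intro i j hij
      fin_cases i <;> fin_cases j <;> simp_all
    · intro i
      fin_cases i <;> simpa
    · intro z hz
      have : z = x ∨ z = y₁ ∨ z = y₂ ∨ z = y₃ := by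
        refine mem_of_reachable (S := {z | z = x ∨ z = y₁ ∨ z = y₂ ∨ z = y₃}) (by simp) ?_ hz
        rintro u (rfl | rfl | rfl | rfl) v huv
        · exact Or.inr ((hN' v).1 huv)
        · exact Or.inl ((d_eq_one d1 h1.symm).1 huv)
        · exact Or.inl ((d_eq_one d2 h2.symm).1 huv)
        · exact Or.inl ((d_eq_one d3 h3.symm).1 huv)
      rcases this with h | h | h | h
      · exact Or.inl h
      · exact Or.inr ⟨0, h⟩
      · exact Or.inr ⟨1, h⟩
      · exact Or.inr ⟨2, h⟩

/-- Every component has at most four vertices. -/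
lemma Opt.exists_comp (hO : π.Opt) (x₀ : V) :
    ∃ T : Finset V, #T ≤ 4 ∧ ∀ v, π.U.Reachable x₀ v → v ∈ T := by
  by_cases h₀ : π.d x₀ = 0
  · refine ⟨{x₀}, by simp, fun v hv => mem_singleton.2 (by_contra fun hne => ?_)⟩
    exact not_reachable_of_d_eq_zero h₀ (Ne.symm hne) hv.symm
  have h4 : ∀ a b c d : V, #{a, b, c, d} ≤ 4 := fun a b c d => card_le_four
  rcases hO.shape hG h₀ with ⟨x, y, hr, -, -, -, hC⟩ | ⟨x, y, w, hr, -, -, -, -, -, -, hC⟩ |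
    ⟨w, u, v, t, hr, -, -, -, -, -, -, -, -, hC⟩ | ⟨x, y, hr, -, -, -, -, hC⟩ |
    ⟨y, hr, -, -, hC⟩
  · refine ⟨{x, y, y, y}, h4 _ _ _ _, fun v hv => ?_⟩
    have := hC v (hr.symm.trans hv)
    simpa using this
  · refine ⟨{x, y, w, w}, h4 _ _ _ _, fun v hv => ?_⟩
    have := hC v (hr.symm.trans hv)
    simpa using this
  · refine ⟨{w, u, v, t}, h4 _ _ _ _, fun v hv => ?_⟩
    have := hC v (hr.symm.trans hv)
    simpa using this
  · refine ⟨{x, y 0, y 1, y 2}, h4 _ _ _ _, fun v hv => ?_⟩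
    have := hC v (hr.symm.trans hv)
    simpa [Fin.exists_fin_succ] using this
  · refine ⟨{y 0, y 1, y 2, y 2}, h4 _ _ _ _, fun v hv => ?_⟩
    have := hC v (hr.symm.trans hv)
    simpa [Fin.exists_fin_succ] using this

end PCol
end PartialColoring

namespace PartialColoring
open Finset Classical

/-- Two distinct points can be moved to two distinct points, moving nothing else. -/
lemma exists_perm_pair {α : Type*} {a b a' b' : α} (h : a ≠ b) (h' : a' ≠ b') :
    ∃ σ : Equiv.Perm α, σ a = a' ∧ σ b = b' ∧
      ∀ v, v ≠ a → v ≠ b → v ≠ a' → v ≠ b' → σ v = v := by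
  refine ⟨Equiv.swap (Equiv.swap a a' b) b' * Equiv.swap a a', ?_, ?_, ?_⟩
  · rw [Equiv.Perm.mul_apply, Equiv.swap_apply_left, Equiv.swap_apply_of_ne_of_ne _ h']
    intro h1
    rw [eq_comm, Equiv.swap_apply_eq_iff, Equiv.swap_apply_right] at h1
    exact h h1.symm
  · rw [Equiv.Perm.mul_apply, Equiv.swap_apply_left]
  · intro v h1 h2 h3 h4
    rw [Equiv.Perm.mul_apply, Equiv.swap_apply_of_ne_of_ne h1 h3,
      Equiv.swap_apply_of_ne_of_ne _ h4]
    intro h5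
    rw [eq_comm, Equiv.swap_apply_eq_iff, Equiv.swap_apply_of_ne_of_ne h1 h3] at h5
    exact h2 h5.symm

variable {V : Type*} [Fintype V] {G : SimpleGraph V}

namespace PCol
variable {π π' π₀ : PCol G} {t u v w x p q r x₀ x' w₁ w₂ q₁ q₂ t₁ t₂ y : V}
  {a b c e g k c₁ c₂ : Fin 7} {W : Finset V}

/-- The colors other than `k` stay inside the clique `W`, and the color `k` leaves it
everywhere. -/
structure IsSealed (π : PCol G) (W : Finset V) (k : Fin 7) : Prop where
  edge : ∃ u ∈ W, ∃ v ∈ W, π.U.Adj u v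
  closed : ∀ w ∈ W, ∀ c ≠ k, π.mate c w ∈ W
  complete : ∀ w ∈ W, ∀ w' ∈ W, w ≠ w' → G.Adj w w'
  out : ∀ w ∈ W, π.mate k w ∉ W
  sep : ∀ w ∈ W, ∀ v, π.U.Adj w v → v ∈ W

namespace IsSealed

lemma congr (h : π.IsSealed W k) (hag : ∀ w ∈ W, ∀ a, π'.mate a w = π.mate a w) :
    π'.IsSealed W k := by
  have hU : ∀ w ∈ W, ∀ v, π'.U.Adj w v ↔ π.U.Adj w v := fun w hw v => by
    simp only [U_adj, hag w hw]
  refine ⟨?_, ?_, h.complete, ?_, ?_⟩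
  · obtain ⟨u, hu, v, hv, huv⟩ := h.edge
    exact ⟨u, hu, v, hv, (hU u hu v).2 huv⟩
  · intro w hw c hc
    rw [hag w hw]; exact h.closed w hw c hc
  · intro w hw
    rw [hag w hw]; exact h.out w hw
  · intro w hw v hv
    exact h.sep w hw v ((hU w hw v).1 hv)

variable (hG : ∀ v, (G.neighborSet v).ncard ≤ 7)
include hG

/-- The coloring inside a sealed clique can be permuted so that any two vertices are joined by an
uncolored edge and miss any two prescribed colors. -/
lemma transport (h : π.IsSealed W k) (hO : π.Opt) (h₁ : w₁ ∈ W) (h₂ : w₂ ∈ W) (hw : w₁ ≠ w₂)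
    (hek : e ≠ k) (hgk : g ≠ k) (heg : e ≠ g) :
    ∃ π' : PCol G, π'.Opt ∧ π'.U.Adj w₁ w₂ ∧ π'.mate e w₁ = w₁ ∧ π'.mate g w₂ = w₂ ∧
      (∀ v ∉ W, ∀ c, π'.mate c v = π.mate c v) ∧ ∀ v, π'.mate k v = π.mate k v := by
  obtain ⟨u, hu, v, hv, huv⟩ := h.edge
  obtain ⟨e', he'⟩ := exists_miss hG huv
  obtain ⟨g', hg'⟩ := exists_miss hG huv.symm
  have hek' : e' ≠ k := by rintro rfl; exact h.out u hu (by rwa [he'])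
  have hgk' : g' ≠ k := by rintro rfl; exact h.out v hv (by rwa [hg'])
  have heg' : e' ≠ g' := by rintro rfl; exact hO.no_common_adj huv he' hg'
  obtain ⟨σ, hσ₁, hσ₂, hσ⟩ := exists_perm_pair hw huv.ne
  obtain ⟨τ, hτe, hτg, hτ⟩ := exists_perm_pair heg heg'
  have hτk : τ k = k := hτ k hek.symm hgk.symm hek'.symm hgk'.symm
  have hτk' : ∀ {c}, c ≠ k → τ c ≠ k := fun {c} hc h' => hc (τ.injective (h'.trans hτk.symm))
  have hout : ∀ v ∉ W, σ v = v := fun v' hv' => hσ v' (by rintro rfl; exact hv' h₁)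
    (by rintro rfl; exact hv' h₂) (by rintro rfl; exact hv' hu) (by rintro rfl; exact hv' hv)
  have hin : ∀ {v}, σ v ∈ W ↔ v ∈ W := by
    intro v'
    constructor
    · intro h'
      by_contra h''
      rw [hout v' h''] at h'
      exact h'' h'
    · intro h'
      by_contra h''
      exact h'' (by rwa [σ.injective (hout _ h'')])
  have hin' : ∀ {v}, σ.symm v ∈ W ↔ v ∈ W := fun {v} => by rw [← hin, Equiv.apply_symm_apply]
  have hcl : ∀ {v c}, v ∈ W → c ≠ k → π.mate (τ c) (σ v) ∈ W := fun {v c} hv hc =>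
    h.closed _ (hin.2 hv) _ (hτk' hc)
  let f : Fin 7 → V → V := fun c v =>
    if v ∈ W ∧ c ≠ k then σ.symm (π.mate (τ c) (σ v)) else π.mate c v
  have f1 : ∀ {c v}, v ∈ W → c ≠ k → f c v = σ.symm (π.mate (τ c) (σ v)) := fun hv hc => by
    simp only [f]; rw [if_pos ⟨hv, hc⟩]
  have f2 : ∀ {c v}, v ∉ W → f c v = π.mate c v := fun hv => by
    simp only [f]; rw [if_neg fun h' => hv h'.1]
  have f3 : ∀ v, f k v = π.mate k v := fun v => by
    simp only [f]; rw [if_neg fun h' => h'.2 rfl]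
  have f4 : ∀ {c v}, v ∉ W → c ≠ k → π.mate c v ∉ W := fun hv hc h' => hv (by
    have := h.closed _ h' _ hc
    rwa [π.invol] at this)
  let π' : PCol G :=
    { mate := f
      invol := by
        intro c v
        by_cases hc : c = k
        · subst hc; rw [f3, f3, π.invol]
        · by_cases hv : v ∈ W
          · rw [f1 hv hc, f1 (hin'.2 (hcl hv hc)) hc, Equiv.apply_symm_apply, π.invol,
              Equiv.symm_apply_apply]
          · rw [f2 hv, f2 (f4 hv hc), π.invol]
      adj := by
        intro c v hne
        by_cases hc : c = k
        · subst hc; rw [f3] at hne ⊢; exact π.adj _ _ hne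
        · by_cases hv : v ∈ W
          · rw [f1 hv hc] at hne ⊢
            exact h.complete _ hv _ (hin'.2 (hcl hv hc)) hne.symm
          · rw [f2 hv] at hne ⊢; exact π.adj _ _ hne
      inj := by
        intro a b v hab hne
        by_cases hv : v ∈ W
        · by_cases ha : a = k <;> by_cases hb : b = k
          · rw [ha, hb]
          · rw [ha, f3, f1 hv hb] at hab
            exact absurd (hab ▸ hin'.2 (hcl hv hb)) (h.out v hv)
          · rw [hb, f3, f1 hv ha] at hab
            exact absurd (hab ▸ hin'.2 (hcl hv ha)) (h.out v hv)
          · rw [f1 hv ha] at hab hne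
            rw [f1 hv hb] at hab
            refine τ.injective (π.inj _ _ (σ v) (σ.symm.injective hab) fun h' => hne ?_)
            rw [h', Equiv.symm_apply_apply]
        · rw [f2 hv] at hab hne
          rw [f2 hv] at hab
          exact π.inj _ _ _ hab hne }
  have hm : ∀ v, #(π'.miss v) = #(π.miss (σ v)) := by
    intro v
    by_cases hv : v ∈ W
    · refine card_equiv τ fun c => ?_
      rw [mem_miss, mem_miss]
      change f c v = v ↔ _
      by_cases hc : c = k
      · rw [hc, hτk, f3]
        exact iff_of_false (fun h' => h.out v hv (by rwa [h']))
          (fun h' => h.out _ (hin.2 hv) (by rw [h']; exact hin.2 hv))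
      · rw [f1 hv hc, Equiv.symm_apply_eq]
    · rw [hout v hv]
      congr 1
      ext c
      rw [mem_miss, mem_miss]
      change f c v = v ↔ _
      rw [f2 hv]
  refine ⟨π', fun π'' => ?_, ⟨h.complete _ h₁ _ h₂ hw, fun c => ?_⟩, ?_, ?_,
    fun v hv c => f2 hv, f3⟩
  · have : π'.defect = π.defect := by
      simp only [defect, hm]
      exact Equiv.sum_comp σ fun v => #(π.miss v)
    rw [this]; exact hO π''
  · change f c w₁ ≠ w₂
    by_cases hc : c = k
    · rw [hc, f3]; intro h'; exact h.out _ h₁ (h' ▸ h₂)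
    · rw [f1 h₁ hc, hσ₁, ne_eq, Equiv.symm_apply_eq, hσ₂]
      exact huv.2 _
  · change f e w₁ = w₁
    rw [f1 h₁ hek, hσ₁, hτe, he', Equiv.symm_apply_eq, hσ₁]
  · change f g w₂ = w₂
    rw [f1 h₂ hgk, hσ₂, hτg, hg', Equiv.symm_apply_eq, hσ₂]

/-- If `e` is missing at the outer neighbor `q₁`, an uncolored edge can be moved out of a sealed
clique to the edge `w₂ q₂` of color `k`, with `k` missing at `q₁` and `q₂` and any other color `g`
missing at `w₂`. -/
lemma exists_out (h : π.IsSealed W k) (hO : π.Opt) (h₁ : w₁ ∈ W) (h₂ : w₂ ∈ W) (hw : w₁ ≠ w₂)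
    (hq₁ : π.mate k w₁ = q₁) (hq₂ : π.mate k w₂ = q₂) (he : π.mate e q₁ = q₁)
    (hgk : g ≠ k) (heg : e ≠ g) :
    ∃ π' : PCol G, π'.Opt ∧ π'.U.Adj w₂ q₂ ∧ π'.mate g w₂ = w₂ ∧ π'.mate k q₁ = q₁ ∧
      π'.mate k q₂ = q₂ ∧ (∀ v ∉ W, v ≠ q₁ → v ≠ q₂ → ∀ c, π'.mate c v = π.mate c v) ∧
      (∀ c ≠ k, π'.mate c q₂ = π.mate c q₂) ∧
      ∀ u ∉ W, ∀ v, π.U.Adj u v → π'.U.Adj u v := by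
  have hq₁W : q₁ ∉ W := hq₁ ▸ h.out _ h₁
  have hq₂W : q₂ ∉ W := hq₂ ▸ h.out _ h₂
  have hqq : q₁ ≠ q₂ := by rintro rfl; exact hw (mate_inj.1 (hq₁.trans hq₂.symm))
  have h12 : w₁ ≠ q₂ := by rintro rfl; exact hq₂W h₁
  have h21 : w₂ ≠ q₁ := by rintro rfl; exact hq₁W h₂
  have h11 : w₁ ≠ q₁ := by rintro rfl; exact hq₁W h₁
  have h22 : w₂ ≠ q₂ := by rintro rfl; exact hq₂W h₂
  have hek : e ≠ k := by
    rintro rfl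
    rw [mate_eq_comm, he] at hq₁
    exact h11 hq₁.symm
  obtain ⟨π₁, hO₁, hU₁, he₁, hg₁, hoff₁, hk₁⟩ := h.transport hG hO h₁ h₂ hw hek hgk heg
  obtain ⟨π₂, s₂⟩ := exists_kempe π₁ {w₁, q₁} e k (by
    rintro v (rfl | rfl)
    · rw [he₁, hk₁, hq₁]; simp
    · rw [hoff₁ _ hq₁W, he, hk₁, mate_eq_comm.1 hq₁]; simp)
  have hn : ∀ {v}, v ≠ w₁ → v ≠ q₁ → v ∉ ({w₁, q₁} : Set V) := fun {v} h1 h2 => by simp [h1, h2]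
  have hkw₁ : π₂.mate k w₁ = w₁ := by
    rw [s₂.on _ (by simp), Equiv.swap_apply_right, he₁]
  have hkq₁ : π₂.mate k q₁ = q₁ := by
    rw [s₂.on _ (by simp), Equiv.swap_apply_right, hoff₁ _ hq₁W, he]
  have hkw₂ : π₂.mate k w₂ = q₂ := by
    rw [s₂.off _ (hn hw.symm h21), hk₁, hq₂]
  obtain ⟨π₃, s₃⟩ := exists_shift (by rw [s₂.U_eq]; exact hU₁) hkw₁ hkw₂ h22.symm
  refine ⟨π₃, s₃.opt (s₂.opt hO₁), s₃.U_yz, ?_, ?_, s₃.mate_z, ?_, ?_, ?_⟩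
  · rw [s₃.mate_of_color_ne _ hgk, s₂.off _ (hn hw.symm h21), hg₁]
  · rw [s₃.mate_of_ne _ h11.symm h21.symm hqq, hkq₁]
  · intro v hv hv1 hv2 c
    have hvw₁ : v ≠ w₁ := by rintro rfl; exact hv h₁
    have hvw₂ : v ≠ w₂ := by rintro rfl; exact hv h₂
    rw [s₃.mate_eq hvw₁ hvw₂ hv2, s₂.off _ (hn hvw₁ hv1), hoff₁ _ hv]
  · intro c hc
    rw [s₃.mate_of_color_ne _ hc, s₂.off _ (hn h12.symm hqq.symm), hoff₁ _ hq₂W]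
  · intro u hu v huv
    refine s₃.U_mono ?_ ?_
    · rw [s₂.U_eq]
      exact ⟨huv.1, fun a => by rw [hoff₁ _ hu]; exact huv.2 a⟩
    · rw [ne_eq, Sym2.eq_iff]
      rintro (⟨rfl, -⟩ | ⟨rfl, -⟩)
      · exact hu h₁
      · exact hu h₂

/-- Two outer neighbors of a sealed clique are not both incident with uncolored edges. -/
lemma not_adj_adj (h : π.IsSealed W k) (hO : π.Opt) (h₁ : w₁ ∈ W) (h₂ : w₂ ∈ W) (hw : w₁ ≠ w₂)
    (hq₁ : π.mate k w₁ = q₁) (hq₂ : π.mate k w₂ = q₂) (ht₁ : π.U.Adj q₁ t₁)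
    (ht₂ : π.U.Adj q₂ t₂) : False := by
  have hq₁W : q₁ ∉ W := hq₁ ▸ h.out _ h₁
  have hq₂W : q₂ ∉ W := hq₂ ▸ h.out _ h₂
  have hne : ∀ {w q c}, w ∈ W → π.mate k w = q → q ∉ W → π.mate c q = q → c ≠ k := by
    rintro w q c hw' hq hq' hc rfl
    rw [mate_eq_comm, hc] at hq
    exact hq' (hq ▸ hw')
  have htW : t₂ ∉ W := fun h' => hq₂W (h.sep _ h' _ ht₂.symm)
  obtain ⟨e, he⟩ := exists_miss hG ht₁
  have hek := hne h₁ hq₁ hq₁W he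
  by_cases hg : ∃ g, g ≠ e ∧ π.mate g q₂ = q₂
  · obtain ⟨g, hge, hg⟩ := hg
    have hgk := hne h₂ hq₂ hq₂W hg
    obtain ⟨π', hO', hU', hg', -, -, -, hc, -⟩ :=
      h.exists_out hG hO h₁ h₂ hw hq₁ hq₂ he hgk hge.symm
    exact hO'.no_common_adj hU' hg' (by rw [hc _ hgk, hg])
  have he₂ : π.mate e q₂ = q₂ := by
    obtain ⟨g, hg'⟩ := exists_miss hG ht₂
    by_cases hge : g = e
    · rwa [← hge]
    · exact absurd ⟨g, hge, hg'⟩ hg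
  have ht₂₁ : t₂ ≠ q₁ := by
    rintro rfl
    exact hO.no_common_adj ht₂ he₂ he
  obtain ⟨g, hgt⟩ := exists_miss hG ht₂.symm
  have hge : e ≠ g := by
    rintro rfl
    exact hO.no_common_adj ht₂ he₂ hgt
  by_cases hgk : g = k
  · subst hgk
    obtain ⟨g', hg1, hg2⟩ : ∃ g' : Fin 7, g' ≠ g ∧ e ≠ g' := by
      clear * -
      revert e g; decide
    obtain ⟨π', hO', -, -, -, hk₂, hoff, -, hU⟩ :=
      h.exists_out hG hO h₁ h₂ hw hq₁ hq₂ he hg1 hg2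
    exact hO'.no_common_adj (hU _ hq₂W _ ht₂) hk₂ (by rw [hoff _ htW ht₂₁ ht₂.ne', hgt])
  · obtain ⟨π', hO', hU', hg', -, -, hoff, -, hU⟩ :=
      h.exists_out hG hO h₁ h₂ hw hq₁ hq₂ he hgk hge
    refine hO'.no_common hG (hU'.reachable.trans (hU _ hq₂W _ ht₂).reachable) ?_ hg'
      (by rw [hoff _ htW ht₂₁ ht₂.ne', hgt])
    rintro rfl
    exact htW h₂

/-- Two outer neighbors of a sealed clique are not both attached to the same end of an uncolored
edge. -/
lemma not_attach_attach (h : π.IsSealed W k) (hO : π.Opt) (h₁ : w₁ ∈ W) (h₂ : w₂ ∈ W)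
    (hw : w₁ ≠ w₂) (hq₁ : π.mate k w₁ = q₁) (hq₂ : π.mate k w₂ = q₂) (hU : π.U.Adj x y)
    (hx : π.mate c₁ x = x) (hc₁ : π.mate c₁ y = q₁) (hc₂ : π.mate c₂ y = q₂) (hqy : q₂ ≠ y)
    (hxW : x ∉ W) (hyW : y ∉ W) : False := by
  have hq₁W : q₁ ∉ W := hq₁ ▸ h.out _ h₁
  have hq₂W : q₂ ∉ W := hq₂ ▸ h.out _ h₂
  have hqq : q₁ ≠ q₂ := by rintro rfl; exact hw (mate_inj.1 (hq₁.trans hq₂.symm))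
  have hcc : c₁ ≠ c₂ := by rintro rfl; exact hqq (hc₁.symm.trans hc₂)
  have hc₂k : c₂ ≠ k := by
    rintro rfl
    rw [← hq₂, mate_inj] at hc₂
    exact hyW (hc₂ ▸ h₂)
  have hqy₁ : q₁ ≠ y := by rintro rfl; exact hO.no_common_adj hU hx hc₁
  have hW : ∀ w ∈ W, w ≠ x ∧ w ≠ y ∧ w ≠ q₁ := fun w hw' =>
    ⟨by rintro rfl; exact hxW hw', by rintro rfl; exact hyW hw', by rintro rfl; exact hq₁W hw'⟩
  obtain ⟨π₁, s₁⟩ := exists_shift hU hx hc₁ hqy₁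
  have hag : ∀ w ∈ W, ∀ a, π₁.mate a w = π.mate a w := fun w hw' =>
    s₁.mate_eq (hW w hw').1 (hW w hw').2.1 (hW w hw').2.2
  obtain ⟨π₂, hO₂, hU₂, hg₂, hk₁, hk₂, hoff, -, hmono⟩ := (h.congr hag).exists_out hG
    (s₁.opt hO) h₁ h₂ hw (by rw [hag _ h₁, hq₁]) (by rw [hag _ h₂, hq₂]) s₁.mate_z hc₂k hcc
  have hy₂ : π₂.mate c₂ y = q₂ := by
    rw [hoff _ hyW hqy₁.symm hqy.symm, s₁.mate_of_color_ne _ hcc.symm, hc₂]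
  obtain ⟨π₃, s₃⟩ := exists_shift hU₂ hg₂ (mate_eq_comm.1 hy₂) hqy.symm
  have hyq : π₃.U.Adj y q₁ := s₃.U_mono (hmono _ hyW _ s₁.U_yz) (by
    rw [ne_eq, Sym2.eq_iff]
    rintro (⟨rfl, -⟩ | ⟨-, rfl⟩)
    · exact hyW h₂
    · exact hq₁W h₂)
  exact (s₃.opt hO₂).no_common hG (hyq.symm.reachable.trans s₃.U_yz.symm.reachable) hqq
    (by rw [s₃.mate_of_color_ne _ hc₂k.symm, hk₁]) (by rw [s₃.mate_of_color_ne _ hc₂k.symm, hk₂])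

end IsSealed

/-- Every vertex of a region can be made incident with an uncolored edge by changes inside the
region. -/
lemma FOpt.exists_active (hG : ∀ v, (G.neighborSet v).ncard ≤ 7) (hF : π.FOpt) (hO : π₀.Opt)
    (hag : ∀ v ∈ π.R x', ∀ a, π₀.mate a v = π.mate a v) (hq : q ∈ π.R x') :
    ∃ π' : PCol G, π'.Opt ∧ (∃ t, π'.U.Adj q t) ∧
      ∀ v ∉ π.R x', ∀ a, π'.mate a v = π₀.mate a v := by
  have hU : ∀ {u v}, u ∈ π.R x' → π.U.Adj u v → π₀.U.Adj u v := fun hu huv =>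
    ⟨huv.1, fun a => by rw [hag _ hu]; exact huv.2 a⟩
  have hq' := hq
  rcases hq' with ⟨hr, hd⟩ | ⟨u, v, c, hr, huv, hu, hv, hzv, -⟩
  · obtain ⟨t, ht⟩ := d_pos.1 (Nat.pos_of_ne_zero hd)
    exact ⟨π₀, hO, ⟨t, hU hq ht⟩, fun _ _ _ => rfl⟩
  · have huR : u ∈ π.R x' := mem_R_of_reachable hr huv
    have hvR : v ∈ π.R x' := hF.mem_R_of_adj hG huR huv
    obtain ⟨π', s⟩ := exists_shift (hU huR huv) (by rw [hag _ huR, hu]) (by rw [hag _ hvR, hv]) hzv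
    refine ⟨π', s.opt hO, ⟨v, s.U_yz.symm⟩, fun w hw a => s.mate_eq ?_ ?_ ?_ a⟩
    · rintro rfl; exact hw huR
    · rintro rfl; exact hw hvR
    · rintro rfl; exact hw hq

/-- Some outer neighbor of a region which is a sealed clique on seven vertices belongs to no
region. -/
lemma FOpt.exists_unowned (hG : ∀ v, (G.neighborSet v).ncard ≤ 7) (hF : π.FOpt)
    (h : π.IsSealed W k) (hW : ∀ v, v ∈ W ↔ v ∈ π.R x₀) (hcard : 7 ≤ #W) :
    ∃ w ∈ W, ∀ x', π.mate k w ∉ π.R x' := by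
  by_contra! hcon
  have hown : ∀ {w x'}, w ∈ W → π.mate k w ∈ π.R x' → ¬ π.U.Reachable x₀ x' := by
    intro w x' hw hx' hr
    rw [← R_congr hr, ← hW] at hx'
    exact h.out w hw hx'
  obtain ⟨w₀, hw₀⟩ : W.Nonempty := card_pos.1 (by omega)
  obtain ⟨x', hx'⟩ := hcon w₀ hw₀
  have hdis : ∀ {x'}, ¬ π.U.Reachable x₀ x' → ∀ v ∈ π.R x', v ∉ W := fun hr v hv hvW =>
    Set.disjoint_left.1 (hF.disjoint_R hG hr) ((hW v).1 hvW) hv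
  have hsame : ∀ w ∈ W, π.mate k w ∈ π.R x' := by
    intro w hw
    obtain ⟨x'', hx''⟩ := hcon w hw
    by_cases hr : π.U.Reachable x'' x'
    · rwa [← R_congr hr]
    exfalso
    have hD : ∀ v ∈ π.R x'', v ∉ π.R x' := fun v hv =>
      Set.disjoint_left.1 (hF.disjoint_R hG hr) hv
    obtain ⟨π₁, hO₁, ⟨t₁, ht₁⟩, hag₁⟩ := hF.exists_active hG hF.1 (fun _ _ _ => rfl) hx'
    obtain ⟨π₂, hO₂, ⟨t₂, ht₂⟩, hag₂⟩ :=
      hF.exists_active hG hO₁ (fun v hv => hag₁ v (hD v hv)) hx''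
    have hag : ∀ v ∈ W, ∀ a, π₂.mate a v = π.mate a v := fun v hv a => by
      rw [hag₂ v fun h' => hdis (hown hw hx'') v h' hv,
        hag₁ v fun h' => hdis (hown hw₀ hx') v h' hv]
    have hne : w₀ ≠ w := by
      rintro rfl
      exact hD _ hx'' hx'
    refine (h.congr hag).not_adj_adj hG hO₂ hw₀ hw hne (by rw [hag _ hw₀]) (by rw [hag _ hw])
      (t₁ := t₁) ⟨ht₁.1, fun a => ?_⟩ ht₂
    rw [hag₂ _ fun h' => hD _ h' hx']
    exact ht₁.2 a
  have hnr := hown hw₀ hx'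
  have h6 : 6 ≤ #{w ∈ W | π.d (π.mate k w) = 0} := by
    have h1 := card_filter_add_card_filter_not (s := W) (fun w => π.d (π.mate k w) = 0)
    have h2 : #{w ∈ W | ¬ π.d (π.mate k w) = 0} ≤ 1 := by
      refine card_le_one.2 fun w₁ h₁ w₂ h₂ => ?_
      rw [mem_filter] at h₁ h₂
      by_contra hw
      obtain ⟨t₁, ht₁⟩ := d_pos.1 (Nat.pos_of_ne_zero h₁.2)
      obtain ⟨t₂, ht₂⟩ := d_pos.1 (Nat.pos_of_ne_zero h₂.2)
      exact h.not_adj_adj hG hF.1 h₁.1 h₂.1 hw rfl rfl ht₁ ht₂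
    omega
  obtain ⟨T, hT4, hT⟩ := hF.1.exists_comp hG x'
  have hatt : ∀ w ∈ ({w ∈ W | π.d (π.mate k w) = 0} : Finset V), ∃ v ∈ T, ∃ u c,
      π.U.Adj u v ∧ u ∉ W ∧ v ∉ W ∧ π.mate c u = u ∧ π.mate c v = π.mate k w ∧
      π.mate k w ≠ v := by
    intro w hw
    rw [mem_filter] at hw
    rcases hsame w hw.1 with ⟨-, hd⟩ | ⟨u, v, c, hr, huv, hu, hv, hzv, -⟩
    · exact absurd hw.2 hd
    · have huR : u ∈ π.R x' := mem_R_of_reachable hr huv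
      exact ⟨v, hT v (hr.trans huv.reachable), u, c, huv, hdis hnr u huR,
        hdis hnr v (hF.mem_R_of_adj hG huR huv), hu, hv, hzv⟩
  choose! f hfT hf using hatt
  obtain ⟨w₁, h₁, w₂, h₂, hw, hfw⟩ := exists_ne_map_eq_of_card_lt_of_maps_to
    (lt_of_le_of_lt hT4 (by omega)) hfT
  obtain ⟨u₁, c₁, huv, hu, hv, hcu, hcv, -⟩ := hf w₁ h₁
  obtain ⟨u₂, c₂, -, -, -, -, hcv₂, hne⟩ := hf w₂ h₂
  rw [← hfw] at hcv₂ hne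
  exact h.not_attach_attach hG hF.1 (mem_filter.1 h₁).1 (mem_filter.1 h₂).1 hw rfl rfl huv hcu hcv
    hcv₂ hne hu hv

end PCol
end PartialColoring

namespace PartialColoring
open Finset Classical

variable {V : Type*} [Fintype V] {G : SimpleGraph V}

namespace PCol
variable {π π' π₀ : PCol G} {v w z : V} {c k : Fin 7} {y : Fin 3 → V} {A : Finset V} {i j l : Fin 3}

lemma bonus_pos_of_unowned (h : ∀ x', π.mate c w ∉ π.R x') : 0 < π.bonus w :=
  card_pos.2 ⟨c, by simpa using h⟩

/-- A triangle of uncolored edges with two colors missing at each vertex, where `A` is the set of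
vertices joined to the triangle by edges of colors missing at the triangle, and `k` is the color
not missing at the triangle. -/
structure IsTri (π : PCol G) (y : Fin 3 → V) (A : Finset V) (k : Fin 7) : Prop where
  best : π.Best
  hU : ∀ i j, i ≠ j → π.U.Adj (y i) (y j)
  comp : ∀ v, π.U.Reachable (y 0) v → ∃ i, v = y i
  big : π.Big (y 0)
  d_y : ∀ i, π.d (y i) = 2
  card_miss : ∀ i, #(π.miss (y i)) = 2
  mem_A : ∀ i z, z ∈ A ↔ ∃ j, j ≠ i ∧ ∃ c ∈ π.miss (y j), π.mate c (y i) = z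
  card_A : #A = 4
  miss_k : ∀ i, π.mate k (y i) ≠ y i
  miss_ne : ∀ c, c ≠ k → ∃ i, π.mate c (y i) = y i

lemma reachable_tri (hU : ∀ i j, i ≠ j → π.U.Adj (y i) (y j)) (i j : Fin 3) :
    π.U.Reachable (y i) (y j) := by
  by_cases h : i = j
  · rw [h]
  · exact (hU i j h).reachable

namespace IsTri
variable (s : IsTri π y A k)
include s

lemma reach (i j : Fin 3) : π.U.Reachable (y i) (y j) := reachable_tri s.hU i j

lemma y_inj (h : i ≠ j) : y i ≠ y j := (s.hU i j h).ne

lemma y_mem_R (i : Fin 3) : y i ∈ π.R (y 0) :=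
  Or.inl ⟨s.reach 0 i, by rw [s.d_y]; omega⟩

lemma y_notMem (i : Fin 3) : y i ∉ A := by
  rw [s.mem_A i]
  rintro ⟨j, hj, c, hc, h⟩
  exact s.best.1.1.no_common_adj (s.hU j i hj) (mem_miss.1 hc) h

lemma ne_y (hz : z ∈ A) (i : Fin 3) : z ≠ y i := by
  rintro rfl
  exact s.y_notMem i hz

lemma not_reach (hz : z ∈ A) (i : Fin 3) : ¬ π.U.Reachable (y i) z := by
  intro h
  obtain ⟨j, hj⟩ := s.comp z ((s.reach 0 i).trans h)
  exact s.ne_y hz j hj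

lemma ne_k (hc : c ∈ π.miss (y i)) : c ≠ k := by
  rintro rfl
  exact s.miss_k i (mem_miss.1 hc)

lemma mate_mem (hc : c ≠ k) (h : π.mate c (y i) ≠ y i) : π.mate c (y i) ∈ A := by
  obtain ⟨j, hj⟩ := s.miss_ne c hc
  refine (s.mem_A i _).2 ⟨j, ?_, c, mem_miss.2 hj, rfl⟩
  rintro rfl
  exact h hj

lemma mate_k_notMem (i : Fin 3) : π.mate k (y i) ∉ A ∧ ∀ j, π.mate k (y i) ≠ y j := by
  constructor
  · rw [s.mem_A i]
    rintro ⟨j, -, c, hc, h⟩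
    refine s.ne_k hc (π.inj _ _ _ h ?_)
    rw [h]
    exact s.miss_k i
  · intro j hj
    by_cases h : i = j
    · rw [h] at hj; exact s.miss_k j hj
    · exact (s.hU i j h).2 k hj

variable (hG : ∀ v, (G.neighborSet v).ncard ≤ 7)
include hG

lemma A_subset_R (hz : z ∈ A) : z ∈ π.R (y 0) := by
  obtain ⟨j, hj, c, hc, h⟩ := (s.mem_A 0 z).1 hz
  exact s.best.1.1.mem_R_of_attach hG (s.reach 0 j) (s.hU j 0 hj) hc h s.big

lemma mem_R_iff (v : V) : v ∈ univ.image y ∪ A ↔ v ∈ π.R (y 0) := by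
  simp only [mem_union, mem_image, mem_univ, true_and]
  constructor
  · rintro (⟨i, rfl⟩ | h)
    · exact s.y_mem_R i
    · exact s.A_subset_R hG h
  · rintro (⟨h, -⟩ | ⟨u, w, c, hr, hU, hu, hw, hne, -⟩)
    · obtain ⟨i, rfl⟩ := s.comp v h
      exact Or.inl ⟨i, rfl⟩
    · obtain ⟨i, rfl⟩ := s.comp u hr
      obtain ⟨j, rfl⟩ := s.comp w (hr.trans hU.reachable)
      refine Or.inr ((s.mem_A j v).2 ⟨i, ?_, c, mem_miss.2 hu, hw⟩)
      rintro rfl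
      exact hU.ne rfl

lemma mate_ne_self (hz : z ∈ A) (hc : c ≠ k) : π.mate c z ≠ z := by
  obtain ⟨i, hi⟩ := s.miss_ne c hc
  obtain ⟨j, hj, e, he, h⟩ := (s.mem_A i z).1 hz
  exact s.best.1.1.not_miss_of_attach hG (s.hU j i hj) (mem_miss.1 he) h (s.ne_y hz i)
    (s.not_reach hz j) (s.reach j i) hi (Or.inl rfl)

/-- An uncolored edge of the triangle can be moved out to an attached vertex. -/
lemma attach (hz : z ∈ A) (i : Fin 3) :
    ∃ j l e π', j ≠ i ∧ l ≠ i ∧ j ≠ l ∧ e ∈ π.miss (y j) ∧ IsShift π π' (y j) (y i) z e ∧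
      π'.U.Adj (y i) (y l) ∧ π'.U.Adj (y l) (y j) ∧ π'.Big z := by
  obtain ⟨j, hj, e, he, h⟩ := (s.mem_A i z).1 hz
  obtain ⟨π', s'⟩ := exists_shift (s.hU j i hj) (mem_miss.1 he) h (s.ne_y hz i)
  obtain ⟨l, hl, hlj⟩ : ∃ l : Fin 3, l ≠ i ∧ j ≠ l := by
    clear * -
    revert i j; decide
  have h1 : π'.U.Adj (y i) (y l) := s'.U_mono (s.hU i l hl.symm) (by
    rw [ne_eq, Sym2.eq_iff]
    rintro (⟨h', -⟩ | ⟨-, h'⟩)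
    · exact s.y_inj hj h'.symm
    · exact s.y_inj hlj h'.symm)
  have h2 : π'.U.Adj (y l) (y j) := s'.U_mono (s.hU l j hlj.symm) (by
    rw [ne_eq, Sym2.eq_iff]
    rintro (⟨h', -⟩ | ⟨h', -⟩)
    · exact s.y_inj hlj h'.symm
    · exact s.y_inj hl h')
  have hr1 : π'.U.Reachable z (y i) := s'.U_yz.symm.reachable
  have hr2 := hr1.trans h1.reachable
  have hr3 := hr2.trans h2.reachable
  refine ⟨j, l, e, π', hj, hl, hlj, he, s', h1, h2,
    (s'.opt s.best.1.1).big hG (T := {z, y i, y l, y j}) ?_ ?_⟩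
  · simp only [mem_insert, mem_singleton]
    rintro v (rfl | rfl | rfl | rfl)
    exacts [.rfl, hr1, hr2, hr3]
  · rw [sum_insert (by simp [s.ne_y hz]), sum_insert (by simp [s.y_inj hl.symm, s.y_inj hj.symm]),
      sum_pair (s.y_inj hlj.symm)]
    have e1 := d_le_miss hG π' z
    have e2 := d_le_miss hG π' (y i)
    have e3 := d_le_miss hG π' (y l)
    have e4 := d_le_miss hG π' (y j)
    have e5 := s'.d_x
    have e6 := s'.d_y
    have e7 := s'.d_z
    have e8 := s'.d_eq (s.y_inj hlj.symm) (s.ne_y hz l).symm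
    rw [s.d_y] at e5 e6 e8
    omega

lemma agree (hz : z ∈ A) (s' : IsShift π π' (y j) (y i) z c) :
    ∀ v ∉ π.R (y 0), ∀ a, π'.mate a v = π.mate a v := fun v hv => by
  refine s'.mate_eq ?_ ?_ ?_
  · rintro rfl; exact hv (s.y_mem_R _)
  · rintro rfl; exact hv (s.y_mem_R _)
  · rintro rfl; exact hv (s.A_subset_R hG hz)

lemma bonus_y_pos (hz : z ∈ A) (hk : π.mate k z = z) (i : Fin 3) : 0 < π.bonus (y i) := by
  obtain ⟨j, l, e, π', hj, hl, hjl, he, s', -, -, hbig⟩ := s.attach hG hz i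
  have hke := (s.ne_k he).symm
  refine bonus_pos_of_unowned (c := k) (s.best.1.unowned hG (s'.opt s.best.1.1) (s.agree hG hz s')
    (s.A_subset_R hG hz) s'.U_yz.symm (c := k) ?_ ?_ ?_ hbig)
  · rw [s'.mate_of_color_ne _ hke, hk]
  · rw [s'.mate_of_color_ne _ hke]
  · rw [← s.mem_R_iff hG]
    simp only [mem_union, mem_image, mem_univ, true_and, not_or, not_exists]
    exact ⟨fun j hj => (s.mate_k_notMem i).2 j hj.symm, (s.mate_k_notMem i).1⟩

lemma card_filter_le : #{z ∈ A | π.mate k z = z} ≤ 2 := by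
  by_contra! hcard
  obtain ⟨z, hz, z₁, h₁, z₂, h₂, h01, h02, h12⟩ := two_lt_card.1 hcard
  rw [mem_filter] at hz h₁ h₂
  obtain ⟨j, l, e, π', hj, hl, hjl, he, s', hil, hlj, -⟩ := s.attach hG hz.1 0
  have hO' := s'.opt s.best.1.1
  have hke := (s.ne_k he).symm
  have hkz : π'.mate k z = z := by rw [s'.mate_of_color_ne _ hke, hz.2]
  have key : ∀ {z'}, z' ∈ A ∧ π.mate k z' = z' → z ≠ z' → π.mate e (y l) = z' := by
    intro z' hz' hne
    obtain ⟨m, hm, e', he', hme⟩ := (s.mem_A l z').1 hz'.1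
    by_cases hee : e' = e
    · rwa [← hee]
    exfalso
    have hkz' : π'.mate k z' = z' := by rw [s'.mate_of_color_ne _ hke, hz'.2]
    have hml : π'.U.Adj (y m) (y l) := by
      have : m = 0 ∨ m = j := by
        clear * - hm hj hl hjl
        revert m l j; decide
      rcases this with rfl | rfl
      · exact hil
      · exact hlj.symm
    have hr : π'.U.Reachable (y m) z :=
      hml.reachable.trans (hil.symm.reachable.trans s'.U_yz.reachable)
    refine hO'.not_miss_of_attach hG hml (c := e') (q := z') ?_ ?_ (s.ne_y hz'.1 l) ?_ hr hkz
      (Or.inl rfl) hkz'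
    · rw [s'.mate_of_color_ne _ hee, mem_miss.1 he']
    · rw [s'.mate_of_color_ne _ hee, hme]
    · intro h'
      exact hO'.no_common hG (hr.symm.trans h') hne hkz hkz'
  exact h12 ((key h₁ h01).symm.trans (key h₂ h02))

lemma bonus_A_pos (hz : z ∈ A) (hc : c ≠ k) (h : π.mate c z ∉ univ.image y ∪ A) :
    0 < π.bonus z := by
  obtain ⟨i, hi⟩ := s.miss_ne c hc
  obtain ⟨j, l, e, π', hj, hl, hjl, he, s', -, -, hbig⟩ := s.attach hG hz i
  have hce : c ≠ e := by
    rintro rfl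
    exact s.best.1.1.no_common_adj (s.hU j i hj) (mem_miss.1 he) hi
  refine bonus_pos_of_unowned (c := c) (s.best.1.unowned hG (s'.opt s.best.1.1) (s.agree hG hz s')
    (s.y_mem_R i) s'.U_yz (c := c) ?_ ?_ ?_ (hbig.of_reachable s'.U_yz.symm.reachable))
  · rw [s'.mate_of_color_ne _ hce, hi]
  · rw [s'.mate_of_color_ne _ hce]
  · rwa [← s.mem_R_iff hG]

omit hG in
lemma disjoint_A : Disjoint (univ.image y) A := by
  rw [Finset.disjoint_left]
  intro v hv
  obtain ⟨i, -, rfl⟩ := mem_image.1 hv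
  exact s.y_notMem i

omit hG in
lemma sum_union {f : V → ℕ} : ∑ w ∈ univ.image y ∪ A, f w = ∑ i, f (y i) + ∑ w ∈ A, f w := by
  rw [Finset.sum_union s.disjoint_A, sum_image]
  intro i _ j _ h
  by_contra h'
  exact s.y_inj h' h

omit hG in
lemma card_union : #(univ.image y ∪ A) = 7 := by
  have h := s.sum_union (f := fun _ => 1)
  simp only [sum_const, smul_eq_mul, mul_one, card_univ, Fintype.card_fin, s.card_A] at h
  omega

lemma isSealed (hk : ∀ z ∈ A, π.mate k z ≠ z)
    (hcl : ∀ z ∈ A, ∀ c, c ≠ k → π.mate c z ∈ univ.image y ∪ A) :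
    π.IsSealed (univ.image y ∪ A) k := by
  have hy : ∀ i, y i ∈ univ.image y ∪ A := fun i => by simp
  have hne : ∀ z ∈ A, ∀ c, π.mate c z ≠ z := fun z hz c => by
    by_cases hc : c = k
    · rw [hc]; exact hk z hz
    · exact s.mate_ne_self hG hz hc
  have hA : ∀ z ∈ A, ∀ w ∈ univ.image y ∪ A, w ≠ z → ∃ c, c ≠ k ∧ π.mate c z = w := by
    intro z hz w hw hwz
    have h1 : (univ.erase k).image (fun c => π.mate c z) = (univ.image y ∪ A).erase z := by
      refine eq_of_subset_of_card_le ?_ ?_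
      · intro v hv
        obtain ⟨c, hc, rfl⟩ := mem_image.1 hv
        exact mem_erase.2 ⟨hne z hz c, hcl z hz c (by simpa using hc)⟩
      · rw [card_image_of_injective _ fun a b hab => π.inj a b z hab (hne z hz a),
          card_erase_of_mem (mem_union_right _ hz), s.card_union]
        simp
    have h2 : w ∈ (univ.image y ∪ A).erase z := mem_erase.2 ⟨hwz, hw⟩
    rw [← h1] at h2
    obtain ⟨c, hc, h⟩ := mem_image.1 h2
    exact ⟨c, by simpa using hc, h⟩
  refine ⟨⟨y 0, hy 0, y 1, hy 1, s.hU 0 1 (by decide)⟩, ?_, ?_, ?_, ?_⟩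
  · intro w hw c hc
    rcases mem_union.1 hw with h | h
    · obtain ⟨i, -, rfl⟩ := mem_image.1 h
      by_cases hci : π.mate c (y i) = y i
      · rwa [hci]
      · exact mem_union_right _ (s.mate_mem hc hci)
    · exact hcl w h c hc
  · have hadj : ∀ z ∈ A, ∀ w ∈ univ.image y ∪ A, w ≠ z → G.Adj z w := by
      intro z hz w hw hwz
      obtain ⟨c, -, rfl⟩ := hA z hz w hw hwz
      exact π.adj _ _ hwz
    intro w hw w' hw' hne'
    rcases mem_union.1 hw with h | h
    · rcases mem_union.1 hw' with h' | h'
      · obtain ⟨i, -, rfl⟩ := mem_image.1 h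
        obtain ⟨j, -, rfl⟩ := mem_image.1 h'
        exact (s.hU i j (by rintro rfl; exact hne' rfl)).1
      · exact (hadj w' h' w hw hne').symm
    · exact hadj w h w' hw' hne'.symm
  · intro w hw hkw
    rcases mem_union.1 hw with h | h
    · obtain ⟨i, -, rfl⟩ := mem_image.1 h
      rcases mem_union.1 hkw with h' | h'
      · obtain ⟨j, -, hj⟩ := mem_image.1 h'
        exact (s.mate_k_notMem i).2 j hj.symm
      · exact (s.mate_k_notMem i).1 h'
    · obtain ⟨c, hc, hcw⟩ := hA w h _ hkw (hk w h)
      exact hc (π.inj _ _ _ hcw (hne w h c))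
  · intro w hw v hv
    rw [s.mem_R_iff hG] at hw ⊢
    exact s.best.1.mem_R_of_adj hG hw hv

lemma charge : 44 ≤ ∑ w ∈ univ.image y ∪ A, π.val w := by
  have hy : ∀ i, π.val (y i) = 5 + π.bonus (y i) := fun i => by
    have h1 := π.col_add_miss (y i)
    rw [s.card_miss] at h1
    simp only [val]
    omega
  have hA : ∀ z ∈ A, 7 + π.bonus z = π.val z + if π.mate k z = z then 1 else 0 := by
    intro z hz
    have h1 := π.col_add_miss z
    have h2 : #(π.miss z) = if π.mate k z = z then 1 else 0 := by
      split_ifs with h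
      · rw [card_eq_one]
        refine ⟨k, ?_⟩
        ext c
        rw [mem_miss, mem_singleton]
        refine ⟨fun hc => ?_, by rintro rfl; exact h⟩
        by_contra hck
        exact s.mate_ne_self hG hz hck hc
      · rw [card_eq_zero, eq_empty_iff_forall_notMem]
        intro c hc
        by_cases hck : c = k
        · exact h (hck ▸ mem_miss.1 hc)
        · exact s.mate_ne_self hG hz hck (mem_miss.1 hc)
    simp only [val]
    omega
  have hsum := sum_congr rfl hA
  rw [sum_add_distrib, sum_add_distrib, sum_const, s.card_A, smul_eq_mul, ← card_filter] at hsum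
  have htot : ∑ w ∈ univ.image y ∪ A, π.val w + #{z ∈ A | π.mate k z = z} =
      43 + ∑ w ∈ univ.image y ∪ A, π.bonus w := by
    rw [s.sum_union, s.sum_union]
    simp only [hy, sum_add_distrib, sum_const, card_univ, Fintype.card_fin, smul_eq_mul]
    omega
  by_cases hk : ∃ z ∈ A, π.mate k z = z
  · obtain ⟨z, hz, hkz⟩ := hk
    have h1 := s.card_filter_le hG
    have h2 := s.sum_union (f := π.bonus)
    rw [Fin.sum_univ_three] at h2
    have := s.bonus_y_pos hG hz hkz 0
    have := s.bonus_y_pos hG hz hkz 1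
    have := s.bonus_y_pos hG hz hkz 2
    omega
  · push Not at hk
    have h0 : #{z ∈ A | π.mate k z = z} = 0 := by
      rw [card_eq_zero, filter_eq_empty_iff]
      exact fun z hz => hk z hz
    obtain ⟨w, hw, hwb⟩ : ∃ w ∈ univ.image y ∪ A, 0 < π.bonus w := by
      by_cases hcl : ∀ z ∈ A, ∀ c, c ≠ k → π.mate c z ∈ univ.image y ∪ A
      · obtain ⟨w, hw, h⟩ := s.best.1.exists_unowned hG (s.isSealed hG hk hcl) (s.mem_R_iff hG)
          s.card_union.ge
        exact ⟨w, hw, bonus_pos_of_unowned h⟩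
      · push Not at hcl
        obtain ⟨z, hz, c, hc, h⟩ := hcl
        exact ⟨z, mem_union_right _ hz, s.bonus_A_pos hG hz hc h⟩
    have := single_le_sum (f := π.bonus) (fun _ _ => Nat.zero_le _) hw
    omega

end IsTri

variable (hG : ∀ v, (G.neighborSet v).ncard ≤ 7)
include hG

lemma Best.charge_triangle (hB : π.Best) (hU : ∀ i j, i ≠ j → π.U.Adj (y i) (y j))
    (hdy : ∀ i, π.d (y i) = 2) (hC : ∀ z, π.U.Reachable (y 0) z → ∃ i, z = y i) :
    ∃ W : Finset V, (∀ w ∈ W, w ∈ π.R (y 0)) ∧ 44 ≤ ∑ w ∈ W, π.val w := by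
  have hO := hB.1.1
  have hreach := reachable_tri hU
  have hinj : Function.Injective y := fun i j h => by
    by_contra h'
    exact (hU i j h').ne h
  have hT : ∀ v ∈ univ.image y, π.U.Reachable (y 0) v := by
    intro v hv
    obtain ⟨i, -, rfl⟩ := mem_image.1 hv
    exact hreach 0 i
  have hTsum : ∀ f : V → ℕ, ∑ v ∈ univ.image y, f v = f (y 0) + f (y 1) + f (y 2) := by
    intro f
    rw [sum_image fun i _ j _ h => hinj h, Fin.sum_univ_three]
  have hm : ∀ i, 2 ≤ #(π.miss (y i)) := fun i => by
    have := d_le_miss hG π (y i)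
    rwa [hdy] at this
  have hbig : π.Big (y 0) := by
    refine hO.big hG hT ?_
    rw [hTsum]
    have := hm 0; have := hm 1; have := hm 2
    omega
  have hdis : ∀ i j, i ≠ j → Disjoint (π.miss (y i)) (π.miss (y j)) := fun i j hij =>
    hO.disjoint_miss hG (hreach i j) fun h => hij (hinj h)
  set C : Fin 3 → Finset (Fin 7) := fun i => (univ.erase i).biUnion fun j => π.miss (y j) with hCdef
  have hCne : ∀ i, ∀ c ∈ C i, π.mate c (y i) ≠ y i := by
    intro i c hc
    obtain ⟨j, hj, hcj⟩ := mem_biUnion.1 hc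
    have hji : j ≠ i := by simpa using hj
    exact hO.mate_ne hG (hreach j i) (fun h => hji (hinj h)) hcj
  have hCcard : ∀ i, #(C i) = ∑ j ∈ univ.erase i, #(π.miss (y j)) := fun i =>
    card_biUnion fun j _ l _ h => hdis j l h
  have hmemN : ∀ i z, z ∈ π.nbrs (y i) (C i) ↔
      ∃ j, j ≠ i ∧ ∃ c ∈ π.miss (y j), π.mate c (y i) = z := by
    intro i z
    simp only [mem_nbrs, hCdef, mem_biUnion, mem_erase, mem_univ, and_true]
    constructor
    · rintro ⟨c, ⟨j, hj, hc⟩, h⟩; exact ⟨j, hj, c, hc, h⟩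
    · rintro ⟨j, hj, c, hc, h⟩; exact ⟨c, ⟨j, hj, hc⟩, h⟩
  set A : Finset V := univ.biUnion fun i => π.nbrs (y i) (C i) with hA
  have hAprop : ∀ z ∈ A, z ∈ π.R (y 0) ∧ ¬ π.U.Reachable (y 0) z ∧ 6 ≤ π.val z := by
    intro z hz
    obtain ⟨i, -, hi⟩ := mem_biUnion.1 hz
    obtain ⟨j, hj, c, hc, h⟩ := (hmemN i z).1 hi
    have hzi : z ≠ y i := by
      rintro rfl
      exact hO.no_common_adj (hU j i hj) (mem_miss.1 hc) h
    have hr : ¬ π.U.Reachable (y 0) z := by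
      intro hr
      obtain ⟨l, rfl⟩ := hC z hr
      exact (hU i l fun h' => hzi (by rw [h'])).2 c h
    exact ⟨hO.mem_R_of_attach hG (hreach 0 j) (hU j i hj) hc h hbig, hr,
      hO.six_le_val_of_attach hG (hU j i hj) (mem_miss.1 hc) h hzi
        (fun h' => hr ((hreach 0 j).trans h')) (hbig.of_reachable (hreach 0 j))⟩
  by_cases h5 : 5 ≤ #A
  · refine hO.charge_of_card hG (T := univ.image y) (N := A) (fun v hv => ⟨hT v hv, ?_⟩) hAprop ?_
    · obtain ⟨i, -, rfl⟩ := mem_image.1 hv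
      rw [hdy]; omega
    · rw [card_image_of_injective _ hinj, card_univ, Fintype.card_fin]
      omega
  have hNsub : ∀ i, π.nbrs (y i) (C i) ⊆ A := fun i =>
    subset_biUnion_of_mem (fun i => π.nbrs (y i) (C i)) (mem_univ i)
  have hle : ∀ i, ∑ j ∈ univ.erase i, #(π.miss (y j)) ≤ #A := fun i => by
    rw [← hCcard, ← card_nbrs (hCne i)]
    exact card_le_card (hNsub i)
  have hle0 := hle 0
  have hle1 := hle 1
  rw [show (univ.erase (0 : Fin 3)) = {1, 2} by decide, sum_pair (by decide)] at hle0
  rw [show (univ.erase (1 : Fin 3)) = {0, 2} by decide, sum_pair (by decide)] at hle1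
  have hm0 := hm 0
  have hm1 := hm 1
  have hm2 := hm 2
  have hmiss : ∀ i, #(π.miss (y i)) = 2 := by
    intro i
    fin_cases i <;> simp <;> omega
  have hA4 : #A = 4 := by omega
  have hNA : ∀ i, π.nbrs (y i) (C i) = A := fun i => by
    refine eq_of_subset_of_card_le (hNsub i) ?_
    rw [card_nbrs (hCne i), hCcard, hA4]
    simp [hmiss]
  have hk : #(univ.biUnion fun i => π.miss (y i))ᶜ = 1 := by
    rw [card_compl, card_biUnion fun i _ j _ h => hdis i j h]
    simp [hmiss]
  obtain ⟨k, hk⟩ := card_eq_one.1 hk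
  have hk' : ∀ c, (∀ i, π.mate c (y i) ≠ y i) ↔ c = k := fun c => by
    have := congrArg (c ∈ ·) hk
    simpa using this
  have s : IsTri π y A k :=
    ⟨hB, hU, hC, hbig, hdy, hmiss, fun i z => by rw [← hNA i]; exact hmemN i z, hA4, (hk' k).2 rfl,
      fun c hc => by
        by_contra! h
        exact hc ((hk' c).1 h)⟩
  exact ⟨_, fun w hw => (s.mem_R_iff hG w).1 hw, s.charge hG⟩

end PCol
end PartialColoring

namespace PartialColoring
open Finset Classical

lemma sum_ncard_neighborSet {V : Type*} [Fintype V] (H : SimpleGraph V) :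
    ∑ v, (H.neighborSet v).ncard = 2 * H.edgeSet.ncard := by
  have h := H.sum_degrees_eq_twice_card_edges
  rw [Set.ncard_eq_toFinset_card', SimpleGraph.edgeFinset] at *
  rw [← h]
  refine sum_congr rfl fun v _ => ?_
  rw [Set.ncard_eq_toFinset_card', SimpleGraph.degree, SimpleGraph.neighborFinset]

variable {V : Type*} [Fintype V] {G : SimpleGraph V}

namespace PCol
variable {π : PCol G} {x₀ : V}

lemma sum_bonus_le (π : PCol G) {O : Finset V} (hO : ∀ w, w ∈ O ↔ ∃ x, w ∈ π.R x) :
    ∑ w ∈ O, π.bonus w ≤ ∑ w ∈ Oᶜ, π.col w := by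
  simp only [bonus, col, card_filter]
  rw [sum_comm, sum_comm (s := Oᶜ)]
  refine sum_le_sum fun a _ => ?_
  rw [← card_filter, ← card_filter]
  refine card_le_card_of_injOn (π.mate a) ?_ fun u _ v _ h => mate_inj.1 h
  intro w hw
  simp only [coe_filter, Set.mem_ofPred_eq, mem_compl, hO, not_exists] at hw ⊢
  refine ⟨hw.2, fun h => ?_⟩
  obtain ⟨x, hx⟩ := hw.1
  rw [π.invol] at h
  exact hw.2 x (h ▸ hx)

lemma sum_val_le (π : PCol G) {O : Finset V} (hO : ∀ w, w ∈ O ↔ ∃ x, w ∈ π.R x) :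
    ∑ w ∈ O, π.val w ≤ ∑ v, π.col v := by
  have h := π.sum_bonus_le hO
  rw [← sum_add_sum_compl O]
  simp only [val, sum_add_distrib]
  omega

/-- The graph of colored edges. -/
def colored (π : PCol G) : SimpleGraph V where
  Adj u v := u ≠ v ∧ ∃ a, π.mate a u = v
  symm := ⟨fun _ _ h => ⟨h.1.symm, h.2.imp fun _ ha => mate_eq_comm.1 ha⟩⟩
  loopless := ⟨fun _ h => h.1 rfl⟩

lemma colored_adj {u v : V} : π.colored.Adj u v ↔ u ≠ v ∧ ∃ a, π.mate a u = v := Iff.rfl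

lemma colored_le (π : PCol G) : π.colored ≤ G := by
  rintro u v ⟨hne, a, rfl⟩
  exact π.adj a u hne.symm

lemma ncard_neighborSet_colored (π : PCol G) (v : V) :
    (π.colored.neighborSet v).ncard = π.col v := by
  rw [col, ← card_image_of_injOn (f := fun a => π.mate a v), ← Set.ncard_coe_finset]
  · congr 1
    ext u
    simp only [SimpleGraph.mem_neighborSet, colored_adj, coe_image, coe_filter, mem_univ, true_and,
      Set.mem_image, Set.mem_ofPred_eq]
    constructor
    · rintro ⟨hne, a, rfl⟩; exact ⟨a, hne.symm, rfl⟩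
    · rintro ⟨a, hne, rfl⟩; exact ⟨hne.symm, a, rfl⟩
  · intro a ha b _ hab
    exact π.inj a b v hab (by simpa using ha)

lemma exists_coloring (π : PCol G) : ∃ c, IsProperEdgeColoring π.colored 7 c := by
  have h : ∀ e ∈ π.colored.edgeSet, ∃ a, ∀ v ∈ e, s(v, π.mate a v) = e := by
    intro e
    induction e with
    | h u v =>
      rintro ⟨-, a, h⟩
      obtain rfl : π.mate a u = v := h
      refine ⟨a, fun w hw => ?_⟩
      rcases Sym2.mem_iff.1 hw with rfl | rfl
      · rfl
      · rw [π.invol, Sym2.eq_swap]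
  choose! f hf using h
  refine ⟨fun e => f e, fun e _ => (f e).2, ?_⟩
  rintro e₁ h₁ e₂ h₂ hne ⟨v, hv₁, hv₂⟩ hc
  refine hne ?_
  rw [← hf e₁ h₁ v hv₁, ← hf e₂ h₂ v hv₂, Fin.ext hc]

variable (hG : ∀ v, (G.neighborSet v).ncard ≤ 7)
include hG

/-- A component of the uncolored graph is paid for by its region. -/
lemma Best.charge (hB : π.Best) (x₀ : V) :
    22 * ∑ v with π.U.Reachable x₀ v, π.d v ≤ 3 * ∑ w with w ∈ π.R x₀, π.val w := by
  have key : ∀ {x n T}, π.U.Reachable x₀ x → (∀ v, π.U.Reachable x v → v ∈ T) →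
      (∃ W : Finset V, (∀ w ∈ W, w ∈ π.R x) ∧ n ≤ ∑ w ∈ W, π.val w) →
      22 * ∑ v ∈ T, π.d v ≤ 3 * n →
      22 * ∑ v with π.U.Reachable x₀ v, π.d v ≤ 3 * ∑ w with w ∈ π.R x₀, π.val w := by
    rintro x n T hr hT ⟨W, hW, hn⟩ h
    have h1 : ∑ v with π.U.Reachable x₀ v, π.d v ≤ ∑ v ∈ T, π.d v :=
      sum_le_sum_of_subset fun v hv => hT v (hr.symm.trans (by simpa using hv))
    have h2 : ∑ w ∈ W, π.val w ≤ ∑ w with w ∈ π.R x₀, π.val w :=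
      sum_le_sum_of_subset fun w hw => by
        rw [mem_filter, R_congr hr]
        exact ⟨mem_univ w, hW w hw⟩
    omega
  by_cases h₀ : π.d x₀ = 0
  · have : ∑ v with π.U.Reachable x₀ v, π.d v = 0 := by
      refine sum_eq_zero fun v hv => ?_
      by_contra hv0
      refine not_reachable_of_d_eq_zero h₀ (fun h : x₀ = v => hv0 (h ▸ h₀)) ?_
      exact (by simpa using hv : π.U.Reachable x₀ v).symm
    rw [this]
    exact Nat.zero_le _
  rcases hB.1.1.shape hG h₀ with ⟨x, y, hr, hxy, hdx, hdy, hC⟩ |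
    ⟨x, y, w, hr, hxy, hxw, hyw, hdx, hdy, hdw, hC⟩ |
    ⟨w, u, v, t, hr, hwu, huv, hvt, hwt, hdw, hdu, hdv, hdt, hC⟩ |
    ⟨x, y, hr, hU, hy, hdx, hdy, hC⟩ | ⟨y, hr, hU, hdy, hC⟩
  · have hT : ∀ v, π.U.Reachable x v → v ∈ ({x, y} : Finset V) := fun v hv => by
      simpa using hC v hv
    have hsum : 22 * ∑ v ∈ {x, y}, π.d v ≤ 3 * 15 := by
      rw [sum_pair hxy.ne]; omega
    rcases le_total #(π.miss x) #(π.miss y) with h | h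
    · exact key hr hT (hB.charge_edge hG hxy hdx hdy h) hsum
    · exact key (hr.trans hxy.reachable) (fun v hv => hT v (hxy.reachable.trans hv))
        (hB.charge_edge hG hxy.symm hdy hdx h) hsum
  · refine key (T := {x, y, w}) hr (fun v hv => by simpa using hC v hv)
      (hB.charge_two_edges hG hxy hxw hyw hdx hdy hdw) ?_
    rw [sum_insert (by simp [hxy.ne, hxw.ne]), sum_pair hyw]
    omega
  · refine key (T := {w, u, v, t}) hr (fun v hv => by simpa using hC v hv)
      (hB.charge_path hG hwu huv hvt hwt hdw hdu hdv hdt hC) ?_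
    have h1 : w ≠ v := by rintro rfl; omega
    have h2 : u ≠ t := by rintro rfl; omega
    rw [sum_insert (by simp [hwu.ne, h1, hwt]), sum_insert (by simp [huv.ne, h2]), sum_pair hvt.ne]
    omega
  · refine key (T := insert x (univ.image y)) hr (fun v hv => ?_)
      (hB.charge_star hG hU hy hdx hdy hC) ?_
    · rcases hC v hv with rfl | ⟨i, rfl⟩ <;> simp
    · rw [sum_insert, sum_image fun i _ j _ h => hy h]
      · simp [hdx, hdy]
      · simp only [mem_image, mem_univ, true_and, not_exists]
        exact fun i h => (hU i).ne h.symm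
  · refine key (T := univ.image y) hr (fun v hv => ?_) (hB.charge_triangle hG hU hdy hC) ?_
    · obtain ⟨i, rfl⟩ := hC v hv
      simp
    · rw [sum_image]
      · simp [hdy]
      · intro i _ j _ h
        by_contra h'
        exact (hU i j h').ne h

lemma Best.sum_d_le (hB : π.Best) : 22 * ∑ v, π.d v ≤ 3 * ∑ v, π.col v := by
  set r : V → V := fun v => (π.U.connectedComponentMk v).out
  have hr : ∀ v, π.U.Reachable (r v) v := fun v =>
    SimpleGraph.ConnectedComponent.exact (Quot.out_eq _)
  have hrr : ∀ {u v}, π.U.Reachable (r u) (r v) → r u = r v := fun {u v} h => by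
    have : π.U.connectedComponentMk u = π.U.connectedComponentMk v :=
      SimpleGraph.ConnectedComponent.sound ((hr u).symm.trans (h.trans (hr v)))
    simp only [r, this]
  have h1 : ∑ v, π.d v = ∑ x ∈ univ.image r, ∑ v with r v = x, π.d v :=
    (sum_fiberwise_of_maps_to (fun v _ => mem_image_of_mem r (mem_univ v)) _).symm
  have h2 : ∀ x ∈ univ.image r, 22 * ∑ v with r v = x, π.d v ≤
      3 * ∑ w with w ∈ π.R x, π.val w := by
    intro x _
    refine le_trans (Nat.mul_le_mul_left _ (sum_le_sum_of_subset fun v hv => ?_))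
      (hB.charge hG x)
    simp only [mem_filter, mem_univ, true_and] at hv ⊢
    rw [← hv]; exact hr v
  have h3 : ∑ x ∈ univ.image r, ∑ w with w ∈ π.R x, π.val w ≤
      ∑ w with ∃ x, w ∈ π.R x, π.val w := by
    rw [← sum_biUnion]
    · refine sum_le_sum_of_subset fun w hw => ?_
      obtain ⟨x, -, hx⟩ := mem_biUnion.1 hw
      simp only [mem_filter, mem_univ, true_and] at hx ⊢
      exact ⟨x, hx⟩
    · intro x hx x' hx' hne
      obtain ⟨u, -, rfl⟩ := mem_image.1 hx
      obtain ⟨v, -, rfl⟩ := mem_image.1 hx'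
      have h := Set.disjoint_left.1 (hB.1.disjoint_R hG fun h => hne (hrr h))
      change Disjoint _ _
      rw [Finset.disjoint_left]
      intro w hw hw'
      simp only [mem_filter, mem_univ, true_and] at hw hw'
      exact h hw hw'
  have h4 := π.sum_val_le (O := {w | ∃ x, w ∈ π.R x}) (fun w => by simp)
  have h5 := sum_le_sum h2
  rw [← mul_sum, ← mul_sum, ← h1] at h5
  omega

end PCol
end PartialColoring

/-- Every simple graph of maximum degree 7 has a 7-edge-colorable subgraph with at least
`(22/25)·|E|` edges. -/
theorem stmt14 {V : Type*} [Fintype V] (G : SimpleGraph V)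
    (hdeg : ∀ v : V, (G.neighborSet v).ncard ≤ 7) :
    ∃ H : SimpleGraph V, H ≤ G ∧ (∃ c, IsProperEdgeColoring H 7 c) ∧
      (22 : ℚ) / 25 * G.edgeSet.ncard ≤ H.edgeSet.ncard := by
  obtain ⟨π, hB⟩ := PartialColoring.PCol.exists_best G
  refine ⟨π.colored, π.colored_le, π.exists_coloring, ?_⟩
  have h1 := hB.sum_d_le hdeg
  have h2 := PartialColoring.sum_ncard_neighborSet π.colored
  have h3 := PartialColoring.sum_ncard_neighborSet G
  simp only [PartialColoring.PCol.ncard_neighborSet_colored] at h2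
  have hdeg_sum : ∑ v, (G.neighborSet v).ncard = ∑ v, π.col v + ∑ v, π.d v := by
    rw [← Finset.sum_add_distrib]
    exact Finset.sum_congr rfl fun v _ => π.degree_eq v
  have h4 : 22 * G.edgeSet.ncard ≤ 25 * π.colored.edgeSet.ncard := by omega
  have h5 : (22 : ℚ) * G.edgeSet.ncard ≤ 25 * π.colored.edgeSet.ncard := by exact_mod_cast h4
  linarith
end

section
/- Let G be a simple graph of maximum degree 6 containing a 6-clique H whose edges are all uncolored under a partial 6-edge-coloring π, and suppose two vertices v, w of H have at least 5 common free colors. Then π can be extended to a proper partial 6-edge-coloring of G that colors all but at most 2 edges of H (and agrees with π on already-colored edges). -/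
/-- A partial edge coloring of `G` with colors `{1,…,k}`: only edges of `G` may be
colored, colors lie in `{1,…,k}`, and incident colored edges get distinct colors. -/
def IsPartialEdgeColoring {V : Type*} (G : SimpleGraph V) (k : ℕ) (π : Sym2 V → Option ℕ) : Prop :=
  (∀ e, π e ≠ none → e ∈ G.edgeSet) ∧
  (∀ e c, π e = some c → 1 ≤ c ∧ c ≤ k) ∧
  ∀ e₁ ∈ G.edgeSet, ∀ e₂ ∈ G.edgeSet, e₁ ≠ e₂ → (∃ v, v ∈ e₁ ∧ v ∈ e₂) →
    π e₁ = none ∨ π e₂ = none ∨ π e₁ ≠ π e₂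

/-- The set of colored edges of a partial coloring. -/
def coloredEdges {V : Type*} (π : Sym2 V → Option ℕ) : Set (Sym2 V) := {e | π e ≠ none}

/-- `π` is a partial `k`-edge-coloring of `G` maximizing the number of colored edges. -/
def MaximizesColored {V : Type*} (G : SimpleGraph V) (k : ℕ) (π : Sym2 V → Option ℕ) : Prop :=
  IsPartialEdgeColoring G k π ∧
  ∀ π', IsPartialEdgeColoring G k π' → (coloredEdges π').ncard ≤ (coloredEdges π).ncard

/-- The set of colors from `{1,…,k}` free at `v`, i.e. appearing on no edge incident to `v`. -/
def freeColors {V : Type*} (G : SimpleGraph V) (k : ℕ) (π : Sym2 V → Option ℕ) (v : V) :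
    Set ℕ :=
  {c | 1 ≤ c ∧ c ≤ k ∧ ∀ e ∈ G.edgeSet, v ∈ e → π e ≠ some c}

/-- The graph of uncolored edges. -/
def freeGraph {V : Type*} (G : SimpleGraph V) (π : Sym2 V → Option ℕ) : SimpleGraph V :=
  SimpleGraph.fromRel (fun u v => G.Adj u v ∧ π s(u, v) = none)

/-- The complete graph on `ι` has a proper partial edge coloring with colors in `κ`, with at most two
uncolored edges, in which no edge at `i` has the color `β i`. -/
def HasAlmostFullColoring {ι κ : Type*} (β : ι → κ) : Prop :=
  ∃ (c : ι → ι → Option κ) (S : Finset (Sym2 ι)),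
    (∀ i j, c i j = c j i) ∧
    (∀ i j k, j ≠ k → c i j = c i k → c i j = none) ∧
    (∀ i j, c i j ≠ some (β i)) ∧
    S.card ≤ 2 ∧ ∀ i j, i ≠ j → c i j = none → s(i, j) ∈ S

theorem HasAlmostFullColoring.of_equiv {ι ι' κ κ' : Type*} (e : ι' ≃ ι) (τ : κ ≃ κ') {β : ι → κ}
    (h : HasAlmostFullColoring fun i => τ (β (e i))) : HasAlmostFullColoring β := by
  obtain ⟨c, S, hsymm, hproper, havoid, hcard, hS⟩ := h
  refine ⟨fun i j => (c (e.symm i) (e.symm j)).map τ.symm,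
    S.map e.toEmbedding.sym2Map, fun i j => by simp only [hsymm], ?_, ?_, by simpa, ?_⟩
  · intro i j k hjk h
    have := hproper (e.symm i) (e.symm j) (e.symm k) (by simpa)
      (Option.map_injective τ.symm.injective h)
    simp [this]
  · intro i j h
    obtain ⟨a, ha, hab⟩ := Option.map_eq_some_iff.1 h
    apply havoid (e.symm i) (e.symm j)
    simp [ha, ← hab]
  · intro i j hij h
    have := hS (e.symm i) (e.symm j) (by simpa) (by simpa using h)
    exact Finset.mem_map.2 ⟨_, this, by simp⟩

/-- A proper edge coloring of `K₆` by the colors `0, …, 4` (the diagonal entries are irrelevant). -/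
def sixCliqueFactorization : Fin 6 → Fin 6 → Fin 6 :=
  ![![5, 2, 1, 3, 0, 4],
    ![2, 5, 4, 1, 3, 0],
    ![1, 4, 5, 0, 2, 3],
    ![3, 1, 0, 5, 4, 2],
    ![0, 3, 2, 4, 5, 1],
    ![4, 0, 3, 2, 1, 5]]

/-- Modify `sixCliqueFactorization` on the edges that conflict with `β`: the edges `{2, 3}` and
`{4, 5}` are recolored with `5` if possible, the others are uncolored. -/
def recoloredFactorization (β : Fin 6 → Fin 6) (i j : Fin 6) : Option (Fin 6) :=
  if i = j then none
  else if sixCliqueFactorization i j = β i ∨ sixCliqueFactorization i j = β j then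
    if i ≠ 0 ∧ i ≠ 1 ∧ i / 2 = j / 2 ∧ β i ≠ 5 ∧ β j ≠ 5 then some 5 else none
  else some (sixCliqueFactorization i j)

theorem hasAlmostFullColoring_normalized (b₂ b₃ b₄ b₅ : Fin 6)
    (h : b₂ = 5 ∧ b₃ = 5 ∨ b₂ = 0 ∧ b₃ = 0 ∨ b₂ = 0 ∧ b₄ = 1 ∧ b₃ ≠ 5) :
    HasAlmostFullColoring ![5, 5, b₂, b₃, b₄, b₅] := by
  have key : ∀ b₂ b₃ b₄ b₅ : Fin 6,
      (b₂ = 5 ∧ b₃ = 5 ∨ b₂ = 0 ∧ b₃ = 0 ∨ b₂ = 0 ∧ b₄ = 1 ∧ b₃ ≠ 5) →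
      let β : Fin 6 → Fin 6 := ![5, 5, b₂, b₃, b₄, b₅]
      let c := recoloredFactorization β
      (∀ i j, c i j = c j i) ∧ (∀ i j k, j ≠ k → c i j = c i k → c i j = none) ∧
      (∀ i j, c i j ≠ some (β i)) ∧
      (Finset.univ.filter fun p : Fin 6 × Fin 6 => p.1 < p.2 ∧ c p.1 p.2 = none).card ≤ 2 := by
    decide +kernel
  obtain ⟨hsymm, hproper, havoid, hcard⟩ := key b₂ b₃ b₄ b₅ h
  refine ⟨_, _, hsymm, hproper, havoid,
    (Finset.card_image_le (f := fun p : Fin 6 × Fin 6 => s(p.1, p.2))).trans hcard, ?_⟩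
  intro i j hij h
  rw [Finset.mem_image]
  rcases lt_or_gt_of_ne hij with hlt | hlt
  · exact ⟨(i, j), by simp [hlt, h], rfl⟩
  · exact ⟨(j, i), by simp [hlt, hsymm j i, h], Sym2.eq_swap⟩

theorem hasAlmostFullColoring_of_injective {ι : Type*} [Fintype ι] (hι : Fintype.card ι = 6)
    (β : ι → Fin 6) (x : Fin 6 → ι) (hx : x.Injective) (τ : Equiv.Perm (Fin 6))
    (h₀ : τ (β (x 0)) = 5) (h₁ : τ (β (x 1)) = 5)
    (h : τ (β (x 2)) = 5 ∧ τ (β (x 3)) = 5 ∨ τ (β (x 2)) = 0 ∧ τ (β (x 3)) = 0 ∨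
      τ (β (x 2)) = 0 ∧ τ (β (x 4)) = 1 ∧ τ (β (x 3)) ≠ 5) :
    HasAlmostFullColoring β := by
  have hbij : x.Bijective := (Fintype.bijective_iff_injective_and_card x).2 ⟨hx, by simp [hι]⟩
  apply HasAlmostFullColoring.of_equiv (Equiv.ofBijective x hbij) τ
  convert hasAlmostFullColoring_normalized _ _ (τ (β (x 4))) (τ (β (x 5))) h using 1
  funext i
  fin_cases i <;> simp [h₀, h₁]

theorem exists_perm_fin_six {a b c : Fin 6} (hab : a ≠ b) (hac : a ≠ c) (hbc : b ≠ c) :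
    ∃ τ : Equiv.Perm (Fin 6), τ a = 5 ∧ τ b = 0 ∧ τ c = 1 := by
  have hx : Function.Injective ![a, b, c] := by
    intro i j
    fin_cases i <;> fin_cases j <;> simp [hab, hac, hbc, hab.symm, hac.symm, hbc.symm]
  have hy : Function.Injective (![5, 0, 1] : Fin 3 → Fin 6) := by decide
  obtain ⟨τ, hτ⟩ := (Equiv.Perm.isMultiplyPretransitive (Fin 6) 3).exists_smul_eq ⟨_, hx⟩ ⟨_, hy⟩
  exact ⟨τ, DFunLike.congr_fun hτ 0, DFunLike.congr_fun hτ 1, DFunLike.congr_fun hτ 2⟩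

theorem hasAlmostFullColoring_of_eq {ι : Type*} [Fintype ι] [DecidableEq ι]
    (hι : Fintype.card ι = 6) (β : ι → Fin 6) {v w : ι} (hvw : v ≠ w) (hβ : β v = β w) :
    HasAlmostFullColoring β := by
  have hinj : ∀ {x₂ x₃ x₄ x₅ : ι}, [v, w, x₂, x₃, x₄, x₅].Nodup →
      Function.Injective ![v, w, x₂, x₃, x₄, x₅] := fun {x₂ x₃ x₄ x₅} h => by
    rw [← List.nodup_ofFn]
    simpa using h
  have hS : (Finset.univ \ {v, w}).card = 4 := by
    rw [Finset.card_sdiff_of_subset (Finset.subset_univ _), Finset.card_univ, hι,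
      Finset.card_pair hvw]
  set S : Finset ι := Finset.univ \ {v, w} with hSdef
  have hmem : ∀ x, x ∈ S ↔ x ≠ v ∧ x ≠ w := by simp [hSdef]
  by_cases hpair : ∃ x ∈ S, ∃ y ∈ S, x ≠ y ∧ β x = β y
  · obtain ⟨x, hx, y, hy, hxy, hβxy⟩ := hpair
    have hcard : ((S.erase x).erase y).card = 2 := by
      rw [Finset.card_erase_of_mem (by simp [hy, hxy.symm]), Finset.card_erase_of_mem hx, hS]
    obtain ⟨z, t, hzt, hset⟩ := Finset.card_eq_two.1 hcard
    have hz : z ∈ (S.erase x).erase y := by simp [hset]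
    have ht : t ∈ (S.erase x).erase y := by simp [hset]
    simp only [Finset.mem_erase, hmem] at hx hy hz ht
    have hx_inj := hinj (x₂ := x) (x₃ := y) (x₄ := z) (x₅ := t) (by simp; grind)
    by_cases hc : β x = β v
    · exact hasAlmostFullColoring_of_injective hι β _ hx_inj (Equiv.swap (β v) 5)
        (by simp) (by simp [← hβ]) (Or.inl (by simp [← hβxy, hc]))
    · obtain ⟨c, hc₁, hc₂⟩ : ∃ c : Fin 6, c ≠ β v ∧ c ≠ β x := by
        generalize β v = a; generalize β x = b
        revert a b; decide
      obtain ⟨τ, h₅, h₀, -⟩ := exists_perm_fin_six (Ne.symm hc) hc₁.symm hc₂.symm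
      exact hasAlmostFullColoring_of_injective hι β _ hx_inj τ
        (by simp [h₅]) (by simp [← hβ, h₅]) (Or.inr (Or.inl (by simp [← hβxy, h₀])))
  · push Not at hpair
    obtain ⟨t, ht, hβt⟩ : ∃ t ∈ S, ∀ x ∈ S, x ≠ t → β x ≠ β v := by
      by_cases h : ∃ t ∈ S, β t = β v
      · obtain ⟨t, ht, htv⟩ := h
        exact ⟨t, ht, fun x hx hxt hxv => hpair x hx t ht hxt (hxv.trans htv.symm)⟩
      · push Not at h
        obtain ⟨t, ht⟩ : S.Nonempty := Finset.card_pos.1 (by omega)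
        exact ⟨t, ht, fun x hx _ => h x hx⟩
    have hcard : (S.erase t).card = 3 := by rw [Finset.card_erase_of_mem ht, hS]
    obtain ⟨x, y, z, hxy, hxz, hyz, hset⟩ := Finset.card_eq_three.1 hcard
    have hx : x ∈ S.erase t := by simp [hset]
    have hy : y ∈ S.erase t := by simp [hset]
    have hz : z ∈ S.erase t := by simp [hset]
    rw [Finset.mem_erase] at hx hy hz
    have hβx := hβt x hx.2 hx.1
    have hβy := hβt y hy.2 hy.1
    have hβz := hβt z hz.2 hz.1
    obtain ⟨τ, h₅, h₀, h₁⟩ :=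
      exists_perm_fin_six hβx.symm hβz.symm (hpair x hx.2 z hz.2 hxz)
    simp only [hmem] at hx hy hz ht
    have hx_inj := hinj (x₂ := x) (x₃ := y) (x₄ := z) (x₅ := t) (by simp; grind)
    refine hasAlmostFullColoring_of_injective hι β _ hx_inj τ
      (by simp [h₅]) (by simp [← hβ, h₅]) (Or.inr (Or.inr ⟨by simp [h₀], by simp [h₁], ?_⟩))
    simpa [← h₅] using hβy

/-- A vertex of an uncolored `6`-clique in a graph of maximum degree `6` sees at most one color. -/
theorem IsPartialEdgeColoring.exists_blocked_color {V : Type*} [Fintype V] {G : SimpleGraph V}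
    (hdeg : ∀ v : V, (G.neighborSet v).ncard ≤ 6)
    {π : Sym2 V → Option ℕ} (hπ : IsPartialEdgeColoring G 6 π)
    {H : Finset V} (hcard : H.card = 6)
    (hclique : ∀ u ∈ H, ∀ z ∈ H, u ≠ z → G.Adj u z)
    (hunc : ∀ u ∈ H, ∀ z ∈ H, u ≠ z → π s(u, z) = none) {u : V} (hu : u ∈ H) :
    ∃ b : Fin 6, ∀ z c, π s(u, z) = some c → c = b + 1 := by
  classical
  by_cases h : ∃ z c, π s(u, z) = some c
  swap
  · push Not at h
    exact ⟨0, fun z c hc => absurd hc (h z c)⟩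
  obtain ⟨z, c, hc⟩ := h
  have hrange := hπ.2.1 _ _ hc
  refine ⟨⟨c - 1, by omega⟩, fun z' c' hc' => ?_⟩
  have hout : ∀ y d, π s(u, y) = some d → y ∈ G.neighborSet u \ ↑(H.erase u) := by
    intro y d hd
    have hadj : G.Adj u y := hπ.1 s(u, y) (by simp [hd])
    refine ⟨hadj, fun hy => ?_⟩
    have hy' := Finset.mem_erase.1 (Finset.mem_coe.1 hy)
    simp [hunc u hu y hy'.2 hy'.1.symm] at hd
  have hle : (G.neighborSet u \ ↑(H.erase u)).ncard ≤ 1 := by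
    have hsub : (↑(H.erase u) : Set V) ⊆ G.neighborSet u := fun y hy => by
      have hy' := Finset.mem_erase.1 (Finset.mem_coe.1 hy)
      exact hclique u hu y hy'.2 hy'.1.symm
    rw [Set.ncard_sdiff hsub (Set.toFinite _), Set.ncard_coe_finset,
      Finset.card_erase_of_mem hu, hcard]
    have := hdeg u
    omega
  have hzz := (Set.ncard_le_one (Set.toFinite _)).1 hle z (hout z c hc) z' (hout z' c' hc')
  subst hzz
  have hcc : c = c' := Option.some_injective _ (hc.symm.trans hc')
  simp only
  omega

/-- Two vertices with five common free colors out of six see at most one color altogether. -/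
theorem exists_common_blocked_color {V : Type*} {G : SimpleGraph V} {π : Sym2 V → Option ℕ}
    (hπ : IsPartialEdgeColoring G 6 π) {v w : V}
    (hfree : 5 ≤ (freeColors G 6 π v ∩ freeColors G 6 π w).ncard) :
    ∃ b : Fin 6, ∀ u, u = v ∨ u = w → ∀ z c, π s(u, z) = some c → c = b + 1 := by
  set T := freeColors G 6 π v ∩ freeColors G 6 π w
  have hsub : T ⊆ ↑(Finset.Icc 1 6) := fun c hc => by
    simpa using ⟨hc.1.1, hc.1.2.1⟩
  have hle : ((↑(Finset.Icc 1 6) : Set ℕ) \ T).ncard ≤ 1 := by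
    rw [Set.ncard_sdiff hsub ((Finset.finite_toSet _).subset hsub), Set.ncard_coe_finset,
      Nat.card_Icc]
    omega
  have hout : ∀ u, u = v ∨ u = w → ∀ z c, π s(u, z) = some c →
      c ∈ (↑(Finset.Icc 1 6) : Set ℕ) \ T := by
    intro u hu z c hc
    have hedge : s(u, z) ∈ G.edgeSet := hπ.1 _ (by simp [hc])
    refine ⟨by simpa using hπ.2.1 _ _ hc, fun hcT => ?_⟩
    rcases hu with rfl | rfl
    · exact hcT.1.2.2 _ hedge (Sym2.mem_mk_left _ _) hc
    · exact hcT.2.2.2 _ hedge (Sym2.mem_mk_left _ _) hc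
  rcases ((↑(Finset.Icc 1 6) : Set ℕ) \ T).eq_empty_or_nonempty with hempty | ⟨c₀, hc₀⟩
  · exact ⟨0, fun u hu z c hc => absurd (hout u hu z c hc) (hempty ▸ Set.notMem_empty c)⟩
  · have hrange : 1 ≤ c₀ ∧ c₀ ≤ 6 := by simpa using hc₀.1
    refine ⟨⟨c₀ - 1, by omega⟩, fun u hu z c hc => ?_⟩
    have := (Set.ncard_le_one ((Finset.finite_toSet _).sdiff)).1 hle c (hout u hu z c hc) c₀ hc₀
    simp only
    omega

/-- A partial coloring of the edges inside `H`, compatible with the colors of `π` seen from `H`,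
extends `π`. -/
theorem IsPartialEdgeColoring.exists_extension {V : Type*} {G : SimpleGraph V}
    {π : Sym2 V → Option ℕ} (hπ : IsPartialEdgeColoring G 6 π) {H : Finset V}
    (hclique : ∀ u ∈ H, ∀ z ∈ H, u ≠ z → G.Adj u z)
    (hunc : ∀ u ∈ H, ∀ z ∈ H, u ≠ z → π s(u, z) = none)
    {β : H → Fin 6} (hβ : ∀ (u : H) z c, π s(↑u, z) = some c → c = β u + 1)
    (h : HasAlmostFullColoring β) :
    ∃ π' : Sym2 V → Option ℕ, IsPartialEdgeColoring G 6 π' ∧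
      (∀ e, π e ≠ none → π' e = π e) ∧
      {e : Sym2 V | (∃ u ∈ H, ∃ z ∈ H, u ≠ z ∧ e = s(u, z)) ∧ π' e = none}.ncard ≤ 2 := by
  classical
  obtain ⟨c, S, hsymm, hproper, havoid, hcard, hS⟩ := h
  let f : V → V → Option ℕ := fun a b =>
    if h : (a ∈ H ∧ b ∈ H) ∧ a ≠ b then (c ⟨a, h.1.1⟩ ⟨b, h.1.2⟩).map fun i : Fin 6 => (i : ℕ) + 1
    else π s(a, b)
  have hf : ∀ a b, f a b = f b a := by
    intro a b
    simp only [f, and_comm (a := a ∈ H), ne_comm (a := a), Sym2.eq_swap (a := a)]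
    split_ifs with h
    · rw [hsymm]
    · rfl
  have hin : ∀ (a b : H), a ≠ b → f a b = (c a b).map fun i : Fin 6 => (i : ℕ) + 1 := by
    intro a b hab
    have : (a : V) ≠ b := fun h => hab (Subtype.ext h)
    simp [f, this]
  have hcases : ∀ a b : V, (∃ a' b' : H, a' ≠ b' ∧ ↑a' = a ∧ ↑b' = b ∧ π s(a, b) = none ∧
      f a b = (c a' b').map fun i : Fin 6 => (i : ℕ) + 1) ∨ f a b = π s(a, b) := by
    intro a b
    by_cases h : (a ∈ H ∧ b ∈ H) ∧ a ≠ b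
    · have hne : (⟨a, h.1.1⟩ : H) ≠ ⟨b, h.1.2⟩ := by simpa using h.2
      exact Or.inl ⟨⟨a, h.1.1⟩, ⟨b, h.1.2⟩, hne, rfl, rfl, hunc a h.1.1 b h.1.2 h.2, hin _ _ hne⟩
    · exact Or.inr (dif_neg h)
  have hinj : Function.Injective fun i : Fin 6 => (i : ℕ) + 1 := fun i j h => by
    simpa [Fin.ext_iff] using h
  have hmixed : ∀ (a b : H) (z : V) (k : ℕ),
      ((c a b).map fun i : Fin 6 => (i : ℕ) + 1) = some k → π s(↑a, z) ≠ some k := by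
    intro a b z k hk hz
    obtain ⟨i, hi, hik⟩ := Option.map_eq_some_iff.1 hk
    have hia : i = β a := hinj (hik.trans (hβ a z k hz))
    exact havoid a b (hia ▸ hi)
  have hloc : ∀ (u y z : V) (k : ℕ), y ≠ z → f u y = some k → f u z ≠ some k := by
    intro u y z k hyz hy hz
    rcases hcases u y with ⟨a, b, hab, ha, rfl, -, h₁⟩ | h₁ <;>
    rcases hcases u z with ⟨a', b', hab', ha', rfl, -, h₂⟩ | h₂
    · subst ha
      obtain rfl := Subtype.ext ha'
      have heq := Option.map_injective hinj (h₁.symm.trans (hy.trans (hz.symm.trans h₂)))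
      have := hproper _ _ _ (fun h => hyz (congrArg _ h)) heq
      simp [h₁, this] at hy
    · subst ha
      exact hmixed a b z k (h₁ ▸ hy) (h₂ ▸ hz)
    · subst ha'
      exact hmixed a' b' y k (h₂ ▸ hz) (h₁ ▸ hy)
    · have hy' := h₁.symm.trans hy
      have hz' := h₂.symm.trans hz
      rcases hπ.2.2 s(u, y) (hπ.1 _ (by simp [hy'])) s(u, z) (hπ.1 _ (by simp [hz']))
        (fun h => hyz (Sym2.congr_right.1 h)) ⟨u, by simp, by simp⟩ with h | h | h
      · simp [hy'] at h
      · simp [hz'] at h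
      · exact h (hy'.trans hz'.symm)
  refine ⟨Sym2.lift ⟨f, hf⟩, ⟨?_, ?_, ?_⟩, ?_, ?_⟩
  · intro e
    induction e with | _ a b
    intro he
    rw [Sym2.lift_mk] at he
    rcases hcases a b with ⟨a', b', hab, rfl, rfl, -, -⟩ | h
    · exact hclique _ a'.2 _ b'.2 fun h => hab (Subtype.ext h)
    · exact hπ.1 _ (h ▸ he)
  · intro e
    induction e with | _ a b
    intro k hk
    rw [Sym2.lift_mk] at hk
    rcases hcases a b with ⟨a', b', -, -, -, -, h⟩ | h
    · obtain ⟨i, -, rfl⟩ := Option.map_eq_some_iff.1 (h.symm.trans hk)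
      have := i.2
      omega
    · exact hπ.2.1 _ _ (h.symm.trans hk)
  · rintro e₁ - e₂ - hne ⟨u, ⟨y, rfl⟩, ⟨z, rfl⟩⟩
    simp only [Sym2.lift_mk]
    have hyz : y ≠ z := fun h => hne (by rw [h])
    rcases hy : f u y with _ | k
    · exact Or.inl rfl
    · exact Or.inr (Or.inr (hloc u y z k hyz hy).symm)
  · intro e
    induction e with | _ a b
    intro he
    rw [Sym2.lift_mk]
    rcases hcases a b with ⟨-, -, -, -, -, h, -⟩ | h
    · exact absurd h he
    · exact h
  · refine (Set.ncard_le_ncard (t := ↑(S.image (Sym2.map Subtype.val))) ?_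
      (Finset.finite_toSet _)).trans ?_
    · rintro _ ⟨⟨a, ha, b, hb, hab, rfl⟩, hnone⟩
      have hne : (⟨a, ha⟩ : H) ≠ ⟨b, hb⟩ := by simpa using hab
      rw [Sym2.lift_mk] at hnone
      have := hS _ _ hne (Option.map_eq_none_iff.1 ((hin _ _ hne).symm.trans hnone))
      exact Finset.mem_coe.2 (Finset.mem_image.2 ⟨_, this, rfl⟩)
    · rw [Set.ncard_coe_finset]
      exact Finset.card_image_le.trans hcard

/-- If a simple graph of maximum degree 6 contains a 6-clique all of whose edges are
uncolored, and two clique vertices share at least 5 free colors, then the partial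
6-edge-coloring extends so that at most 2 clique edges remain uncolored. -/
theorem stmt19 {V : Type*} [Fintype V] (G : SimpleGraph V)
    (hdeg : ∀ v : V, (G.neighborSet v).ncard ≤ 6)
    (π : Sym2 V → Option ℕ) (hπ : IsPartialEdgeColoring G 6 π)
    (H : Finset V) (hcard : H.card = 6)
    (hclique : ∀ u ∈ H, ∀ z ∈ H, u ≠ z → G.Adj u z)
    (hunc : ∀ u ∈ H, ∀ z ∈ H, u ≠ z → π s(u, z) = none)
    (v w : V) (hv : v ∈ H) (hw : w ∈ H) (hvw : v ≠ w)
    (hfree : 5 ≤ (freeColors G 6 π v ∩ freeColors G 6 π w).ncard) :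
    ∃ π' : Sym2 V → Option ℕ, IsPartialEdgeColoring G 6 π' ∧
      (∀ e, π e ≠ none → π' e = π e) ∧
      {e : Sym2 V | (∃ u ∈ H, ∃ z ∈ H, u ≠ z ∧ e = s(u, z)) ∧ π' e = none}.ncard ≤ 2 := by
  classical
  obtain ⟨b₀, hb₀⟩ := exists_common_blocked_color hπ hfree
  have hblocked (u : H) := hπ.exists_blocked_color hdeg hcard hclique hunc u.2
  choose b hb using hblocked
  let β : H → Fin 6 := fun u => if (u : V) = v ∨ (u : V) = w then b₀ else b u
  have hβ : ∀ (u : H) z c, π s(↑u, z) = some c → c = β u + 1 := by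
    intro u z c hc
    by_cases hu : (u : V) = v ∨ (u : V) = w
    · simpa only [β, if_pos hu] using hb₀ u hu z c hc
    · simpa only [β, if_neg hu] using hb u z c hc
  refine hπ.exists_extension hclique hunc hβ ?_
  exact hasAlmostFullColoring_of_eq (by simpa using hcard) β (v := ⟨v, hv⟩) (w := ⟨w, hw⟩)
    (by simpa using hvw) (by simp [β])
end
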